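/- Let n ∈ S^{d−1}. For any φ ∈ C^∞(𝕋^d;ℝ^m), the lifted Dirichlet problem with data φ has a smooth solution V = V(θ,t) on 𝕋^d×[0,∞) satisfying, for every multi-index α and every integer j ≥ 0, (∫_0^∞ ∫_{𝕋^d} (|N^T∇_θ ∂_θ^α ∂_t^j V|² + |∂_θ^α ∂_t^{1+j} V|²) dθ dt)^{1/2} ≤ C ‖φ‖_{C^{|α|+j+1}(𝕋^d)}, where C depends only on d, m, |α|, j and A. -/

import Mathlib

open MeasureTheory
open scoped BigOperators Topology

noncomputable section

/-- `ℝ^d` with the Euclidean norm. -/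
abbrev Euc (d : ℕ) := EuclideanSpace ℝ (Fin d)

/-- The dot product on `ℝ^d`. -/
def dotp {d : ℕ} (x y : Euc d) : ℝ := ∑ i, x i * y i

/-- The partial derivative `∂f/∂x_i`. -/
def pder {d : ℕ} (i : Fin d) (f : Euc d → ℝ) (x : Euc d) : ℝ :=
  fderiv ℝ f x (EuclideanSpace.single i 1)

/-- An integer vector, viewed as an element of `ℝ^d`. -/
def zvec {d : ℕ} (z : Fin d → ℤ) : Euc d :=
  (WithLp.equiv 2 (∀ _ : Fin d, ℝ)).symm fun k => (z k : ℝ)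

/-- A coefficient tensor `A = (a_{ij}^{αβ})` that is smooth, 1-periodic and uniformly
elliptic with ellipticity constant `lam`. -/
structure Coeffs (d m : ℕ) : Type where
  a : Fin d → Fin d → Fin m → Fin m → Euc d → ℝ
  lam : ℝ
  lam_pos : 0 < lam
  smooth : ∀ i j α β, ContDiff ℝ (⊤ : ℕ∞) (a i j α β)
  periodic : ∀ i j α β (x : Euc d) (z : Fin d → ℤ), a i j α β (x + zvec z) = a i j α β x
  ell_low : ∀ (x : Euc d) (ξ : Fin m → Fin d → ℝ),
    lam * (∑ α, ∑ i, ξ α i ^ 2) ≤ ∑ i, ∑ j, ∑ α, ∑ β, a i j α β x * ξ α i * ξ β j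
  ell_up : ∀ (x : Euc d) (ξ : Fin m → Fin d → ℝ),
    ∑ i, ∑ j, ∑ α, ∑ β, a i j α β x * ξ α i * ξ β j ≤ lam⁻¹ * (∑ α, ∑ i, ξ α i ^ 2)

/-- The adjoint coefficients `a*_{ij}^{αβ} = a_{ji}^{βα}`. -/
def astar {d m : ℕ} (A : Coeffs d m) : Fin d → Fin d → Fin m → Fin m → Euc d → ℝ :=
  fun i j α β => A.a j i β α

/-- `u` solves the second order elliptic system `-∂_i (c_{ij}^{αβ} ∂_j u^β) = 0` in `Ω`. -/
def IsSolOf {d m : ℕ} (c : Fin d → Fin d → Fin m → Fin m → Euc d → ℝ)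
    (Ω : Set (Euc d)) (u : Euc d → Fin m → ℝ) : Prop :=
  ∀ x ∈ Ω, ∀ α : Fin m,
    ∑ i, pder i (fun y => ∑ j, ∑ β, c i j α β y * pder j (fun w => u w β) y) x = 0

/-- The half-space `ℍ^d_n(s) = {x : x·n < -s}`. -/
def halfSpace {d : ℕ} (n : Euc d) (s : ℝ) : Set (Euc d) := {x | dotp x n < -s}

/-- The hyperplane `{x : x·n = -s}`, the boundary of `ℍ^d_n(s)`. -/
def hyperplane {d : ℕ} (n : Euc d) (s : ℝ) : Set (Euc d) := {x | dotp x n = -s}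

/-- A (componentwise) bounded `ℝ^m`-valued function. -/
def IsBddFn {d m : ℕ} (u : Euc d → Fin m → ℝ) : Prop := ∃ C : ℝ, ∀ x α, |u x α| ≤ C

/-- `u` is a solution of the Dirichlet problem in the half-space `ℍ^d_n(s)` with boundary
data `φ`, for the operator with coefficients `c`:  it is smooth inside, continuous up to the
boundary, solves the system inside and attains the boundary value `φ`. -/
def IsDirSol {d m : ℕ} (c : Fin d → Fin d → Fin m → Fin m → Euc d → ℝ)
    (n : Euc d) (s : ℝ) (φ u : Euc d → Fin m → ℝ) : Prop :=
  ContDiffOn ℝ (⊤ : ℕ∞) u (halfSpace n s) ∧ ContinuousOn u (closure (halfSpace n s)) ∧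
    IsSolOf c (halfSpace n s) u ∧ ∀ x ∈ hyperplane n s, u x = φ x

/-- The index `d-1`, the "last" coordinate direction, corresponding to the `t` variable in
the lifted problems. -/
def lastIdx (d : ℕ) (hd : 0 < d) : Fin d := ⟨d - 1, Nat.sub_lt hd Nat.one_pos⟩

/-- The matrix `M` has orthonormal columns. -/
def IsOrtho {d : ℕ} (M : Fin d → Fin d → ℝ) : Prop :=
  ∀ k l, ∑ i, M i k * M i l = (if k = l then (1 : ℝ) else 0)

/-- The last column of `M` is `-n`, i.e. `M = (N, -n)`. -/
def LastColNeg {d : ℕ} (hd : 0 < d) (n : Euc d) (M : Fin d → Fin d → ℝ) : Prop :=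
  ∀ i, M i (lastIdx d hd) = -(n i)

/-- The `k`-th component of the lifted gradient `(Nᵀ∇_θ, ∂_t)`: for `k ≠ d-1` it is the
`k`-th entry of `Nᵀ∇_θ` (where `N` consists of the first `d-1` columns of `M`), and for
`k = d-1` it is `∂_t`. -/
def liftD {d : ℕ} (hd : 0 < d) (M : Fin d → Fin d → ℝ) (k : Fin d)
    (f : Euc d → ℝ → ℝ) (θ : Euc d) (t : ℝ) : ℝ :=
  if k = lastIdx d hd then deriv (f θ) t
  else ∑ i, M i k * pder i (fun θ' => f θ' t) θ

/-- The coefficients `B_n(θ,t) = Mᵀ A*(θ - tn) M` of the lifted problem. -/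
def liftB {d m : ℕ} (A : Coeffs d m) (n : Euc d) (M : Fin d → Fin d → ℝ)
    (k l : Fin d) (α β : Fin m) (θ : Euc d) (t : ℝ) : ℝ :=
  ∑ i, ∑ j, M i k * astar A i j α β (θ - t • n) * M j l

/-- The α-component of `(Nᵀ∇_θ, ∂_t) · B_n (Nᵀ∇_θ, ∂_t) V` at `(θ,t)`. -/
def liftOp {d m : ℕ} (hd : 0 < d) (A : Coeffs d m) (n : Euc d) (M : Fin d → Fin d → ℝ)
    (V : Euc d → ℝ → Fin m → ℝ) (α : Fin m) (θ : Euc d) (t : ℝ) : ℝ :=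
  ∑ k, liftD hd M k
    (fun a b => ∑ l, ∑ β, liftB A n M k l α β a b * liftD hd M l (fun a' b' => V a' b' β) a b)
    θ t

/-- `V` solves the lifted Dirichlet problem in `𝕋^d × (0,∞)` with Dirichlet data `φ`:
`-(Nᵀ∇_θ, ∂_t) · B_n (Nᵀ∇_θ, ∂_t) V = 0` for `t > 0` and `V(θ,0) = φ(θ)`.  (Functions on
`𝕋^d` are identified with `ℤ^d`-periodic functions on `ℝ^d`; the solution, which is smooth
up to the boundary, is represented by a smooth function on `ℝ^d × ℝ`.) -/
structure IsLiftedDirSol {d m : ℕ} (hd : 0 < d) (A : Coeffs d m) (n : Euc d)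
    (M : Fin d → Fin d → ℝ) (φ : Euc d → Fin m → ℝ) (V : Euc d → ℝ → Fin m → ℝ) : Prop where
  smooth : ContDiff ℝ (⊤ : ℕ∞) (fun p : Euc d × ℝ => V p.1 p.2)
  periodic : ∀ (θ : Euc d) (z : Fin d → ℤ) (t : ℝ), V (θ + zvec z) t = V θ t
  eqn : ∀ (θ : Euc d) (t : ℝ), 0 < t → ∀ α, liftOp hd A n M V α θ t = 0
  bc : ∀ θ, V θ 0 = φ θ

/-- `U` solves the lifted Neumann problem in `𝕋^d × (0,∞)` with Neumann data `g`:
`-(Nᵀ∇_θ, ∂_t) · B_n (Nᵀ∇_θ, ∂_t) U = 0` for `t > 0` and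
`-e_{d+1} · B_n (Nᵀ∇_θ, ∂_t) U = g` at `t = 0`. -/
structure IsLiftedNeuSol {d m : ℕ} (hd : 0 < d) (A : Coeffs d m) (n : Euc d)
    (M : Fin d → Fin d → ℝ) (g : Euc d → Fin m → ℝ) (U : Euc d → ℝ → Fin m → ℝ) : Prop where
  smooth : ContDiff ℝ (⊤ : ℕ∞) (fun p : Euc d × ℝ => U p.1 p.2)
  periodic : ∀ (θ : Euc d) (z : Fin d → ℤ) (t : ℝ), U (θ + zvec z) t = U θ t
  eqn : ∀ (θ : Euc d) (t : ℝ), 0 < t → ∀ α, liftOp hd A n M U α θ t = 0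
  bc : ∀ (θ : Euc d) (α : Fin m),
    -(∑ l, ∑ β, liftB A n M (lastIdx d hd) l α β θ 0 *
        liftD hd M l (fun a b => U a b β) θ 0) = g θ α

/-- `j`-th derivative in `t`. -/
def dtj {d : ℕ} (j : ℕ) (f : Euc d → ℝ → ℝ) : Euc d → ℝ → ℝ := fun θ t => deriv^[j] (f θ) t

/-- partial derivative in `θ_i`. -/
def dth {d : ℕ} (i : Fin d) (f : Euc d → ℝ → ℝ) : Euc d → ℝ → ℝ :=
  fun θ t => pder i (fun a => f a t) θ

/-- iterated partial derivative `∂_θ^α` for the multi-index given by the list `l`. -/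
def dthMulti {d : ℕ} (l : List (Fin d)) (f : Euc d → ℝ → ℝ) : Euc d → ℝ → ℝ := l.foldr dth f

/-- The `C^k(𝕋^d)` norm of a (periodic) function. -/
def CkNorm {d m : ℕ} (k : ℕ) (φ : Euc d → Fin m → ℝ) : ℝ :=
  ∑ j ∈ Finset.range (k + 1), ⨆ x : Euc d, ‖iteratedFDeriv ℝ j φ x‖

/-- The fundamental cell `[0,1)^d` of `𝕋^d = ℝ^d/ℤ^d`. -/
def unitCell (d : ℕ) : Set (Euc d) := {θ | ∀ i, 0 ≤ θ i ∧ θ i < 1}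

/-- `n` satisfies the Diophantine condition `|(I - n⊗n)ξ| ≥ κ|ξ|^{-2}` for all
`ξ ∈ ℤ^d \ {0}` (stated in squared form), with constant `κ > 0`. -/
def IsDioph {d : ℕ} (n : Euc d) (κ : ℝ) : Prop :=
  0 < κ ∧ ∀ ξ : Fin d → ℤ, ξ ≠ 0 →
    κ ^ 2 * ((∑ i, ((ξ i : ℝ)) ^ 2) ^ 2)⁻¹ ≤
      ∑ i, ((ξ i : ℝ) - (∑ j, (ξ j : ℝ) * n j) * n i) ^ 2

/-- The "tangential" index set: all lifted directions except the last (`t`) direction;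
these correspond to the components of `Nᵀ∇_θ`. -/
def tanIdx (d : ℕ) (hd : 0 < d) : Finset (Fin d) :=
  Finset.univ.filter fun k => k ≠ lastIdx d hd


section
open MeasureTheory
open scoped BigOperators Topology
set_option linter.all false
set_option linter.deprecated false

/-- linear functional `y ↦ 2π k·y`. -/
def kd {d : ℕ} (k : Fin d → ℤ) : Euc d →L[ℝ] ℝ :=
  ∑ j, (2 * Real.pi * (k j : ℝ)) • (EuclideanSpace.proj j : Euc d →L[ℝ] ℝ)

lemma kd_apply {d : ℕ} (k : Fin d → ℤ) (y : Euc d) :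
    kd k y = ∑ j, 2 * Real.pi * (k j : ℝ) * y j := by
  simp [kd, ContinuousLinearMap.sum_apply]

/-- the character `exp(2πi k·y)`. -/
def ek {d : ℕ} (k : Fin d → ℤ) (y : Euc d) : ℂ := Complex.exp ((kd k y : ℝ) * Complex.I)

section ekfacts
variable {d : ℕ}

lemma kd_zero : kd (0 : Fin d → ℤ) = 0 := by
  ext y; simp [kd_apply]

lemma kd_add (k l : Fin d → ℤ) : kd (k + l) = kd k + kd l := by
  ext y; simp only [kd_apply, ContinuousLinearMap.add_apply, ← Finset.sum_add_distrib]
  refine Finset.sum_congr rfl fun j _ => ?_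
  simp; ring

lemma kd_neg (k : Fin d → ℤ) : kd (-k) = -kd k := by
  ext y; simp only [kd_apply, ContinuousLinearMap.neg_apply, ← Finset.sum_neg_distrib]
  refine Finset.sum_congr rfl fun j _ => ?_
  simp

lemma kd_single (k : Fin d → ℤ) (j : Fin d) (c : ℝ) :
    kd k (EuclideanSpace.single j c) = 2 * Real.pi * (k j : ℝ) * c := by
  rw [kd_apply, Finset.sum_eq_single j]
  · simp
  · intro b _ hb; simp [hb]
  · simp

@[simp] lemma ek_zero (y : Euc d) : ek 0 y = 1 := by simp [ek, kd_zero]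
lemma ek_add (k l : Fin d → ℤ) (y : Euc d) : ek (k + l) y = ek k y * ek l y := by
  simp [ek, kd_add, ← Complex.exp_add, add_mul]
lemma ek_shift (k : Fin d → ℤ) (y c : Euc d) : ek k (y + c) = ek k y * ek k c := by
  simp [ek, ← Complex.exp_add, add_mul]
@[simp] lemma ek_at_zero (k : Fin d → ℤ) : ek k (0 : Euc d) = 1 := by simp [ek]
@[simp] lemma ek_norm (k : Fin d → ℤ) (y : Euc d) : ‖ek k y‖ = 1 := by
  simp [ek, Complex.norm_exp_ofReal_mul_I]
lemma ek_neg_mul (k : Fin d → ℤ) (y : Euc d) : ek (-k) y * ek k y = 1 := by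
  rw [← ek_add]; simp
lemma ek_neg (k : Fin d → ℤ) (y : Euc d) : ek (-k) y = (starRingEnd ℂ) (ek k y) := by
  simp only [ek, ← Complex.exp_conj]; simp [kd_neg]
lemma zvec_apply (z : Fin d → ℤ) (i : Fin d) : zvec z i = (z i : ℝ) := rfl

lemma ek_zvec (k z : Fin d → ℤ) : ek k (zvec z : Euc d) = 1 := by
  rw [ek, Complex.exp_eq_one_iff]
  refine ⟨∑ j, k j * z j, ?_⟩
  rw [kd_apply]; push_cast
  rw [Finset.sum_mul, Finset.sum_mul]
  refine Finset.sum_congr rfl fun j _ => ?_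
  rw [zvec_apply]; push_cast; ring

lemma ek_periodic (k : Fin d → ℤ) (y : Euc d) (z : Fin d → ℤ) : ek k (y + zvec z) = ek k y := by
  rw [ek_shift, ek_zvec, mul_one]

lemma ek_contDiff (k : Fin d → ℤ) {n : WithTop ℕ∞} : ContDiff ℝ n (ek k : Euc d → ℂ) := by
  unfold ek
  have h : ContDiff ℝ n (fun y : Euc d => ((kd k y : ℝ) : ℂ)) :=
    Complex.ofRealCLM.contDiff.comp (kd k).contDiff
  exact Complex.contDiff_exp.comp (h.mul contDiff_const)

lemma ek_continuous (k : Fin d → ℤ) : Continuous (ek k : Euc d → ℂ) := (ek_contDiff (n := 0) k).continuous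

lemma ek_hasFDerivAt (k : Fin d → ℤ) (y : Euc d) :
    HasFDerivAt (ek k) (((Complex.ofRealCLM.comp (kd k)).smulRight (Complex.I * ek k y) : Euc d →L[ℝ] ℂ)) y := by
  have h1 : HasFDerivAt (fun y : Euc d => ((kd k y : ℝ) : ℂ)) (Complex.ofRealCLM.comp (kd k)) y :=
    (Complex.ofRealCLM.hasFDerivAt).comp y (kd k).hasFDerivAt
  have h2 := ((h1.mul_const Complex.I).cexp)
  unfold ek
  refine h2.congr_fderiv ?_
  ext v
  simp; ring

lemma ek_fderiv (k : Fin d → ℤ) : fderiv ℝ (ek k : Euc d → ℂ) =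
    fun y => ek k y • ((Complex.ofRealCLM.comp (kd k)).smulRight Complex.I : Euc d →L[ℝ] ℂ) := by
  ext y v
  rw [(ek_hasFDerivAt k y).fderiv]; simp; ring

lemma ek_iter (k : Fin d → ℤ) (i : ℕ) (y : Euc d) :
    ‖iteratedFDeriv ℝ i (ek k) y‖ ≤ ‖kd k‖ ^ i := by
  induction i generalizing y with
  | zero => simp
  | succ i ih =>
    rw [← norm_iteratedFDeriv_fderiv, ek_fderiv]
    set B : Euc d →L[ℝ] ℂ := (Complex.ofRealCLM.comp (kd k)).smulRight Complex.I
    have hB : ‖B‖ ≤ ‖kd k‖ := by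
      refine ContinuousLinearMap.opNorm_le_bound _ (norm_nonneg _) fun v => ?_
      simp only [B, ContinuousLinearMap.smulRight_apply, norm_smul, Complex.norm_I, mul_one]
      simpa using (kd k).le_opNorm v
    let S : ℂ →L[ℝ] (Euc d →L[ℝ] ℂ) := (ContinuousLinearMap.lsmul ℝ ℂ : ℂ →L[ℝ] _ →L[ℝ] _).flip B
    have : (fun y => ek k y • B) = S ∘ (ek k) := by
      funext y; simp [S]
    rw [this]
    have hS : ‖S‖ ≤ ‖B‖ := by
      refine ContinuousLinearMap.opNorm_le_bound _ (norm_nonneg _) fun v => ?_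
      simp [S, norm_smul, mul_comm]
    calc _ ≤ ‖S‖ * ‖iteratedFDeriv ℝ i (ek k) y‖ :=
          S.norm_iteratedFDeriv_comp_left ((ek_contDiff (n := i) k).contDiffAt) le_rfl
      _ ≤ ‖kd k‖ * ‖kd k‖ ^ i := by gcongr; exact hS.trans hB; exact ih y
      _ = _ := by ring

lemma kd_norm (k : Fin d → ℤ) : ‖kd k‖ ≤ 2 * Real.pi * d * ‖k‖ := by
  refine ContinuousLinearMap.opNorm_le_bound _ (by positivity) fun v => ?_
  rw [kd_apply]
  calc ‖∑ j, 2 * Real.pi * (k j : ℝ) * v j‖ ≤ ∑ j : Fin d, 2 * Real.pi * ‖k‖ * ‖v‖ := by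
        refine (norm_sum_le _ _).trans (Finset.sum_le_sum fun j _ => ?_)
        rw [norm_mul, norm_mul, norm_mul]
        have h1 : ‖(k j : ℝ)‖ ≤ ‖k‖ := by
          have := norm_le_pi_norm k j; rwa [Int.norm_eq_abs] at this
        have h2 : ‖v j‖ ≤ ‖v‖ := PiLp.norm_apply_le v j
        have : ‖(2:ℝ)‖ * ‖Real.pi‖ = 2 * Real.pi := by
          simp [abs_of_pos Real.pi_pos]
        rw [this]; gcongr
    _ = _ := by simp; ring

end ekfacts

/-! ### cell integrals -/
/-- Z^d-periodicity -/
def Per {d : ℕ} {E : Type*} (f : Euc d → E) : Prop := ∀ y (z : Fin d → ℤ), f (y + zvec z) = f y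

section cell
variable {d : ℕ} {E : Type*} [NormedAddCommGroup E] [NormedSpace ℝ E]

abbrev stdB (d : ℕ) : Module.Basis (Fin d) ℝ (Euc d) := (EuclideanSpace.basisFun (Fin d) ℝ).toBasis

lemma unitCell_eq : unitCell d = ZSpan.fundamentalDomain (stdB d) := by
  ext x; simp [unitCell, ZSpan.mem_fundamentalDomain, stdB]

lemma span_zvec (g : Submodule.span ℤ (Set.range (stdB d))) : ∃ z : Fin d → ℤ, (g : Euc d) = zvec z := by
  have := (stdB d).mem_span_iff_repr_mem ℤ (g : Euc d)
  have h := this.1 g.2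
  choose z hz using h
  refine ⟨z, ?_⟩
  ext i
  have := hz i
  simp [stdB] at this
  rw [zvec_apply, this]

lemma cell_shift {f : Euc d → E} (hf : Per f) (c : Euc d) :
    ∫ y in unitCell d, f (y + c) = ∫ y in unitCell d, f y := by
  have hfd : IsAddFundamentalDomain (Submodule.span ℤ (Set.range (stdB d))) (unitCell d) volume := by
    rw [unitCell_eq]; exact ZSpan.isAddFundamentalDomain _ _
  haveI : VAddInvariantMeasure (Submodule.span ℤ (Set.range (stdB d))) (Euc d) volume :=
    ⟨fun g s hs => measure_preimage_add volume (g : Euc d) s⟩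
  have h2 := hfd.vadd_of_comm c
  have hinv : ∀ (g : Submodule.span ℤ (Set.range (stdB d))) (x : Euc d), f (g +ᵥ x) = f x := by
    intro g x
    obtain ⟨z, hz⟩ := span_zvec g
    have : g +ᵥ x = x + zvec z := by
      rw [← hz, add_comm]; rfl
    rw [this, hf]
  rw [hfd.setIntegral_eq h2 hinv]
  have := (measurePreserving_vadd c (volume : Measure (Euc d))).setIntegral_image_emb
    (measurableEmbedding_const_vadd c) f (unitCell d)
  rw [Set.image_vadd] at this
  rw [this]
  simp [add_comm]

lemma unitCell_meas : MeasurableSet (unitCell d) := by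
  rw [unitCell_eq]; exact ZSpan.fundamentalDomain_measurableSet _

lemma unitCell_bdd : Bornology.IsBounded (unitCell d) := by
  rw [unitCell_eq]; exact ZSpan.fundamentalDomain_isBounded _

lemma unitCell_vol : volume (unitCell d) = 1 := by
  rw [unitCell_eq, ZSpan.fundamentalDomain_ae_parallelepiped (stdB d) volume |> measure_congr]
  have := (EuclideanSpace.basisFun (Fin d) ℝ).volume_parallelepiped
  simpa [stdB] using this

instance : IsProbabilityMeasure (volume.restrict (unitCell d)) :=
  ⟨by rw [Measure.restrict_apply_univ, unitCell_vol]⟩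

lemma cell_integrable {f : Euc d → E} (hf : Continuous f) : IntegrableOn f (unitCell d) := by
  have h := (hf.continuousOn (s := closure (unitCell d))).integrableOn_compact (μ := volume)
    (Metric.isCompact_of_isClosed_isBounded isClosed_closure unitCell_bdd.closure)
  exact h.mono_set subset_closure

lemma cell_ek [DecidableEq (Fin d → ℤ)] (k : Fin d → ℤ) : ∫ y in unitCell d, ek k y = if k = 0 then 1 else 0 := by
  split_ifs with h
  · subst h; simp
  · obtain ⟨j, hj⟩ := Function.ne_iff.1 h
    have hs := cell_shift (f := ek k) (ek_periodic k) (EuclideanSpace.single j (1 / (2 * (k j : ℝ))))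
    have he : ek k (EuclideanSpace.single j (1 / (2 * (k j : ℝ)))) = -1 := by
      have hj' : ((k j : ℝ)) ≠ 0 := by simpa using hj
      rw [ek, kd_single, show 2 * Real.pi * (k j : ℝ) * (1 / (2 * (k j : ℝ))) = Real.pi by field_simp,
        Complex.exp_pi_mul_I]
    simp only [ek_shift, he, mul_neg_one, integral_neg] at hs
    exact self_eq_neg.1 hs.symm

lemma cell_deriv [CompleteSpace E] {f : Euc d → E} (hf : Per f) (hc : ContDiff ℝ 1 f) (j : Fin d) :
    ∫ y in unitCell d, fderiv ℝ f y (EuclideanSpace.single j 1) = 0 := by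
  set e : Euc d := EuclideanSpace.single j 1
  set g : Euc d → E := fun y => fderiv ℝ f y e
  have hgc : Continuous g := (hc.continuous_fderiv one_ne_zero).clm_apply continuous_const
  have hgp : Per g := by
    intro y z
    simp only [g]
    have : (fun x => f (x + zvec z)) = f := funext fun x => hf x z
    rw [← fderiv_comp_add_right, this]
  have h1 : ∀ y, ∫ r in (0:ℝ)..1, g (y + r • e) = 0 := by
    intro y
    have hd : ∀ r ∈ Set.uIcc (0:ℝ) 1, HasDerivAt (fun r : ℝ => f (y + r • e)) (g (y + r • e)) r := by
      intro r _
      have h0 : HasDerivAt (fun r : ℝ => y + r • e) e r := by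
        simpa using ((hasDerivAt_id r).smul_const e).const_add y
      exact ((hc.differentiable one_ne_zero _).hasFDerivAt).comp_hasDerivAt r h0
    rw [intervalIntegral.integral_eq_sub_of_hasDerivAt hd
      ((hgc.comp (by fun_prop)).intervalIntegrable _ _)]
    have : y + (1:ℝ) • e = y + zvec (Pi.single j 1) := by
      congr 1; ext i
      rw [zvec_apply]
      by_cases h : i = j
      · subst h; simp [e]
      · simp [e, h]
    rw [this, hf]; simp
  have h2 : ∫ y in unitCell d, ∫ r in (0:ℝ)..1, g (y + r • e) = 0 := by simp [h1]
  rw [← intervalIntegral_integral_swap] at h2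
  · have : ∀ r : ℝ, ∫ y in unitCell d, g (y + r • e) = ∫ y in unitCell d, g y := fun r => cell_shift hgp _
    simpa [this] using h2
  · have hcont : Continuous (fun p : ℝ × Euc d => g (p.2 + p.1 • e)) := hgc.comp (by fun_prop)
    have hK : IsCompact (Set.Icc (0:ℝ) 1 ×ˢ closure (unitCell d)) :=
      isCompact_Icc.prod (Metric.isCompact_of_isClosed_isBounded isClosed_closure unitCell_bdd.closure)
    have := hcont.continuousOn.integrableOn_compact hK (μ := volume)
    rw [Set.uIoc_of_le zero_le_one, Measure.prod_restrict]
    exact this.mono_set (Set.prod_mono Set.Ioc_subset_Icc_self subset_closure)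

end cell
end

section
open MeasureTheory
open scoped BigOperators Topology
set_option linter.all false
set_option linter.deprecated false

/-- weight `1+|k|` -/
def wt {d : ℕ} (k : Fin d → ℤ) : ℝ := 1 + ‖k‖
lemma wt_pos {d : ℕ} (k : Fin d → ℤ) : 0 < wt k := by unfold wt; positivity
lemma one_le_wt {d : ℕ} (k : Fin d → ℤ) : 1 ≤ wt k := by unfold wt; linarith [norm_nonneg k]
lemma wt_ne {d : ℕ} (k : Fin d → ℤ) : wt k ≠ 0 := (wt_pos k).ne'

lemma summable_prod_aux (g : ℤ → ℝ) (hg : Summable g) (h0 : ∀ x, 0 ≤ g x) (d : ℕ) :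
    Summable (fun k : Fin d → ℤ => ∏ i, g (k i)) := by
  induction d with
  | zero => exact Summable.of_finite
  | succ d ih =>
    have := hg.mul_of_nonneg ih h0 (fun k => Finset.prod_nonneg fun i _ => h0 _)
    rw [← (Fin.consEquiv (fun _ : Fin (d+1) => ℤ)).summable_iff]
    refine this.congr fun p => ?_
    simp [Fin.prod_univ_succ, Fin.consEquiv]

lemma summable_wt (d : ℕ) : Summable (fun k : Fin d → ℤ => (wt k ^ (2 * d))⁻¹) := by
  have hg : Summable (fun x : ℤ => ((1 + |(x:ℝ)|) ^ 2)⁻¹) := by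
    have h := Real.summable_one_div_int_pow.2 (show 1 < 2 by norm_num)
    refine Summable.of_norm_bounded_eventually h ?_
    have : ∀ᶠ x : ℤ in Filter.cofinite, x ≠ 0 := by
      simpa using (Set.finite_singleton (0:ℤ)).compl_mem_cofinite
    filter_upwards [this] with x hx
    have hx' : (0:ℝ) < |(x:ℝ)| := by simpa using hx
    rw [Real.norm_of_nonneg (by positivity), one_div, ← sq_abs (x:ℝ)]
    gcongr; linarith
  refine Summable.of_nonneg_of_le (fun k => by have := wt_pos k; positivity) (fun k => ?_)
    (summable_prod_aux _ hg (fun x => by positivity) d)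
  rw [Finset.prod_inv_distrib]
  gcongr
  rw [pow_mul]
  · calc ∏ i, (1 + |(k i:ℝ)|) ^ 2 ≤ ∏ i : Fin d, (wt k)^2 := by
          refine Finset.prod_le_prod (fun i _ => by positivity) fun i _ => ?_
          have h1 : |(k i : ℝ)| ≤ ‖k‖ := by
            have := norm_le_pi_norm k i; rwa [Int.norm_eq_abs] at this
          unfold wt; gcongr
      _ = _ := by simp

lemma summable_wt' {d : ℕ} (n : ℕ) (hn : 2 * d ≤ n) : Summable (fun k : Fin d → ℤ => (wt k ^ n)⁻¹) := by
  refine Summable.of_nonneg_of_le (fun k => by have := wt_pos k; positivity) (fun k => ?_) (summable_wt d)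
  have := one_le_wt k
  gcongr

section fc
variable {d : ℕ} {B : Type*} [NormedAddCommGroup B] [NormedSpace ℂ B] [NormedSpace ℝ B]
  [IsScalarTower ℝ ℂ B]

/-- Fourier coefficient -/
def fc (f : Euc d → B) (k : Fin d → ℤ) : B := ∫ y in unitCell d, ek (-k) y • f y

lemma Per.bdd {E : Type*} [NormedAddCommGroup E] {f : Euc d → E} (hf : Per f) (hc : Continuous f) :
    ∃ C, ∀ y, ‖f y‖ ≤ C := by
  obtain ⟨C, hC⟩ := (Metric.isCompact_of_isClosed_isBounded isClosed_closure
    (unitCell_bdd (d := d)).closure).exists_bound_of_continuousOn hc.continuousOn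
  refine ⟨C, fun y => ?_⟩
  have : f y = f (y + zvec (fun i => -⌊y i⌋)) := (hf _ _).symm
  rw [this]
  apply hC; apply subset_closure
  intro i
  have : (y + zvec (fun i => -⌊y i⌋)) i = y i - ⌊y i⌋ := by
    rw [PiLp.add_apply, zvec_apply]; push_cast; ring
  rw [this]
  exact ⟨by linarith [Int.floor_le (y i)], by linarith [Int.lt_floor_add_one (y i)]⟩

lemma Per.fderiv {E : Type*} [NormedAddCommGroup E] [NormedSpace ℝ E] {f : Euc d → E} (hf : Per f) :
    Per (fderiv ℝ f) := by
  intro y z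
  have : (fun x => f (x + zvec z)) = f := funext fun x => hf x z
  rw [← fderiv_comp_add_right, this]

/-- partial derivative, vector valued -/
def pd {E : Type*} [NormedAddCommGroup E] [NormedSpace ℝ E] (j : Fin d) (f : Euc d → E) : Euc d → E :=
  fun y => _root_.fderiv ℝ f y (EuclideanSpace.single j 1)

lemma Per.pd {E : Type*} [NormedAddCommGroup E] [NormedSpace ℝ E] {f : Euc d → E} (hf : Per f) (j : Fin d) :
    Per (pd j f) := fun y z => by unfold _root_.pd; rw [hf.fderiv]

lemma pd_smooth {E : Type*} [NormedAddCommGroup E] [NormedSpace ℝ E] {f : Euc d → E}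
    (hf : ContDiff ℝ (⊤ : ℕ∞) f) (j : Fin d) : ContDiff ℝ (⊤ : ℕ∞) (pd j f) :=
  (hf.fderiv_right (by simp)).clm_apply contDiff_const

lemma fc_norm {f : Euc d → B} {C : ℝ} (hC : ∀ y, ‖f y‖ ≤ C) (k : Fin d → ℤ) : ‖fc f k‖ ≤ C := by
  have := norm_integral_le_of_norm_le_const (μ := volume.restrict (unitCell d))
    (f := fun y => ek (-k) y • f y) (C := C) (Filter.Eventually.of_forall fun y => by
      simpa [norm_smul] using hC y)
  simpa [fc] using this

lemma fc_pd [CompleteSpace B] {f : Euc d → B} (hf : Per f) (hc : ContDiff ℝ 1 f) (j : Fin d) (k : Fin d → ℤ) :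
    fc (pd j f) k = (2 * Real.pi * (k j : ℝ) * Complex.I : ℂ) • fc f k := by
  set e : Euc d := EuclideanSpace.single j 1
  have hper : Per (fun y => ek (-k) y • f y) := fun y z => by simp only [hf y z, ek_periodic]
  have hcd : ContDiff ℝ 1 (fun y => ek (-k) y • f y) := (ek_contDiff _).smul hc
  have h0 := cell_deriv hper hcd j
  have hder : ∀ y, _root_.fderiv ℝ (fun y => ek (-k) y • f y) y e =
      ek (-k) y • pd j f y - (2 * Real.pi * (k j : ℝ) * Complex.I : ℂ) • (ek (-k) y • f y) := by
    intro y
    have h1 := (ek_hasFDerivAt (-k) y)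
    have h2 := (hc.differentiable one_ne_zero y).hasFDerivAt
    have h3 : HasFDerivAt (fun y => ek (-k) y • f y) _ y := h1.smul h2
    rw [h3.fderiv]
    simp only [pd, e, ContinuousLinearMap.add_apply, ContinuousLinearMap.smul_apply,
      ContinuousLinearMap.smulRight_apply, ContinuousLinearMap.comp_apply, kd_single, sub_eq_add_neg]
    congr 1
    rw [← neg_smul, smul_smul]
    congr 1
    simp; ring
  rw [show (fun y => _root_.fderiv ℝ (fun y => ek (-k) y • f y) y (EuclideanSpace.single j 1)) = _ from
    funext hder] at h0
  rw [integral_sub, integral_smul, sub_eq_zero] at h0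
  · exact h0
  · exact cell_integrable ((ek_continuous _).smul ((hc.continuous_fderiv one_ne_zero).clm_apply continuous_const))
  · exact (cell_integrable ((ek_continuous _).smul hc.continuous)).smul _

lemma fc_decay [CompleteSpace B] (s : ℕ) : ∀ {f : Euc d → B} (hf : Per f) (hc : ContDiff ℝ (⊤ : ℕ∞) f),
    ∃ C, ∀ k, wt k ^ s * ‖fc f k‖ ≤ C := by
  induction s with
  | zero =>
    intro f hf hc
    obtain ⟨C, hC⟩ := hf.bdd hc.continuous
    exact ⟨C, fun k => by simpa using fc_norm hC k⟩
  | succ s ih =>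
    intro f hf hc
    obtain ⟨C, hC⟩ := ih hf hc
    choose D hD using fun j => ih (hf.pd j) (pd_smooth hc j)
    refine ⟨C + ∑ j, D j, fun k => ?_⟩
    have hk : ‖k‖ ≤ ∑ j, |(k j : ℝ)| := by
      rw [pi_norm_le_iff_of_nonneg (Finset.sum_nonneg fun j _ => abs_nonneg _)]
      intro i; rw [Int.norm_eq_abs]
      exact Finset.single_le_sum (f := fun j => |(k j : ℝ)|) (fun j _ => abs_nonneg _) (Finset.mem_univ i)
    have h1 : ∀ j, |(k j : ℝ)| * ‖fc f k‖ ≤ ‖fc (pd j f) k‖ := by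
      intro j
      rw [fc_pd hf (hc.of_le (by exact_mod_cast le_top)), norm_smul]
      gcongr
      simp [abs_of_pos Real.pi_pos]
      have : 1 ≤ 2 * Real.pi := by linarith [Real.pi_gt_three]
      nlinarith [abs_nonneg (k j : ℝ)]
    have hw := wt_pos k
    calc wt k ^ (s+1) * ‖fc f k‖ = wt k ^ s * ‖fc f k‖ + wt k ^ s * (‖k‖ * ‖fc f k‖) := by
          rw [pow_succ]; unfold wt; ring
      _ ≤ wt k ^ s * ‖fc f k‖ + wt k ^ s * ((∑ j, |(k j : ℝ)|) * ‖fc f k‖) := by gcongr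
      _ = wt k ^ s * ‖fc f k‖ + ∑ j, wt k ^ s * (|(k j : ℝ)| * ‖fc f k‖) := by
          rw [Finset.sum_mul, Finset.mul_sum]
      _ ≤ C + ∑ j, D j := by
          gcongr with j
          · exact hC k
          · exact le_trans (by gcongr; exact h1 j) (hD j k)

lemma fc_summable [CompleteSpace B] (s : ℕ) {f : Euc d → B} (hf : Per f) (hc : ContDiff ℝ (⊤ : ℕ∞) f) :
    Summable (fun k => wt k ^ s * ‖fc f k‖) := by
  obtain ⟨C, hC⟩ := fc_decay (s + 2 * d) hf hc
  refine Summable.of_nonneg_of_le (fun k => by have := wt_pos k; positivity) (fun k => ?_)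
    ((summable_wt d).mul_left C)
  have := wt_pos k
  rw [← div_eq_mul_inv, le_div_iff₀ (by positivity)]
  refine le_trans (le_of_eq ?_) (hC k)
  rw [pow_add]; ring

lemma fc_summable0 [CompleteSpace B] {f : Euc d → B} (hf : Per f) (hc : ContDiff ℝ (⊤ : ℕ∞) f) :
    Summable (fun k => ‖fc f k‖) := by simpa using fc_summable 0 hf hc

end fc

/-! inversion -/
lemma ek_mFourier {d : ℕ} (k : Fin d → ℤ) (y : Euc d) :
    UnitAddTorus.mFourier k (fun i => ((y i : ℝ) : UnitAddCircle)) = ek k y := by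
  simp only [UnitAddTorus.mFourier, ContinuousMap.coe_mk, ek, kd_apply]
  rw [Finset.prod_congr rfl (fun i _ => fourier_coe_apply (n := k i) (x := y i))]
  rw [← Complex.exp_sum]
  congr 1
  push_cast
  rw [Finset.sum_mul]
  refine Finset.sum_congr rfl fun j _ => ?_
  simp; ring

lemma cell_box {d : ℕ} {E : Type*} [NormedAddCommGroup E] [NormedSpace ℝ E] (f : Euc d → E) :
    ∫ x in {x : Fin d → ℝ | ∀ i, x i ∈ Set.Ioc (0:ℝ) (0+1)}, f (WithLp.toLp 2 x) = ∫ y in unitCell d, f y := by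
  have h1 : ∫ y in unitCell d, f y = ∫ x in {x : Fin d → ℝ | ∀ i, x i ∈ Set.Ico (0:ℝ) 1}, f (WithLp.toLp 2 x) := by
    have := (PiLp.volume_preserving_toLp (Fin d)).setIntegral_preimage_emb
      (MeasurableEquiv.toLp 2 (Fin d → ℝ)).measurableEmbedding f (unitCell d)
    rw [← this]; rfl
  rw [h1]
  apply setIntegral_congr_set
  have e1 : {x : Fin d → ℝ | ∀ i, x i ∈ Set.Ioc (0:ℝ) (0+1)} = Set.pi Set.univ (fun i => Set.Ioc (0:ℝ) 1) := by
    ext x; simp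
  have e2 : {x : Fin d → ℝ | ∀ i, x i ∈ Set.Ico (0:ℝ) 1} = Set.pi Set.univ (fun i => Set.Ico (0:ℝ) 1) := by
    ext x; simp
  rw [e1, e2]
  have a1 := Measure.univ_pi_Ioc_ae_eq_Icc (μ := fun _ : Fin d => (volume : Measure ℝ)) (f := fun _ => 0) (g := fun _ => 1)
  have a2 := Measure.univ_pi_Ico_ae_eq_Icc (μ := fun _ : Fin d => (volume : Measure ℝ)) (f := fun _ => 0) (g := fun _ => 1)
  exact a1.trans a2.symm

lemma fourier_inv_C {d : ℕ} {f : Euc d → ℂ} (hf : Per f) (hc : Continuous f)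
    (hs : Summable (fun k => fc f k)) (y : Euc d) : HasSum (fun k => ek k y • fc f k) (f y) := by
  let q : (Fin d → ℝ) → UnitAddTorus (Fin d) := fun x i => (x i : UnitAddCircle)
  have hq : IsOpenQuotientMap q := IsOpenQuotientMap.piMap (fun i => QuotientAddGroup.isOpenQuotientMap_mk)
  have hlift : ∀ x x' : Fin d → ℝ, q x = q x' → f (WithLp.toLp 2 x) = f (WithLp.toLp 2 x') := by
    intro x x' h
    have h' : ∀ i, ∃ z : ℤ, x i + z = x' i := by
      intro i
      have := congrFun h i
      simp only [q] at this
      have := (QuotientAddGroup.eq).1 this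
      obtain ⟨z, hz⟩ := AddSubgroup.mem_zmultiples_iff.1 this
      refine ⟨z, ?_⟩
      simp at hz; linarith
    choose z hz using h'
    rw [← hf _ z]
    congr 1; ext i
    rw [PiLp.add_apply, zvec_apply]; exact hz i
  let fT : C(UnitAddTorus (Fin d), ℂ) :=
    ⟨fun p => f (WithLp.toLp 2 (Function.surjInv hq.surjective p)), by
      have : (fun p => f (WithLp.toLp 2 (Function.surjInv hq.surjective p))) ∘ q = fun x => f (WithLp.toLp 2 x) := by
        funext x; exact hlift _ _ (Function.surjInv_eq hq.surjective (q x))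
      rw [hq.isQuotientMap.continuous_iff, this]
      exact hc.comp (by fun_prop)⟩
  have hfT : ∀ x : Fin d → ℝ, fT (q x) = f (WithLp.toLp 2 x) := fun x =>
    hlift _ _ (Function.surjInv_eq hq.surjective (q x))
  have hco : ∀ k, UnitAddTorus.mFourierCoeff fT k = fc f k := by
    intro k
    rw [UnitAddTorus.mFourierCoeff_eq_integral fT k (fun _ => 0), fc, ← cell_box]
    congr 1
    funext x
    have h1 := hfT x
    have h2 := ek_mFourier (-k) (WithLp.toLp 2 x)
    simp only [q] at h1 h2
    rw [h1]; congr 1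
  have := UnitAddTorus.hasSum_mFourier_series_apply_of_summable (f := fT) (by rw [show UnitAddTorus.mFourierCoeff fT = _ from funext hco]; exact hs) (q y)
  rw [hfT] at this
  simp only [hco] at this
  convert this using 2 with k
  rw [show UnitAddTorus.mFourier k (q y) = ek k y from ek_mFourier k y, smul_eq_mul, smul_eq_mul, mul_comm]

lemma fourier_inv {d : ℕ} {B : Type*} [NormedAddCommGroup B] [NormedSpace ℂ B] [NormedSpace ℝ B]
    [IsScalarTower ℝ ℂ B] [CompleteSpace B] {f : Euc d → B} (hf : Per f)
    (hc : ContDiff ℝ (⊤ : ℕ∞) f) (y : Euc d) : HasSum (fun k => ek k y • fc f k) (f y) := by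
  have hs : Summable (fun k => ek k y • fc f k) := by
    refine Summable.of_norm ?_
    simpa [norm_smul] using fc_summable0 hf hc
  have key : f y = ∑' k, ek k y • fc f k := by
    rw [← sub_eq_zero, SeparatingDual.eq_zero_iff_forall_dual_eq_zero (R := ℂ)]
    intro g
    have hg : ∀ k, fc (fun y => g (f y)) k = g (fc f k) := by
      intro k
      have := ContinuousLinearMap.integral_comp_comm (g.restrictScalars ℝ)
        (cell_integrable ((ek_continuous (-k)).smul hc.continuous))
      simpa [fc] using this
    have h1 := fourier_inv_C (f := fun y => g (f y)) (fun y z => by simp only [hf y z])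
      (g.continuous.comp hc.continuous) (by
        simp only [hg]
        exact (g.restrictScalars ℝ).summable (fc_summable0 hf hc).of_norm) y
    have h2 := (g.hasSum hs.hasSum)
    rw [map_sub, sub_eq_zero]
    refine h1.unique ?_
    have e : (fun k => ek k y • fc (fun y => g (f y)) k) = fun b => g (ek b y • fc f b) := by
      funext k; rw [hg]; simp
    rw [e]; exact h2
  rw [key]; exact hs.hasSum
end

section
open MeasureTheory
open scoped BigOperators Topology RealInnerProductSpace
set_option linter.all false
set_option linter.deprecated false

/-- frequency space ℓ²(ℤ^d; F) -/
def HS (d : ℕ) (F : Type*) [NormedAddCommGroup F] : Type _ := lp (fun _ : Fin d → ℤ => F) 2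

section HSinst
variable {d : ℕ} {F : Type*} [NormedAddCommGroup F]
instance : NormedAddCommGroup (HS d F) := inferInstanceAs (NormedAddCommGroup (lp (fun _ : Fin d → ℤ => F) 2))
instance [InnerProductSpace ℝ F] : InnerProductSpace ℝ (HS d F) :=
  inferInstanceAs (InnerProductSpace ℝ (lp (fun _ : Fin d → ℤ => F) 2))
instance [CompleteSpace F] : CompleteSpace (HS d F) :=
  inferInstanceAs (CompleteSpace (lp (fun _ : Fin d → ℤ => F) 2))
instance : CoeFun (HS d F) (fun _ => (Fin d → ℤ) → F) := ⟨fun x => x.1⟩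
@[ext] lemma HS.ext {x y : HS d F} (h : ∀ k, x k = y k) : x = y := Subtype.ext (funext h)
@[simp] lemma HS.add_apply (x y : HS d F) (k) : (x + y) k = x k + y k := rfl
@[simp] lemma HS.sub_apply (x y : HS d F) (k) : (x - y) k = x k - y k := rfl
@[simp] lemma HS.neg_apply (x : HS d F) (k) : (-x) k = -x k := rfl
@[simp] lemma HS.zero_apply (k) : (0 : HS d F) k = 0 := rfl
@[simp] lemma HS.smul_apply [InnerProductSpace ℝ F] (c : ℝ) (x : HS d F) (k) : (c • x) k = c • x k := rfl

lemma HS.summable_sq (x : HS d F) : Summable (fun k => ‖x k‖ ^ 2) := by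
  have := (lp.memℓp x).summable (by norm_num)
  simpa using this

lemma HS.norm_sq (x : HS d F) : ‖x‖ ^ 2 = ∑' k, ‖x k‖ ^ 2 := by
  have := lp.norm_rpow_eq_tsum (p := 2) (by norm_num) x
  simp at this
  exact this

lemma HS.inner_eq [InnerProductSpace ℝ F] (x y : HS d F) : ⟪x, y⟫ = ∑' k, ⟪x k, y k⟫ :=
  lp.inner_eq_tsum (𝕜 := ℝ) (G := fun _ : Fin d → ℤ => F) x y

/-- constructor -/
def HS.mk (x : (Fin d → ℤ) → F) (h : Summable (fun k => ‖x k‖ ^ 2)) : HS d F :=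
  ⟨x, by apply memℓp_gen; simpa using h⟩
@[simp] lemma HS.mk_apply (x : (Fin d → ℤ) → F) (h) (k) : HS.mk x h k = x k := rfl

lemma HS.norm_apply_le (x : HS d F) (k) : ‖x k‖ ≤ ‖x‖ :=
  lp.norm_apply_le_norm (by norm_num) x k

/-- evaluation at a frequency -/
def HS.ev [InnerProductSpace ℝ F] (k : Fin d → ℤ) : HS d F →L[ℝ] F :=
  LinearMap.mkContinuous { toFun := fun x => x k, map_add' := fun _ _ => rfl, map_smul' := fun _ _ => rfl } 1
    (fun x => by rw [one_mul]; exact HS.norm_apply_le x k)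
@[simp] lemma HS.ev_apply [InnerProductSpace ℝ F] (k : Fin d → ℤ) (x : HS d F) : HS.ev k x = x k := rfl

/-- a single mode -/
def HS.single (k : Fin d → ℤ) (a : F) : HS d F := (lp.single 2 k a : lp (fun _ : Fin d → ℤ => F) 2)
lemma HS.single_apply (k : Fin d → ℤ) (a : F) (l) : HS.single k a l = if l = k then a else 0 := by
  change (lp.single 2 k a : lp (fun _ : Fin d → ℤ => F) 2) l = _
  rw [lp.single_apply, Pi.single_apply]

/-- density: continuous linear maps agreeing on single modes agree -/
lemma HS.hasSum_single (x : HS d F) : HasSum (fun k => HS.single k (x k)) x :=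
  lp.hasSum_single (by norm_num) x
end HSinst

section ops
variable {d : ℕ} {F Fp Fpp : Type*} [NormedAddCommGroup F] [InnerProductSpace ℝ F]
  [NormedAddCommGroup Fp] [InnerProductSpace ℝ Fp] [NormedAddCommGroup Fpp] [InnerProductSpace ℝ Fpp]

/-- bounded family of operators -/
def Bd (L : (Fin d → ℤ) → F →L[ℝ] Fp) : Prop := ∃ C, ∀ k, ‖L k‖ ≤ C

lemma Bd.of_le {L : (Fin d → ℤ) → F →L[ℝ] Fp} (C : ℝ) (h : ∀ k, ‖L k‖ ≤ C) : Bd L := ⟨C, h⟩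

lemma shift_summable (x : HS d F) (q : Fin d → ℤ) : Summable (fun k => ‖x (k - q)‖ ^ 2) :=
  (Equiv.subRight q).summable_iff.2 (HS.summable_sq x)

lemma dsh_aux {L : (Fin d → ℤ) → F →L[ℝ] Fp} {C : ℝ} (h : ∀ k, ‖L k‖ ≤ C) (q : Fin d → ℤ) (x : HS d F) (k) :
    ‖L k (x (k - q))‖ ^ 2 ≤ C ^ 2 * ‖x (k - q)‖ ^ 2 := by
  rw [← mul_pow]
  gcongr
  exact (L k).le_of_opNorm_le (h k) _

/-- shifted-diagonal operator `(x)_k ↦ L_k x_{k-q}` -/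
def dsh (L : (Fin d → ℤ) → F →L[ℝ] Fp) (q : Fin d → ℤ) : HS d F →L[ℝ] HS d Fp := by
  classical
  exact if h : Bd L then
    LinearMap.mkContinuous
      { toFun := fun x => HS.mk (fun k => L k (x (k - q))) (by
          obtain ⟨C, hC⟩ := h
          exact Summable.of_nonneg_of_le (fun k => by positivity) (dsh_aux hC q x)
            ((shift_summable x q).mul_left _))
        map_add' := fun x y => by ext k; simp
        map_smul' := fun c x => by ext k; simp } (h.choose)
      (fun x => by
        have hC := h.choose_spec
        have hC0 : 0 ≤ h.choose := (norm_nonneg _).trans (hC 0)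
        refine le_of_sq_le_sq ?_ (by positivity) |> fun h => h
        rw [mul_pow, HS.norm_sq, HS.norm_sq, ← (Equiv.subRight q).tsum_eq (fun k => ‖x k‖ ^ 2), ← tsum_mul_left]
        refine Summable.tsum_le_tsum (dsh_aux hC q x) ?_ ((shift_summable x q).mul_left _)
        exact Summable.of_nonneg_of_le (fun k => by positivity) (dsh_aux hC q x)
            ((shift_summable x q).mul_left _))
  else 0

lemma dsh_apply {L : (Fin d → ℤ) → F →L[ℝ] Fp} (h : Bd L) (q : Fin d → ℤ) (x : HS d F) (k) :
    dsh L q x k = L k (x (k - q)) := by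
  unfold dsh; rw [dif_pos h]; rfl

lemma dsh_norm {L : (Fin d → ℤ) → F →L[ℝ] Fp} {C : ℝ} (h : ∀ k, ‖L k‖ ≤ C) (q : Fin d → ℤ) :
    ‖dsh L q‖ ≤ C := by
  have hC0 : 0 ≤ C := (norm_nonneg _).trans (h 0)
  refine ContinuousLinearMap.opNorm_le_bound _ hC0 fun x => ?_
  refine le_of_sq_le_sq ?_ (by positivity) |> fun h => h
  rw [mul_pow, HS.norm_sq, HS.norm_sq, ← (Equiv.subRight q).tsum_eq (fun k => ‖x k‖ ^ 2), ← tsum_mul_left]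
  simp only [dsh_apply ⟨C, h⟩]
  refine Summable.tsum_le_tsum (dsh_aux h q x) ?_ ((shift_summable x q).mul_left _)
  exact Summable.of_nonneg_of_le (fun k => by positivity) (dsh_aux h q x)
            ((shift_summable x q).mul_left _)

/-- diagonal operator -/
def diag (L : (Fin d → ℤ) → F →L[ℝ] Fp) : HS d F →L[ℝ] HS d Fp := dsh L 0

lemma diag_apply {L : (Fin d → ℤ) → F →L[ℝ] Fp} (h : Bd L) (x : HS d F) (k) :
    diag L x k = L k (x k) := by rw [diag, dsh_apply h, sub_zero]

lemma diag_norm {L : (Fin d → ℤ) → F →L[ℝ] Fp} {C : ℝ} (h : ∀ k, ‖L k‖ ≤ C) : ‖diag L‖ ≤ C := dsh_norm h 0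

lemma diag_inner {L : (Fin d → ℤ) → F →L[ℝ] Fp} {L' : (Fin d → ℤ) → Fp →L[ℝ] F} (h : Bd L) (h' : Bd L')
    (hadj : ∀ k a b, ⟪L k a, b⟫ = ⟪a, L' k b⟫) (x : HS d F) (y : HS d Fp) :
    ⟪diag L x, y⟫ = ⟪x, diag L' y⟫ := by
  rw [HS.inner_eq, HS.inner_eq]
  simp only [diag_apply h, diag_apply h', hadj]

/-- scalar multiplier -/
def mul (θ : (Fin d → ℤ) → ℝ) : HS d F →L[ℝ] HS d F := diag (fun k => θ k • ContinuousLinearMap.id ℝ F)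

lemma mul_bd {θ : (Fin d → ℤ) → ℝ} {C : ℝ} (h : ∀ k, |θ k| ≤ C) (k) :
    ‖θ k • ContinuousLinearMap.id ℝ F‖ ≤ C := by
  rw [norm_smul]
  calc _ ≤ |θ k| * 1 := by gcongr; exact le_of_eq (Real.norm_eq_abs _); exact ContinuousLinearMap.norm_id_le
    _ ≤ C := by simpa using h k

lemma mul_apply' {θ : (Fin d → ℤ) → ℝ} (h : ∃ C, ∀ k, |θ k| ≤ C) (x : HS d F) (k) :
    mul θ x k = θ k • x k := by
  obtain ⟨C, h⟩ := h
  rw [mul, diag_apply ⟨C, mul_bd h⟩]; simp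

lemma mul_norm {θ : (Fin d → ℤ) → ℝ} {C : ℝ} (h : ∀ k, |θ k| ≤ C) : ‖(mul θ : HS d F →L[ℝ] HS d F)‖ ≤ C :=
  diag_norm (mul_bd h)

lemma mul_inner {θ : (Fin d → ℤ) → ℝ} (h : ∃ C, ∀ k, |θ k| ≤ C) (x y : HS d F) :
    ⟪mul θ x, y⟫ = ⟪x, mul θ y⟫ := by
  obtain ⟨C, h⟩ := h
  refine diag_inner ⟨C, mul_bd h⟩ ⟨C, mul_bd h⟩ (fun k a b => ?_) x y
  simp [inner_smul_left, inner_smul_right]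

lemma mul_diag {θ : (Fin d → ℤ) → ℝ} (h : ∃ C, ∀ k, |θ k| ≤ C) {L : (Fin d → ℤ) → F →L[ℝ] Fp} (hL : Bd L)
    (x : HS d F) : mul θ (diag L x) = diag L (mul θ x) := by
  ext k; rw [mul_apply' h, diag_apply hL, diag_apply hL, mul_apply' h]; simp

lemma mul_mul {θ ψ χ : (Fin d → ℤ) → ℝ} (h : ∃ C, ∀ k, |θ k| ≤ C) (h' : ∃ C, ∀ k, |ψ k| ≤ C)
    (hχ : ∀ k, θ k * ψ k = χ k)
    (x : HS d F) : mul θ (mul ψ x) = mul χ x := by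
  obtain ⟨C, hC⟩ := h
  obtain ⟨D, hD⟩ := h'
  have : ∃ C, ∀ k, |χ k| ≤ C := ⟨C * D, fun k => by
    rw [← hχ, abs_mul]
    exact mul_le_mul (hC k) (hD k) (abs_nonneg _) ((abs_nonneg _).trans (hC k))⟩
  ext k; rw [mul_apply' ⟨C, hC⟩, mul_apply' ⟨D, hD⟩, mul_apply' this, smul_smul, hχ]

lemma mul_one' {θ : (Fin d → ℤ) → ℝ} (h : ∀ k, θ k = 1) (x : HS d F) : mul θ x = x := by
  ext k; rw [mul_apply' ⟨1, fun k => by simp [h]⟩, h, one_smul]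

/-! matrix (convolution type) operators -/
/-- rapidly decaying kernels -/
def Rapid (a : (Fin d → ℤ) → F →L[ℝ] Fp) : Prop := ∀ s : ℕ, Summable (fun q => wt q ^ s * ‖a q‖)

/-- admissible weights -/
def Adm (s : ℕ) (ρ : (Fin d → ℤ) → ℝ) : Prop := (∀ k, 0 < ρ k) ∧ ∀ k q, ρ k ≤ wt q ^ s * ρ (k - q)

/-- conjugated convolution operator -/
def Aop (a : (Fin d → ℤ) → F →L[ℝ] Fp) (ρ : (Fin d → ℤ) → ℝ) : HS d F →L[ℝ] HS d Fp :=
  ∑' q, dsh (fun k => (ρ k / ρ (k - q)) • a q) q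

lemma Aop_bd {a : (Fin d → ℤ) → F →L[ℝ] Fp} {s : ℕ} {ρ : (Fin d → ℤ) → ℝ} (hρ : Adm s ρ) (q k) :
    ‖(ρ k / ρ (k - q)) • a q‖ ≤ wt q ^ s * ‖a q‖ := by
  rw [norm_smul, Real.norm_of_nonneg (div_nonneg (hρ.1 _).le (hρ.1 _).le)]
  gcongr
  rw [div_le_iff₀ (hρ.1 _)]
  exact hρ.2 k q

variable [CompleteSpace Fp]

lemma Aop_hasSum {a : (Fin d → ℤ) → F →L[ℝ] Fp} (ha : Rapid a) {s : ℕ} {ρ : (Fin d → ℤ) → ℝ} (hρ : Adm s ρ) :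
    HasSum (fun q => dsh (fun k => (ρ k / ρ (k - q)) • a q) q) (Aop a ρ) := by
  refine Summable.hasSum (Summable.of_norm ?_)
  exact Summable.of_nonneg_of_le (fun q => norm_nonneg _) (fun q => dsh_norm (Aop_bd hρ q) q) (ha s)

lemma Aop_norm {a : (Fin d → ℤ) → F →L[ℝ] Fp} (ha : Rapid a) {s : ℕ} {ρ : (Fin d → ℤ) → ℝ} (hρ : Adm s ρ) :
    ‖Aop a ρ‖ ≤ ∑' q, wt q ^ s * ‖a q‖ :=
  (Aop_hasSum ha hρ).norm_le_of_bounded (ha s).hasSum (fun q => dsh_norm (Aop_bd hρ q) q)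

lemma Aop_apply_hasSum {a : (Fin d → ℤ) → F →L[ℝ] Fp} (ha : Rapid a) {s : ℕ} {ρ : (Fin d → ℤ) → ℝ} (hρ : Adm s ρ)
    (x : HS d F) (k) : HasSum (fun q => (ρ k / ρ (k - q)) • a q (x (k - q))) (Aop a ρ x k) := by
  have h := (Aop_hasSum ha hρ)
  have h2 := ((ContinuousLinearMap.apply ℝ (HS d Fp) x).hasSum h)
  have h3 := (HS.ev k).hasSum h2
  simp only [ContinuousLinearMap.apply_apply] at h3
  have e : (fun q => (ρ k / ρ (k - q)) • a q (x (k - q))) =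
     fun b => (HS.ev k) (dsh (fun k => (ρ k / ρ (k - b)) • a b) b x) := by
    funext q
    change _ = (dsh (fun k => (ρ k / ρ (k - q)) • a q) q x) k
    rw [dsh_apply ⟨_, Aop_bd hρ q⟩]; simp
  rw [e]; exact h3

lemma mul_Aop {a : (Fin d → ℤ) → F →L[ℝ] Fp} (ha : Rapid a) {s s' : ℕ} {ρ ρ' θ : (Fin d → ℤ) → ℝ}
    (hρ : Adm s ρ) (hρ' : Adm s' ρ') (hθ : ∃ C, ∀ k, |θ k| ≤ C) (h : ∀ k, ρ' k = θ k * ρ k) (x : HS d F) :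
    mul θ (Aop a ρ x) = Aop a ρ' (mul θ x) := by
  ext k
  rw [mul_apply' hθ]
  refine ((Aop_apply_hasSum ha hρ x k).const_smul (θ k)).unique ?_
  have := Aop_apply_hasSum ha hρ' (mul θ x) k
  convert this using 2 with q
  rw [mul_apply' hθ, map_smul, smul_smul, smul_smul, h, h]
  congr 1
  have h1 := (hρ.1 (k - q)).ne'
  have h2 : θ (k - q) ≠ 0 := by
    intro h0; have := hρ'.1 (k - q); rw [h, h0] at this; simp at this
  field_simp

/-- weight `(1+ε|k|)^s`. -/
def wte (ε : ℝ) (s : ℕ) (k : Fin d → ℤ) : ℝ := (1 + ε * ‖k‖) ^ s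

lemma norm_sub_aux (k q : Fin d → ℤ) : ‖k‖ ≤ ‖q‖ + ‖k - q‖ := by
  have := norm_add_le q (k - q); simpa using this

lemma wte_adm {ε : ℝ} (h0 : 0 ≤ ε) (h1 : ε ≤ 1) (s : ℕ) : Adm (d := d) s (wte ε s) := by
  refine ⟨fun k => by unfold wte; positivity, fun k q => ?_⟩
  unfold wte wt
  rw [← mul_pow]
  gcongr
  have := norm_sub_aux k q
  nlinarith [norm_nonneg q, norm_nonneg (k - q), mul_le_mul_of_nonneg_left this h0, mul_nonneg h0 (norm_nonneg (k-q)),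
    mul_nonneg (norm_nonneg q) (mul_nonneg h0 (norm_nonneg (k-q))), mul_le_mul_of_nonneg_right h1 (norm_nonneg q)]

lemma wte_ratio {ε : ℝ} (h0 : 0 ≤ ε) (h1 : ε ≤ 1) (s : ℕ) (k q : Fin d → ℤ) :
    |wte ε s k / wte ε s (k - q) - 1| ≤ ε * (s * wt q ^ s) := by
  unfold wte; rw [← div_pow]
  set r := (1 + ε * ‖k‖) / (1 + ε * ‖k - q‖)
  have hr0 : 0 ≤ r := by positivity
  have hr1 : |r - 1| ≤ ε * wt q := by
    have hp : 0 < 1 + ε * ‖k - q‖ := by positivity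
    have : r - 1 = (ε * (‖k‖ - ‖k - q‖)) / (1 + ε * ‖k - q‖) := by
      simp only [r]; field_simp; ring
    rw [this, abs_div, abs_of_pos hp, div_le_iff₀ hp, abs_mul, abs_of_nonneg h0]
    have h3 : |‖k‖ - ‖k - q‖| ≤ ‖q‖ := by
      have := abs_norm_sub_norm_le k (k - q); simpa using this
    have h4 := mul_le_mul_of_nonneg_left h3 h0
    have h5 : ‖q‖ ≤ wt q := by unfold wt; linarith
    have h6 := mul_le_mul_of_nonneg_left h5 h0
    nlinarith [mul_nonneg h0 (wt_pos q).le, mul_nonneg h0 (norm_nonneg (k-q)), mul_nonneg (mul_nonneg h0 (wt_pos q).le) (mul_nonneg h0 (norm_nonneg (k-q)))]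
  have hr2 : r ≤ wt q := by
    have := (wte_adm (d := d) h0 h1 1).2 k q
    simp only [wte, pow_one] at this
    simp only [r]; rwa [div_le_iff₀ (by positivity)]
  have hw := one_le_wt q
  clear_value r
  induction s with
  | zero => simp
  | succ s ih =>
    have : r ^ (s+1) - 1 = r * (r ^ s - 1) + (r - 1) := by ring
    rw [this]
    calc |r * (r ^ s - 1) + (r - 1)| ≤ |r| * |r ^ s - 1| + |r - 1| := by
          rw [← abs_mul]; exact abs_add_le _ _
      _ ≤ wt q * (ε * (s * wt q ^ s)) + ε * wt q := by
          rw [abs_of_nonneg hr0]; gcongr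
      _ ≤ wt q * (ε * (s * wt q ^ s)) + ε * wt q ^ (s+1) := by
          gcongr; exact le_self_pow₀ hw (by omega)
      _ = _ := by push_cast; ring

lemma Aop_perturb {a : (Fin d → ℤ) → F →L[ℝ] Fp} (ha : Rapid a) {ε : ℝ} (h0 : 0 ≤ ε) (h1 : ε ≤ 1) (s : ℕ) :
    ‖Aop a (wte ε s) - Aop a (wte 1 0)‖ ≤ ε * (s * ∑' q, wt q ^ s * ‖a q‖) := by
  have A1 := Aop_hasSum ha (wte_adm (d := d) h0 h1 s)
  have A2 := Aop_hasSum ha (wte_adm (d := d) zero_le_one le_rfl 0)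
  have hS := ((ha s).hasSum.mul_left (s:ℝ)).mul_left ε
  refine (A1.sub A2).norm_le_of_bounded hS fun q => ?_
  have B1 := Aop_bd (a := a) (wte_adm (d := d) h0 h1 s) q
  have B2 := Aop_bd (a := a) (wte_adm (d := d) zero_le_one le_rfl 0) q
  have : dsh (fun k => (wte ε s k / wte ε s (k - q)) • a q) q - dsh (fun k => (wte 1 0 k / wte 1 0 (k - q)) • a q) q
    = dsh (fun k => (wte ε s k / wte ε s (k - q) - 1) • a q) q := by
    have B3 : Bd (fun k => (wte ε s k / wte ε s (k - q) - 1) • a q) := by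
      refine ⟨wt q ^ s * ‖a q‖ + ‖a q‖, fun k => ?_⟩
      beta_reduce
      rw [sub_smul, one_smul]
      exact (norm_sub_le _ _).trans (add_le_add (B1 k) le_rfl)
    ext x k
    simp only [ContinuousLinearMap.sub_apply, HS.sub_apply]
    rw [dsh_apply ⟨_, B1⟩, dsh_apply ⟨_, B2⟩, dsh_apply B3]
    simp [wte, sub_smul]
  rw [this]
  refine dsh_norm (fun k => ?_) q
  rw [norm_smul, Real.norm_eq_abs]
  calc _ ≤ (ε * (s * wt q ^ s)) * ‖a q‖ := by gcongr; exact wte_ratio h0 h1 s k q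
    _ = _ := by ring

end ops
end

section
open MeasureTheory
open scoped BigOperators Topology RealInnerProductSpace
set_option linter.all false
set_option linter.deprecated false

/-- complex structure on a real inner product space -/
class CS (F : Type*) [NormedAddCommGroup F] [InnerProductSpace ℝ F] where
  cs : ℂ →L[ℝ] F →L[ℝ] F
  cs_one : ∀ x : F, cs 1 x = x
  cs_mul : ∀ (a b : ℂ) (x : F), cs (a * b) x = cs a (cs b x)
  cs_norm : ∀ (a : ℂ) (x : F), ‖cs a x‖ = ‖a‖ * ‖x‖
  cs_inner : ∀ (c : ℂ) (a b : F), ⟪cs c a, b⟫ = ⟪a, cs ((starRingEnd ℂ) c) b⟫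

open CS
/-- complex multiplication on `ℂ^ι` as a real bilinear map -/
def lsm (ι : Type*) [Fintype ι] : ℂ →L[ℝ] EuclideanSpace ℂ ι →L[ℝ] EuclideanSpace ℂ ι :=
  LinearMap.mkContinuous₂ (LinearMap.mk₂ ℝ (fun (c : ℂ) (x : EuclideanSpace ℂ ι) => c • x)
    (fun a b x => add_smul a b x) (fun r a x => smul_assoc r a x) (fun a x y => smul_add a x y)
    (fun r a x => smul_comm a r x)) 1 (fun c x => by
      rw [LinearMap.mk₂_apply, norm_smul, one_mul])
lemma lsm_apply (ι : Type*) [Fintype ι] (c : ℂ) (x : EuclideanSpace ℂ ι) : lsm ι c x = c • x := rfl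

instance {ι : Type*} [Fintype ι] : CS (EuclideanSpace ℂ ι) where
  cs := lsm ι
  cs_one x := by rw [lsm_apply, one_smul]
  cs_mul a b x := by simp only [lsm_apply, mul_smul]
  cs_norm a x := by rw [lsm_apply, norm_smul]
  cs_inner c a b := by
    rw [lsm_apply, lsm_apply, PiLp.inner_apply, PiLp.inner_apply]
    refine Finset.sum_congr rfl fun i _ => ?_
    simp [Complex.inner]; ring

section cslem
variable {F : Type*} [NormedAddCommGroup F] [InnerProductSpace ℝ F] [CS F]
lemma cs_real (r : ℝ) (x : F) : cs (r : ℂ) x = r • x := by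
  have h : (r : ℂ) = r • (1 : ℂ) := by simp
  rw [h, map_smul, ContinuousLinearMap.smul_apply, cs_one]
lemma cs_comm (a b : ℂ) (x : F) : cs a (cs b x) = cs b (cs a x) := by
  rw [← cs_mul, ← cs_mul, mul_comm]
lemma cs_smul (a : ℂ) (r : ℝ) (x : F) : cs a (r • x) = r • cs a x := map_smul _ _ _
end cslem

/-- the basic smoothing operator -/
def wi (s : ℕ) {d : ℕ} (k : Fin d → ℤ) : ℝ := (wt k ^ s)⁻¹
lemma wi_pos (s : ℕ) {d : ℕ} (k : Fin d → ℤ) : 0 < wi s k := by have := wt_pos k; unfold wi; positivity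
lemma wi_le (s : ℕ) {d : ℕ} (k : Fin d → ℤ) : |wi s k| ≤ 1 := by
  rw [abs_of_pos (wi_pos s k)]; unfold wi
  exact inv_le_one_of_one_le₀ (one_le_pow₀ (one_le_wt k))
lemma wi_bd (s d : ℕ) : ∃ C, ∀ k : Fin d → ℤ, |wi s k| ≤ C := ⟨1, wi_le s⟩
lemma wi_add (s t : ℕ) {d : ℕ} (k : Fin d → ℤ) : wi s k * wi t k = wi (s + t) k := by
  unfold wi; rw [pow_add, mul_inv]
lemma wi_cancel {r σ : ℕ} (h : r ≤ σ) {d : ℕ} (k : Fin d → ℤ) : wi σ k * wt k ^ r = wi (σ - r) k := by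
  have := wt_ne k
  have e : wt k ^ σ = wt k ^ (σ - r) * wt k ^ r := by rw [← pow_add]; congr 1; omega
  unfold wi; rw [e]; field_simp

lemma summable_wi {σ d : ℕ} (hσ : 2 * d ≤ σ) : Summable (fun k : Fin d → ℤ => wi σ k) := summable_wt' σ hσ

section evo
variable {d : ℕ} {F Fp : Type*} [NormedAddCommGroup F] [InnerProductSpace ℝ F] [CS F]
  [CompleteSpace F] [NormedAddCommGroup Fp] [InnerProductSpace ℝ Fp] [CS Fp]
  [CompleteSpace Fp]

lemma HS.ev_norm (k : Fin d → ℤ) : ‖(HS.ev k : HS d F →L[ℝ] F)‖ ≤ 1 :=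
  LinearMap.mkContinuous_norm_le _ zero_le_one _

/-- scalar to term -/
def evS (σ : ℕ) (k : Fin d → ℤ) : ℂ →L[ℝ] (HS d F →L[ℝ] F) :=
  wi σ k • ((ContinuousLinearMap.compL ℝ (HS d F) F F).flip (HS.ev k)).comp (cs)
lemma evS_apply (σ : ℕ) (k : Fin d → ℤ) (c : ℂ) (z : HS d F) : (evS σ k c : HS d F →L[ℝ] F) z = wi σ k • (cs c (z k)) := rfl
lemma evS_le' (σ : ℕ) (k : Fin d → ℤ) (c : ℂ) : ‖(evS σ k c : HS d F →L[ℝ] F)‖ ≤ wi σ k * ‖c‖ := by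
  refine ContinuousLinearMap.opNorm_le_bound _ (mul_nonneg (wi_pos σ k).le (norm_nonneg _)) fun z => ?_
  rw [evS_apply, norm_smul, cs_norm, Real.norm_of_nonneg (wi_pos σ k).le]
  have h1 := mul_le_mul_of_nonneg_left (HS.norm_apply_le z k) (norm_nonneg c)
  have h2 := mul_le_mul_of_nonneg_left h1 (wi_pos σ k).le
  linarith
lemma evS_le (σ : ℕ) (k : Fin d → ℤ) {c : ℂ} (hc : ‖c‖ = 1) : ‖(evS σ k c : HS d F →L[ℝ] F)‖ ≤ wi σ k := by
  have := evS_le' (F := F) σ k c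
  rwa [hc, mul_one] at this
lemma evS_norm (σ : ℕ) (k : Fin d → ℤ) : ‖(evS σ k : ℂ →L[ℝ] (HS d F →L[ℝ] F))‖ ≤ wi σ k := by
  exact ContinuousLinearMap.opNorm_le_bound _ (wi_pos σ k).le fun c => evS_le' σ k c

/-- point evaluation of the function with coefficients `wt^{-σ} z` -/
def evo (σ : ℕ) (y : Euc d) : HS d F →L[ℝ] F := ∑' k, evS σ k (ek k y)

lemma evo_hasSum {σ : ℕ} (hσ : 2 * d ≤ σ) (y : Euc d) :
    HasSum (fun k => evS σ k (ek k y)) (evo σ y : HS d F →L[ℝ] F) := by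
  have h : ∀ k, ‖(evS σ k (ek k y) : HS d F →L[ℝ] F)‖ ≤ wi σ k := fun k => by
    exact evS_le σ k (ek_norm k y)
  exact (Summable.of_norm (Summable.of_nonneg_of_le (fun k => norm_nonneg _) h (summable_wi hσ))).hasSum

lemma evo_apply {σ : ℕ} (hσ : 2 * d ≤ σ) (y : Euc d) (z : HS d F) :
    HasSum (fun k => wi σ k • (cs (ek k y) (z k))) (evo σ y z) := by
  have h := (ContinuousLinearMap.apply ℝ F z).hasSum (evo_hasSum hσ y)
  exact h

lemma evo_contDiff {σ r : ℕ} (hσ : r + 2 * d ≤ σ) :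
    ContDiff ℝ (r : ℕ∞) (fun y : Euc d => (evo σ y : HS d F →L[ℝ] F)) := by
  unfold evo
  refine contDiff_tsum (𝕜 := ℝ) (v := fun i k => wi σ k * ‖(kd k : Euc d →L[ℝ] ℝ)‖ ^ i)
    (f := fun k y => (evS σ k (ek k y) : HS d F →L[ℝ] F)) (fun k => (evS σ k : ℂ →L[ℝ] HS d F →L[ℝ] F).contDiff.comp (ek_contDiff k)) ?_ ?_
  · intro i hi
    have hi : i ≤ r := by exact_mod_cast hi
    refine Summable.of_nonneg_of_le (fun k => by have := wi_pos σ k; positivity) (fun k => ?_)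
      ((summable_wt' (d := d) (σ - i) (by omega)).mul_left ((2 * Real.pi * d) ^ i))
    have h1 : ‖(kd k : Euc d →L[ℝ] ℝ)‖ ≤ (2 * Real.pi * d) * wt k := by
      refine (kd_norm k).trans ?_
      unfold wt
      have : 0 ≤ 2 * Real.pi * d := by positivity
      nlinarith [norm_nonneg k]
    have h0 := wi_pos σ k
    calc _ ≤ wi σ k * ((2 * Real.pi * d) * wt k) ^ i := by gcongr
      _ = (2 * Real.pi * d) ^ i * (wi σ k * wt k ^ i) := by ring
      _ = _ := by rw [wi_cancel (by omega)]; rfl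
  · intro i k y hi
    have h1 := (evS σ k : ℂ →L[ℝ] HS d F →L[ℝ] F).norm_iteratedFDeriv_comp_left (x := y) (n := i) ((ek_contDiff (n := (i:ℕ∞)) k).contDiffAt) le_rfl
    have h2 := ek_iter k i y
    have h3 := evS_norm (F := F) σ k
    exact h1.trans (mul_le_mul h3 h2 (norm_nonneg _) (wi_pos σ k).le)

lemma evo_continuous {σ : ℕ} (hσ : 2 * d ≤ σ) :
    Continuous (fun y : Euc d => (evo σ y : HS d F →L[ℝ] F)) :=
  (evo_contDiff (r := 0) (σ := σ) (by omega)).continuous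

/-- smoothing by `s` -/
def Js (s : ℕ) : HS d F →L[ℝ] HS d F := mul (wi s)
lemma Js_apply (s : ℕ) (z : HS d F) (k) : Js s z k = wi s k • z k := mul_apply' (wi_bd s d) z k
lemma Js_Js (s t : ℕ) (z : HS d F) : Js s (Js t z) = Js (s + t) z := mul_mul (wi_bd s d) (wi_bd t d) (wi_add s t) z
lemma Js_zero (z : HS d F) : Js 0 z = z := mul_one' (fun k => by simp [wi]) z
lemma Js_inj (s : ℕ) {z w : HS d F} (h : Js s z = Js s w) : z = w := by
  ext k
  have := congrArg (fun x : HS d F => x k) h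
  simp only [Js_apply] at this
  exact smul_right_injective F (wi_pos s k).ne' this
lemma Js_inner (s : ℕ) (z w : HS d F) : ⟪Js s z, w⟫ = ⟪z, Js s w⟫ := mul_inner (wi_bd s d) z w
lemma Js_norm (s : ℕ) : ‖(Js s : HS d F →L[ℝ] HS d F)‖ ≤ 1 := mul_norm (wi_le s)

lemma evo_Js {σ : ℕ} (hσ : 2 * d ≤ σ) (s : ℕ) (y : Euc d) (z : HS d F) : evo σ y (Js s z) = evo (σ + s) y z := by
  refine (evo_apply hσ y (Js s z)).unique ?_
  have := evo_apply (show 2 * d ≤ σ + s by omega) y z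
  have e : (fun k => wi σ k • (cs (ek k y) (Js s z k))) = fun k => wi (σ + s) k • (cs (ek k y) (z k)) := by
    funext k
    rw [Js_apply, cs_smul, smul_smul, wi_add]
  rw [e]; exact this

/-- complex diagonal multiplier -/
def cmul (θ : (Fin d → ℤ) → ℂ) : HS d F →L[ℝ] HS d F := diag (fun k => cs (θ k))
lemma cmul_bd {θ : (Fin d → ℤ) → ℂ} {C : ℝ} (h : ∀ k, ‖θ k‖ ≤ C) (k) :
    ‖(cs (θ k) : F →L[ℝ] F)‖ ≤ C :=
  ContinuousLinearMap.opNorm_le_bound _ ((norm_nonneg _).trans (h k)) fun x => by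
    rw [cs_norm]; exact mul_le_mul_of_nonneg_right (h k) (norm_nonneg _)
lemma cmul_apply {θ : (Fin d → ℤ) → ℂ} (h : ∃ C, ∀ k, ‖θ k‖ ≤ C) (x : HS d F) (k) :
    cmul θ x k = cs (θ k) (x k) := by
  obtain ⟨C, h⟩ := h
  rw [cmul, diag_apply ⟨C, cmul_bd h⟩]
lemma cmul_norm {θ : (Fin d → ℤ) → ℂ} {C : ℝ} (h : ∀ k, ‖θ k‖ ≤ C) : ‖(cmul θ : HS d F →L[ℝ] HS d F)‖ ≤ C :=
  diag_norm (cmul_bd h)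

/-- symbol of the smoothed directional derivative -/
def sy (v : Euc d) (k : Fin d → ℤ) : ℂ := ((wi 1 k * kd k v : ℝ) : ℂ) * Complex.I
lemma sy_le (v : Euc d) (k : Fin d → ℤ) : ‖sy v k‖ ≤ 2 * Real.pi * d * ‖v‖ := by
  unfold sy
  rw [norm_mul, Complex.norm_I, mul_one, Complex.norm_real, norm_mul, Real.norm_of_nonneg (wi_pos 1 k).le]
  have h1 : ‖kd k v‖ ≤ (2 * Real.pi * d * ‖k‖) * ‖v‖ := (kd k).le_of_opNorm_le (kd_norm k) v
  have h2 : wi 1 k * wt k = 1 := by have := wt_ne k; unfold wi; field_simp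
  have h3 : ‖k‖ ≤ wt k := by unfold wt; linarith
  have h0 := wi_pos 1 k
  calc wi 1 k * ‖kd k v‖ ≤ wi 1 k * ((2 * Real.pi * d * wt k) * ‖v‖) := by
        refine mul_le_mul_of_nonneg_left (h1.trans ?_) h0.le
        gcongr
    _ = (wi 1 k * wt k) * (2 * Real.pi * d * ‖v‖) := by ring
    _ = _ := by rw [h2, one_mul]
lemma sy_bd (v : Euc d) : ∃ C, ∀ k, ‖sy v k‖ ≤ C := ⟨_, sy_le v⟩
/-- smoothed directional derivative -/
def dh (v : Euc d) : HS d F →L[ℝ] HS d F := cmul (sy v)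
lemma dh_apply (v : Euc d) (x : HS d F) (k) : dh v x k = cs (sy v k) (x k) := cmul_apply (sy_bd v) x k
lemma dh_norm (v : Euc d) : ‖(dh v : HS d F →L[ℝ] HS d F)‖ ≤ 2 * Real.pi * d * ‖v‖ := cmul_norm (sy_le v)
lemma dh_Js (v : Euc d) (s : ℕ) (x : HS d F) : dh v (Js s x) = Js s (dh v x) := by
  ext k; rw [dh_apply, Js_apply, Js_apply, dh_apply, cs_smul]
lemma dh_dh (v w : Euc d) (x : HS d F) : dh v (dh w x) = dh w (dh v x) := by
  ext k; simp only [dh_apply]; rw [cs_comm]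

lemma evo_hasFDerivAt {σ : ℕ} (hσ : 2 * d ≤ σ) (z : HS d F) (y : Euc d) (v : Euc d) :
    HasFDerivAt (fun y => evo (σ + 1) y z) (fderiv ℝ (fun y => evo (σ + 1) y z) y) y ∧
    fderiv ℝ (fun y => evo (σ + 1) y z) y v = evo σ y (dh v z) := by
  have hd : Differentiable ℝ (fun y : Euc d => (evo (σ + 1) y : HS d F →L[ℝ] F)) :=
    (evo_contDiff (r := 1) (σ := σ + 1) (by omega)).differentiable (by simp)
  have hd' : DifferentiableAt ℝ (fun y => evo (σ + 1) y z) y := (hd y).clm_apply (differentiableAt_const z)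
  refine ⟨hd'.hasFDerivAt, ?_⟩
  let T : (Fin d → ℤ) → ℂ →L[ℝ] F := fun k => (ContinuousLinearMap.apply ℝ F z).comp (evS (σ + 1) k)
  have hT : ∀ k c, T k c = wi (σ + 1) k • (cs c (z k)) := fun k c => rfl
  have hTn : ∀ k, ‖T k‖ ≤ wi (σ + 1) k * ‖z‖ := fun k => by
    refine ContinuousLinearMap.opNorm_le_bound _ (mul_nonneg (wi_pos _ k).le (norm_nonneg _)) fun c => ?_
    rw [hT, norm_smul, cs_norm, Real.norm_of_nonneg (wi_pos _ k).le]
    have h1 := mul_le_mul_of_nonneg_left (HS.norm_apply_le z k) (norm_nonneg c)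
    have h2 := mul_le_mul_of_nonneg_left h1 (wi_pos (σ+1) k).le
    linarith
  have e : (fun y => evo (σ + 1) y z) = fun y => ∑' k, T k (ek k y) := by
    funext y; exact (evo_apply (by omega) y z).tsum_eq.symm
  have key : HasFDerivAt (fun y => ∑' k, T k (ek k y)) (∑' k, (T k).comp (fderiv ℝ (ek k) y)) y := by
    refine hasFDerivAt_tsum (𝕜 := ℝ) (u := fun k => (2 * Real.pi * d * ‖z‖) * wi σ k) (f' := fun k y => (T k).comp (fderiv ℝ (ek k) y))
      (x₀ := y) ?_ (fun k x => ?_) (fun k x => ?_) ?_ y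
    · exact (summable_wt' σ hσ).mul_left _
    · exact (T k).hasFDerivAt.comp x (((ek_contDiff (n := 1) k).differentiable (by simp)) x).hasFDerivAt
    · refine (ContinuousLinearMap.opNorm_comp_le _ _).trans ?_
      have h1 : ‖fderiv ℝ (ek k) x‖ ≤ 2 * Real.pi * d * wt k := by
        have := ek_iter k 1 x
        rw [← norm_iteratedFDeriv_one] 
        refine this.trans ?_
        rw [pow_one]
        refine (kd_norm k).trans ?_
        have h3 : ‖k‖ ≤ wt k := by unfold wt; linarith
        gcongr
      calc _ ≤ (wi (σ + 1) k * ‖z‖) * (2 * Real.pi * d * wt k) :=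
            mul_le_mul (hTn k) h1 (norm_nonneg _) (mul_nonneg (wi_pos _ k).le (norm_nonneg _))
        _ = (2 * Real.pi * d * ‖z‖) * (wi (σ + 1) k * wt k ^ 1) := by ring
        _ = _ := by rw [wi_cancel (by omega)]; rfl
    · exact (evo_apply (by omega) y z).summable
  have hsum : Summable (fun k => (T k).comp (fderiv ℝ (ek k) y)) := by
    refine Summable.of_norm_bounded ((summable_wt' σ hσ).mul_left (2 * Real.pi * d * ‖z‖)) fun k => ?_
    refine (ContinuousLinearMap.opNorm_comp_le _ _).trans ?_
    have h1 : ‖fderiv ℝ (ek k) y‖ ≤ 2 * Real.pi * d * wt k := by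
      have := ek_iter k 1 y
      rw [← norm_iteratedFDeriv_one] 
      refine this.trans ?_
      rw [pow_one]
      refine (kd_norm k).trans ?_
      have h3 : ‖k‖ ≤ wt k := by unfold wt; linarith
      gcongr
    calc _ ≤ (wi (σ + 1) k * ‖z‖) * (2 * Real.pi * d * wt k) :=
          mul_le_mul (hTn k) h1 (norm_nonneg _) (mul_nonneg (wi_pos _ k).le (norm_nonneg _))
      _ = (2 * Real.pi * d * ‖z‖) * (wi (σ + 1) k * wt k ^ 1) := by ring
      _ = _ := by rw [wi_cancel (by omega)]; rfl
  rw [e, key.fderiv]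
  have h4 := (ContinuousLinearMap.apply ℝ F v).hasSum hsum.hasSum
  refine HasSum.unique h4 ?_
  have h5 := evo_apply hσ y (dh v z)
  have e2 : (fun k => wi σ k • (cs (ek k y) (dh v z k))) = fun k => (ContinuousLinearMap.apply ℝ F v) ((T k).comp (fderiv ℝ (ek k) y)) := by
    funext k
    rw [dh_apply, ContinuousLinearMap.apply_apply, ContinuousLinearMap.comp_apply, hT, (ek_hasFDerivAt k y).fderiv]
    rw [← wi_add, mul_smul, ← cs_mul, ← cs_real (wi 1 k), ← cs_mul]
    congr 2
    simp only [sy, ContinuousLinearMap.smul_apply, ContinuousLinearMap.smulRight_apply, ContinuousLinearMap.comp_apply, Complex.ofRealCLM_apply, smul_eq_mul]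
    push_cast
    ring_nf
  rw [e2] at h5; exact h5

/-- translation -/
def Sh (c : Euc d) : HS d F →L[ℝ] HS d F := cmul (fun k => ek k c)
lemma Sh_apply (c : Euc d) (x : HS d F) (k) : Sh c x k = cs (ek k c) (x k) := cmul_apply ⟨1, fun k => by simp [ek_norm]⟩ x k
lemma Sh_norm (c : Euc d) (x : HS d F) : ‖Sh c x‖ = ‖x‖ := by
  have h : ‖Sh c x‖ ^ 2 = ‖x‖ ^ 2 := by
    rw [HS.norm_sq, HS.norm_sq]; simp only [Sh_apply, cs_norm, ek_norm, one_mul]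
  exact (pow_left_inj₀ (norm_nonneg _) (norm_nonneg _) two_ne_zero).1 h
lemma Sh_Js (c : Euc d) (s : ℕ) (x : HS d F) : Sh c (Js s x) = Js s (Sh c x) := by
  ext k; rw [Sh_apply, Js_apply, Js_apply, Sh_apply, cs_smul]
lemma Sh_dh (c v : Euc d) (x : HS d F) : Sh c (dh v x) = dh v (Sh c x) := by
  ext k; simp only [Sh_apply, dh_apply]; rw [cs_comm]
lemma Sh_zero (x : HS d F) : Sh (0 : Euc d) x = x := by ext k; simp [Sh_apply, cs_one]
lemma evo_Sh {σ : ℕ} (hσ : 2 * d ≤ σ) (y c : Euc d) (z : HS d F) : evo σ y (Sh c z) = evo σ (y + c) z := by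
  refine (evo_apply hσ y (Sh c z)).unique ?_
  have := evo_apply hσ (y + c) z
  have e : (fun k => wi σ k • (cs (ek k y) (Sh c z k))) = fun k => wi σ k • (cs (ek k (y + c)) (z k)) := by
    funext k; rw [Sh_apply, ← cs_mul, ek_shift]
  rw [e]; exact this

lemma evo_per {σ : ℕ} : Per (fun y : Euc d => (evo σ y : HS d F →L[ℝ] F)) := by
  intro y z
  simp only [evo, ek_periodic]
end evo
end

section
open MeasureTheory
open scoped BigOperators Topology RealInnerProductSpace
set_option linter.all false
set_option linter.deprecated false
open CS

section pars
variable {d : ℕ} {F Fp : Type*} [NormedAddCommGroup F] [InnerProductSpace ℝ F] [CS F]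
  [CompleteSpace F] [NormedAddCommGroup Fp] [InnerProductSpace ℝ Fp] [CS Fp]
  [CompleteSpace Fp]

lemma wte_one (s : ℕ) (k : Fin d → ℤ) : wte 1 s k = wt k ^ s := by unfold wte wt; rw [one_mul]
lemma wte_one_adm (s : ℕ) : Adm (d := d) s (wte 1 s) := wte_adm zero_le_one le_rfl s

/-- weighted conjugates -/
def As (a : (Fin d → ℤ) → F →L[ℝ] Fp) (s : ℕ) : HS d F →L[ℝ] HS d Fp := Aop a (wte 1 s)

lemma Js_As {a : (Fin d → ℤ) → F →L[ℝ] Fp} (ha : Rapid a) (s t : ℕ) (x : HS d F) :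
    Js t (As a (s + t) x) = As a s (Js t x) := by
  refine mul_Aop ha (wte_one_adm (s + t)) (wte_one_adm s) (wi_bd t d) (fun k => ?_) x
  rw [wte_one, wte_one, wi, pow_add]
  have := wt_ne k
  field_simp

lemma evo_As {σ : ℕ} (hσ : 2 * d ≤ σ) {a : (Fin d → ℤ) → F →L[ℝ] Fp} (ha : Rapid a)
    (hc : ∀ q c x, a q (cs c x) = cs c (a q x)) (y : Euc d) (Ay : F →L[ℝ] Fp)
    (hA : ∀ x, HasSum (fun q => cs (ek q y) (a q x)) (Ay x)) (z : HS d F) :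
    evo σ y (As a σ z) = Ay (evo σ y z) := by
  have hρ := wte_one_adm (d := d) σ
  have h1 := (ContinuousLinearMap.apply ℝ (HS d Fp) z).hasSum (Aop_hasSum ha hρ)
  have h2 := (evo σ y : HS d Fp →L[ℝ] Fp).hasSum h1
  refine h2.unique ?_
  have h3 := hA (evo σ y z)
  have e : (fun q => cs (ek q y) (a q (evo σ y z))) = fun q => (evo σ y : HS d Fp →L[ℝ] Fp) ((ContinuousLinearMap.apply ℝ (HS d Fp) z)
      (dsh (fun k => (wte 1 σ k / wte 1 σ (k - q)) • a q) q)) := by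
    funext q
    rw [ContinuousLinearMap.apply_apply]
    have h4 := ((cs (ek q y) : Fp →L[ℝ] Fp).comp (a q)).hasSum (evo_apply hσ y z)
    rw [← (Equiv.subRight q).hasSum_iff] at h4
    refine h4.unique ?_
    have h5 := evo_apply hσ y (dsh (fun k => (wte 1 σ k / wte 1 σ (k - q)) • a q) q z)
    have e2 : (fun k => wi σ k • (cs (ek k y) (dsh (fun k => (wte 1 σ k / wte 1 σ (k - q)) • a q) q z k))) =
      (fun k => ((cs (ek q y) : Fp →L[ℝ] Fp).comp (a q)) (wi σ k • (cs (ek k y) (z k)))) ∘ (Equiv.subRight q) := by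
      funext k
      rw [dsh_apply ⟨_, Aop_bd hρ q⟩]
      change _ = ((cs (ek q y) : Fp →L[ℝ] Fp).comp (a q)) (wi σ (k - q) • (cs (ek (k - q) y) (z (k - q))))
      simp only [ContinuousLinearMap.smul_apply, ContinuousLinearMap.comp_apply, map_smul, hc]
      rw [← cs_mul, ← ek_add, smul_smul]
      have e4 : q + (k - q) = k := by abel
      rw [e4]
      congr 1
      rw [wte_one, wte_one, wi, wi]
      have := wt_ne k
      field_simp
    rw [e2] at h5; exact h5
  rw [e] at h3; exact h3

/-- Gram operator of the evaluation -/
def gram (σ : ℕ) (y : Euc d) : HS d F →L[ℝ] HS d F :=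
  (ContinuousLinearMap.adjoint (evo σ y : HS d F →L[ℝ] F)).comp (evo σ y)

lemma gram_cont {σ : ℕ} (hσ : 2 * d ≤ σ) : Continuous (fun y : Euc d => (gram σ y : HS d F →L[ℝ] HS d F)) := by
  have h := evo_continuous (F := F) hσ
  have h2 : Continuous (fun y : Euc d => ContinuousLinearMap.adjoint (evo σ y : HS d F →L[ℝ] F)) :=
    (ContinuousLinearMap.adjoint (𝕜 := ℝ) (E := HS d F) (F := F)).continuous.comp h
  exact h2.clm_comp h

lemma evo_single {σ : ℕ} (hσ : 2 * d ≤ σ) (y : Euc d) (k : Fin d → ℤ) (a : F) :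
    evo σ y (HS.single k a) = wi σ k • cs (ek k y) a := by
  refine (evo_apply hσ y _).unique ?_
  have := hasSum_ite_eq k (wi σ k • cs (ek k y) a)
  have e : (fun l => wi σ l • (cs (ek l y) (HS.single k a l))) = fun l => if l = k then wi σ k • cs (ek k y) a else 0 := by
    funext l
    rw [HS.single_apply]
    split_ifs with h
    · rw [h]
    · simp
  rw [e]; exact this

lemma HS.inner_single (k : Fin d → ℤ) (a : F) (z : HS d F) : ⟪HS.single k a, z⟫ = ⟪a, z k⟫ := by
  rw [HS.inner_eq, tsum_eq_single k]
  · rw [HS.single_apply, if_pos rfl]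
  · intro l hl; rw [HS.single_apply, if_neg hl, inner_zero_left]

lemma HS.clm_ext {T S : HS d F →L[ℝ] HS d F} (h : ∀ k a l b, ⟪T (HS.single k a), HS.single l b⟫ = ⟪S (HS.single k a), HS.single l b⟫) :
    T = S := by
  ext1 z
  have h1 : ∀ k a, T (HS.single k a) = S (HS.single k a) := by
    intro k a
    ext l
    refine ext_inner_right ℝ fun b => ?_
    have := h k a l b
    rw [real_inner_comm, HS.inner_single, real_inner_comm _ (S _), HS.inner_single] at this
    rw [real_inner_comm, this, real_inner_comm]
  have h2 := T.hasSum (HS.hasSum_single z)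
  have h3 := S.hasSum (HS.hasSum_single z)
  simp only [h1] at h2
  exact h2.unique h3

lemma parseval {σ : ℕ} (hσ : 2 * d ≤ σ) (z w : HS d F) :
    ∫ y in unitCell d, ⟪evo σ y z, evo σ y w⟫ = ⟪Js σ z, Js σ w⟫ := by
  have hi : IntegrableOn (fun y : Euc d => (gram σ y : HS d F →L[ℝ] HS d F)) (unitCell d) := cell_integrable (gram_cont hσ)
  have key : ∀ z w : HS d F, ⟪(∫ y in unitCell d, (gram σ y : HS d F →L[ℝ] HS d F)) z, w⟫ =
      ∫ y in unitCell d, ⟪evo σ y z, evo σ y w⟫ := by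
    intro z w
    rw [ContinuousLinearMap.integral_apply hi]
    rw [real_inner_comm, ← integral_inner (hi.apply_continuousLinearMap z)]
    refine integral_congr_ae (Filter.Eventually.of_forall fun y => ?_)
    simp only [gram, ContinuousLinearMap.comp_apply]
    rw [ContinuousLinearMap.adjoint_inner_right, real_inner_comm]
  have hT : (∫ y in unitCell d, (gram σ y : HS d F →L[ℝ] HS d F)) = Js (σ + σ) := by
    refine HS.clm_ext fun k a l b => ?_
    rw [key]
    have e1 : ∀ y : Euc d, ⟪(evo σ y : HS d F →L[ℝ] F) (HS.single k a), (evo σ y : HS d F →L[ℝ] F) (HS.single l b)⟫ =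
        wi σ k * (wi σ l * ⟪a, (ContinuousLinearMap.flip cs b : ℂ →L[ℝ] F) (ek (l - k) y)⟫) := by
      intro y
      rw [evo_single hσ, evo_single hσ, real_inner_smul_left, real_inner_smul_right, cs_inner, ← ek_neg, ← cs_mul, ← ek_add, neg_add_eq_sub]; rfl
    simp only [e1]
    rw [integral_const_mul, integral_const_mul, integral_inner (𝕜 := ℝ), ContinuousLinearMap.integral_comp_comm, cell_ek]
    · rw [real_inner_comm (HS.single l b), HS.inner_single, Js_apply, HS.single_apply]
      by_cases h : l = k
      · subst h
        simp only [sub_self, if_true, ContinuousLinearMap.flip_apply, cs_one, real_inner_smul_right]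
        rw [real_inner_comm, ← wi_add]; ring
      · simp [sub_eq_zero, h]
    · exact cell_integrable (ek_continuous _)
    · exact cell_integrable ((ContinuousLinearMap.continuous _).comp (ek_continuous _))
  rw [← key, hT, Js_inner, ← Js_Js, ← Js_inner]

lemma parseval_norm {σ : ℕ} (hσ : 2 * d ≤ σ) (z : HS d F) :
    ∫ y in unitCell d, ‖evo σ y z‖ ^ 2 = ‖Js σ z‖ ^ 2 := by
  have := parseval hσ z z
  simpa only [real_inner_self_eq_norm_sq] using this

lemma Js_dense (s : ℕ) : DenseRange (Js s : HS d F →L[ℝ] HS d F) := by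
  intro x
  refine mem_closure_of_tendsto (HS.hasSum_single x) (Filter.Eventually.of_forall fun t => ?_)
  refine ⟨∑ k ∈ t, HS.single k ((wi s k)⁻¹ • x k), ?_⟩
  rw [map_sum]
  refine Finset.sum_congr rfl fun k _ => ?_
  ext l
  rw [Js_apply, HS.single_apply, HS.single_apply]
  split_ifs with h
  · rw [h, smul_smul, mul_inv_cancel₀ (wi_pos s k).ne', one_smul]
  · simp

lemma Aop_coercive {a : (Fin d → ℤ) → F →L[ℝ] F} (ha : Rapid a)
    (hc : ∀ q c x, a q (cs c x) = cs c (a q x)) (A : Euc d → F →L[ℝ] F) (hAc : Continuous A)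
    (hA : ∀ y x, HasSum (fun q => cs (ek q y) (a q x)) (A y x)) {lam : ℝ}
    (hl : ∀ y x, lam * ‖x‖ ^ 2 ≤ ⟪A y x, x⟫) (x : HS d F) :
    lam * ‖x‖ ^ 2 ≤ ⟪As a 0 x, x⟫ := by
  refine (Js_dense (2 * d)).induction_on (p := fun x : HS d F => lam * ‖x‖ ^ 2 ≤ ⟪As a 0 x, x⟫) x ?_ ?_
  · exact isClosed_le (by fun_prop) (by fun_prop)
  · intro z
    have h0 := Js_As ha 0 (2 * d) z
    rw [zero_add] at h0
    rw [← h0, ← parseval le_rfl, ← parseval_norm le_rfl, ← integral_const_mul]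
    have hcz : Continuous (fun y => (evo (2 * d) y z : F)) := (evo_continuous le_rfl).clm_apply continuous_const
    refine integral_mono (cell_integrable (by fun_prop)) (cell_integrable ?_) fun y => ?_
    · exact ((evo_continuous le_rfl).clm_apply continuous_const).inner hcz
    · simp only
      rw [evo_As le_rfl ha hc y (A y) (hA y)]
      exact hl y _

lemma Aop_coercive' {a : (Fin d → ℤ) → F →L[ℝ] F} (ha : Rapid a) {lam : ℝ} (hl0 : 0 < lam)
    (h0 : ∀ x : HS d F, lam * ‖x‖ ^ 2 ≤ ⟪As a 0 x, x⟫) (s : ℕ) :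
    ∃ ε : ℝ, 0 < ε ∧ ε ≤ 1 ∧ ∀ x : HS d F, lam / 2 * ‖x‖ ^ 2 ≤ ⟪Aop a (wte ε s) x, x⟫ := by
  set S := s * ∑' q, wt q ^ s * ‖a q‖
  have hS : 0 ≤ S := by
    refine mul_nonneg (Nat.cast_nonneg s) (tsum_nonneg fun q => mul_nonneg (pow_nonneg (wt_pos q).le _) (norm_nonneg _))
  refine ⟨min 1 (lam / (2 * (S + 1))), by positivity, min_le_left _ _, fun x => ?_⟩
  set ε := min 1 (lam / (2 * (S + 1)))
  have hε0 : 0 < ε := by positivity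
  have hp := Aop_perturb ha hε0.le (min_le_left _ _) s
  have hε : ε * S ≤ lam / 2 := by
    have h1 : ε ≤ lam / (2 * (S + 1)) := min_le_right _ _
    calc ε * S ≤ lam / (2 * (S + 1)) * (S + 1) := by gcongr; linarith
      _ = lam / 2 := by field_simp
  have h2 : |⟪(Aop a (wte ε s) - Aop a (wte 1 0)) x, x⟫| ≤ lam / 2 * ‖x‖ ^ 2 := by
    refine (abs_real_inner_le_norm _ _).trans ?_
    have h3 := (Aop a (wte ε s) - Aop a (wte 1 0)).le_of_opNorm_le (hp.trans hε) x
    calc _ ≤ (lam / 2 * ‖x‖) * ‖x‖ := by gcongr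
      _ = _ := by ring
  have h4 := h0 x
  rw [ContinuousLinearMap.sub_apply, inner_sub_left] at h2
  have h5 := (abs_le.1 h2).1
  unfold As at h4
  linarith
end pars
end

section
open MeasureTheory
open scoped BigOperators Topology RealInnerProductSpace
set_option linter.all false
set_option linter.deprecated false

section lm
variable {H : Type*} [NormedAddCommGroup H] [InnerProductSpace ℝ H] [CompleteSpace H]

lemma lax_bound {X : Submodule ℝ H} {T Q : H →L[ℝ] H} (hQ : ∀ x ∈ X, Q x ∈ X)
    {c : ℝ} (hc0 : 0 < c) (hc : ∀ x, c * ‖x‖ ^ 2 ≤ ⟪T x, Q x⟫) {f u : H} (hu : u ∈ X)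
    (h : ∀ v ∈ X, ⟪T u, v⟫ = ⟪f, v⟫) : ‖u‖ ≤ ‖Q‖ / c * ‖f‖ := by
  have h1 := hc u
  rw [h _ (hQ u hu)] at h1
  have h2 := real_inner_le_norm f (Q u)
  have h3 := Q.le_opNorm u
  have h4 : c * ‖u‖ ^ 2 ≤ ‖f‖ * (‖Q‖ * ‖u‖) := h1.trans (h2.trans (by gcongr))
  rcases eq_or_lt_of_le (norm_nonneg u) with h0 | h0
  · rw [← h0]; positivity
  · have h5 : c * ‖u‖ ≤ ‖f‖ * ‖Q‖ := by
      refine le_of_mul_le_mul_right ?_ h0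
      linarith
    rw [div_mul_eq_mul_div, le_div_iff₀ hc0]
    linarith

lemma lax_unique {X : Submodule ℝ H} {T Q : H →L[ℝ] H} (hQ : ∀ x ∈ X, Q x ∈ X)
    {c : ℝ} (hc0 : 0 < c) (hc : ∀ x, c * ‖x‖ ^ 2 ≤ ⟪T x, Q x⟫) {u w : H} (hu : u ∈ X) (hw : w ∈ X)
    (h : ∀ v ∈ X, ⟪T u, v⟫ = ⟪T w, v⟫) : u = w := by
  have := lax_bound hQ hc0 hc (f := 0) (X.sub_mem hu hw) (fun v hv => by
    rw [map_sub, inner_sub_left, h v hv, sub_self, inner_zero_left])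
  rw [norm_zero, mul_zero] at this
  exact sub_eq_zero.1 (norm_le_zero_iff.1 this)

lemma lax_exists {X : Submodule ℝ H} (hX : IsClosed (X : Set H)) {T Q P : H →L[ℝ] H} (hQ : ∀ x ∈ X, Q x ∈ X)
    (hP : ∀ x ∈ X, P x ∈ X) (hQP : ∀ x, Q (P x) = x)
    {c : ℝ} (hc0 : 0 < c) (hc : ∀ x, c * ‖x‖ ^ 2 ≤ ⟪T x, Q x⟫) (f : H) :
    ∃ u ∈ X, ∀ v ∈ X, ⟪T u, v⟫ = ⟪f, v⟫ := by
  haveI : CompleteSpace X := hX.completeSpace_coe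
  let S : X →L[ℝ] X := X.orthogonalProjection.comp ((ContinuousLinearMap.adjoint Q).comp (T.comp X.subtypeL))
  have hS : ∀ u v : X, ⟪S u, v⟫ = ⟪T u, Q v⟫ := fun u v => by
    change ⟪X.orthogonalProjection ((ContinuousLinearMap.adjoint Q) (T u)), v⟫ = _
    rw [Submodule.inner_orthogonalProjection_eq_of_mem_right, ContinuousLinearMap.adjoint_inner_left]
  let B : X →L[ℝ] X →L[ℝ] ℝ := (innerSL ℝ).comp S
  have hB : ∀ u v : X, B u v = ⟪T u, Q v⟫ := fun u v => hS u v
  have co : IsCoercive B := ⟨c, hc0, fun u => by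
    rw [hB]; have := hc u; simpa [pow_two, mul_assoc] using this⟩
  obtain ⟨u, hu⟩ := (co.continuousLinearEquivOfBilin).surjective (X.orthogonalProjection ((ContinuousLinearMap.adjoint Q) f))
  refine ⟨u, u.2, fun v hv => ?_⟩
  have h1 := co.continuousLinearEquivOfBilin_apply u ⟨P v, hP v hv⟩
  rw [hu, hB, Submodule.inner_orthogonalProjection_eq_of_mem_right, ContinuousLinearMap.adjoint_inner_left] at h1
  simp only [hQP] at h1
  exact h1.symm

/-- inverse of a coercive operator -/
lemma lax_inv {T Q P : H →L[ℝ] H} (hQP : ∀ x, Q (P x) = x)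
    {c : ℝ} (hc0 : 0 < c) (hc : ∀ x, c * ‖x‖ ^ 2 ≤ ⟪T x, Q x⟫) :
    ∃ S : H →L[ℝ] H, (∀ x, T (S x) = x) ∧ (∀ x, S (T x) = x) ∧ ‖S‖ ≤ ‖Q‖ / c := by
  have hex : ∀ f, ∃ u, T u = f := fun f => by
    obtain ⟨u, -, hu⟩ := lax_exists (X := ⊤) isClosed_univ (T := T) (Q := Q) (P := P) (fun _ _ => trivial) (fun _ _ => trivial)
      hQP hc0 hc f
    exact ⟨u, ext_inner_right ℝ fun v => hu v trivial⟩
  have hinj : ∀ u w, T u = T w → u = w := fun u w h =>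
    lax_unique (X := ⊤) (Q := Q) (fun _ _ => trivial) hc0 hc trivial trivial (fun v _ => by rw [h])
  choose g hg using hex
  let S0 : H →ₗ[ℝ] H := { toFun := g, map_add' := fun x y => hinj _ _ (by rw [hg, map_add, hg, hg]), map_smul' := fun r x => hinj _ _ (by
      simp only [RingHom.id_apply]; rw [hg, map_smul, hg]) }
  have hb : ∀ x, ‖S0 x‖ ≤ ‖Q‖ / c * ‖x‖ := fun x =>
    lax_bound (X := ⊤) (T := T) (Q := Q) (fun _ _ => trivial) hc0 hc trivial (fun v _ => by change ⟪T (g x), v⟫ = _; rw [hg])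
  refine ⟨S0.mkContinuous _ hb, fun x => hg x, fun x => hinj _ _ (hg _), LinearMap.mkContinuous_norm_le _ (by positivity) hb⟩
end lm
end

section
open MeasureTheory
open scoped BigOperators Topology RealInnerProductSpace
set_option linter.all false
set_option linter.deprecated false

/-- the half line measure -/
def mu : Measure ℝ := volume.restrict (Set.Ioi 0)

/-- test functions -/
structure Tst (R : ℝ) (g : ℝ → ℝ) : Prop where
  meas : Measurable g
  bdd : ∃ C, ∀ t, |g t| ≤ C
  supp : ∀ t, t ∉ Set.Ioc 0 R → g t = 0

section tst
variable {R : ℝ} {g h : ℝ → ℝ}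

lemma Tst.intg (hg : Tst R g) : Integrable g := by
  obtain ⟨C, hC⟩ := hg.bdd
  have h1 : IntegrableOn g (Set.Ioc 0 R) :=
    Measure.integrableOn_of_bounded (M := C) (by simp) hg.meas.aestronglyMeasurable (Filter.Eventually.of_forall fun t => by simpa using hC t)
  exact (integrableOn_iff_integrable_of_support_subset (fun t ht => by
    by_contra h; exact ht (hg.supp t h))).1 h1

lemma Tst.sub (hg : Tst R g) (hh : Tst R h) : Tst R (fun t => g t - h t) := by
  obtain ⟨C, hC⟩ := hg.bdd
  obtain ⟨C', hC'⟩ := hh.bdd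
  refine ⟨hg.meas.sub hh.meas, ⟨C + C', fun t => (abs_sub _ _).trans (add_le_add (hC t) (hC' t))⟩, fun t ht => by rw [hg.supp t ht, hh.supp t ht, sub_zero]⟩
lemma Tst.const_mul (c : ℝ) (hg : Tst R g) : Tst R (fun t => c * g t) := by
  obtain ⟨C, hC⟩ := hg.bdd
  refine ⟨hg.meas.const_mul c, ⟨|c| * C, fun t => by rw [abs_mul]; gcongr; exact hC t⟩, fun t ht => by rw [hg.supp t ht, mul_zero]⟩
lemma Tst.mono {R' : ℝ} (hR : R ≤ R') (hg : Tst R g) : Tst R' g :=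
  ⟨hg.meas, hg.bdd, fun t ht => hg.supp t fun h => ht ⟨h.1, h.2.trans hR⟩⟩
lemma Tst.ind {S : Set ℝ} (hS : MeasurableSet S) (h : S ⊆ Set.Ioc 0 R) : Tst R (S.indicator fun _ => (1:ℝ)) := by
  refine ⟨measurable_const.indicator hS, ⟨1, fun t => ?_⟩, fun t ht => Set.indicator_of_notMem (fun h' => ht (h h')) _⟩
  by_cases ht : t ∈ S <;> simp [ht]

lemma Tst.cont_prim (hg : Tst R g) : Continuous (fun t => ∫ s in (0:ℝ)..t, g s) :=
  intervalIntegral.continuous_primitive (fun a b => hg.intg.intervalIntegrable) 0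

lemma Tst.prim (hR : 0 ≤ R) (hg : Tst R g) (h0 : ∫ s in (0:ℝ)..R, g s = 0) : Tst R (fun t => ∫ s in (0:ℝ)..t, g s) := by
  refine ⟨hg.cont_prim.measurable, ?_, fun t ht => ?_⟩
  · refine ⟨∫ s, |g s|, fun t => ?_⟩
    have := intervalIntegral.norm_integral_le_integral_norm_uIoc (f := g) (μ := volume) (a := 0) (b := t)
    refine this.trans ?_
    exact setIntegral_le_integral hg.intg.norm (Filter.Eventually.of_forall fun s => norm_nonneg _)
  · by_cases h1 : 0 < t
    · have h2 : R < t := by by_contra h; exact ht ⟨h1, not_lt.1 h⟩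
      rw [← intervalIntegral.integral_add_adjacent_intervals (b := R) hg.intg.intervalIntegrable hg.intg.intervalIntegrable, h0, zero_add]
      rw [intervalIntegral.integral_of_le h2.le]
      refine setIntegral_eq_zero_of_forall_eq_zero fun s hs => hg.supp s fun h => absurd hs.1 (not_lt.2 h.2)
    · rw [intervalIntegral.integral_of_ge (not_lt.1 h1), setIntegral_eq_zero_of_forall_eq_zero, neg_zero]
      exact fun s hs => hg.supp s fun h => absurd hs.2 (not_le.2 h.1)

/-- backward primitive -/
def bprim (R : ℝ) (g : ℝ → ℝ) : ℝ → ℝ := (Set.Ioc 0 R).indicator fun t => ∫ s in t..R, g s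

lemma Tst.bprim (hg : Tst R g) : Tst R (bprim R g) := by
  have hc : Continuous (fun t => ∫ s in t..R, g s) := by
    have e : (fun t => ∫ s in t..R, g s) = fun t => -(∫ s in R..t, g s) := by funext t; rw [intervalIntegral.integral_symm]
    rw [e]
    exact (intervalIntegral.continuous_primitive (fun a b => hg.intg.intervalIntegrable) R).neg
  refine ⟨hc.measurable.indicator measurableSet_Ioc, ⟨∫ s, |g s|, fun t => ?_⟩, fun t ht => Set.indicator_of_notMem ht _⟩
  unfold _root_.bprim
  by_cases ht : t ∈ Set.Ioc 0 R
  · rw [Set.indicator_of_mem ht]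
    have := intervalIntegral.norm_integral_le_integral_norm_uIoc (f := g) (μ := volume) (a := t) (b := R)
    exact this.trans (setIntegral_le_integral hg.intg.norm (Filter.Eventually.of_forall fun s => norm_nonneg _))
  · rw [Set.indicator_of_notMem ht, abs_zero]
    exact integral_nonneg fun s => abs_nonneg _

lemma Tst.mu_int (hg : Tst R g) (f : ℝ → ℝ) : ∫ t, g t * f t ∂mu = ∫ t in Set.Ioc 0 R, g t * f t := by
  unfold mu
  have hsub : Set.Ioc (0:ℝ) R ⊆ Set.Ioi 0 := fun t ht => ht.1
  refine setIntegral_eq_of_subset_of_forall_diff_eq_zero measurableSet_Ioi hsub fun t ht => ?_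
  rw [hg.supp t ht.2, zero_mul]

/-- Fubini -/
lemma fub (hg : Tst R g) {w : ℝ → ℝ} (hw : IntegrableOn w (Set.Ioc 0 R)) :
    ∫ t, g t * (∫ s in (0:ℝ)..t, w s) ∂mu = ∫ s, bprim R g s * w s ∂mu := by
  rw [hg.mu_int, hg.bprim.mu_int]
  set ν : Measure ℝ := volume.restrict (Set.Ioc 0 R) with hν
  have hgi : Integrable g ν := hg.intg.integrableOn
  let F : ℝ × ℝ → ℝ := fun p => Set.indicator {p : ℝ × ℝ | p.2 ≤ p.1} (fun p => g p.1 * w p.2) p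
  have hF : Integrable F (ν.prod ν) :=
    (hgi.mul_prod hw).indicator (measurableSet_le measurable_snd measurable_fst)
  have sw := integral_integral_swap (f := fun x y => F (x, y)) hF
  have e1 : ∫ t, g t * (∫ s in (0:ℝ)..t, w s) ∂ν = ∫ t, ∫ s, F (t, s) ∂ν ∂ν := by
    refine setIntegral_congr_fun measurableSet_Ioc fun t ht => ?_
    have e2 : (fun s => F (t, s)) = (Set.Iic t).indicator fun s => g t * w s := by
      funext s
      by_cases h : s ≤ t
      · simp [F, h]
      · simp [F, h]
    simp only [e2]
    rw [integral_indicator measurableSet_Iic, hν, Measure.restrict_restrict measurableSet_Iic, integral_const_mul,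
      intervalIntegral.integral_of_le ht.1.le]
    congr 2
    congr 1
    ext s; simp only [Set.mem_Ioc, Set.mem_inter_iff, Set.mem_Iic]
    exact ⟨fun h => ⟨h.2, h.1, h.2.trans ht.2⟩, fun h => ⟨h.2.1, h.1⟩⟩
  have e3 : ∫ s, bprim R g s * w s ∂ν = ∫ s, ∫ t, F (t, s) ∂ν ∂ν := by
    refine setIntegral_congr_fun measurableSet_Ioc fun s hs => ?_
    have e2 : (fun t => F (t, s)) = (Set.Ici s).indicator fun t => g t * w s := by
      funext t
      by_cases h : s ≤ t
      · simp [F, h]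
      · simp [F, h]
    simp only [e2]
    rw [integral_indicator measurableSet_Ici, hν, Measure.restrict_restrict measurableSet_Ici, integral_mul_const, bprim,
      Set.indicator_of_mem hs, intervalIntegral.integral_of_le hs.2]
    congr 1
    have e4 : Set.Ici s ∩ Set.Ioc 0 R = Set.Icc s R := by
      ext t; simp only [Set.mem_Icc, Set.mem_inter_iff, Set.mem_Ici, Set.mem_Ioc]
      exact ⟨fun h => ⟨h.1, h.2.2⟩, fun h => ⟨h.1, hs.1.trans_le h.1, h.2⟩⟩
    rw [e4, integral_Icc_eq_integral_Ioc]
  rw [e1, e3, sw]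
end tst

section dbr
variable {H : Type*} [NormedAddCommGroup H] [InnerProductSpace ℝ H] [CompleteSpace H]

lemma dbr_zero {f : ℝ → H} (hf : ∀ R, IntegrableOn f (Set.Ioc 0 R))
    (h : ∀ R g a, 0 ≤ R → Tst R g → ∫ t, g t * ⟪f t, a⟫ ∂mu = 0) : ∀ᵐ t ∂mu, f t = 0 := by
  have key : ∀ R : ℕ, ∀ᵐ t ∂(volume.restrict (Set.Ioc (0:ℝ) R)), f t = 0 := by
    intro R
    refine Integrable.ae_eq_zero_of_forall_setIntegral_eq_zero (hf R) fun S hS _ => ?_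
    refine ext_inner_right ℝ fun a => ?_
    rw [inner_zero_left, Measure.restrict_restrict hS, real_inner_comm]
    have hi : IntegrableOn f (S ∩ Set.Ioc 0 (R:ℝ)) := (hf R).mono_set Set.inter_subset_right
    rw [← integral_inner hi]
    have h1 := h R _ a R.cast_nonneg (Tst.ind (hS.inter measurableSet_Ioc) (Set.inter_subset_right (s := S) (t := Set.Ioc 0 (R:ℝ))))
    refine Eq.trans ?_ h1
    unfold mu
    have e : (fun t => (S ∩ Set.Ioc 0 (R:ℝ)).indicator (fun _ => (1:ℝ)) t * ⟪f t, a⟫) = (S ∩ Set.Ioc 0 (R:ℝ)).indicator (fun t => ⟪a, f t⟫) := by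
      funext t
      by_cases ht : t ∈ S ∩ Set.Ioc 0 (R:ℝ)
      · rw [Set.indicator_of_mem ht, Set.indicator_of_mem ht, one_mul, real_inner_comm]
      · rw [Set.indicator_of_notMem ht, Set.indicator_of_notMem ht, zero_mul]
    rw [e, integral_indicator (hS.inter measurableSet_Ioc), Measure.restrict_restrict (hS.inter measurableSet_Ioc)]
    congr 2
    ext t; simp only [Set.mem_inter_iff, Set.mem_Ioc, Set.mem_Ioi]; tauto
  have e : Set.Ioi (0:ℝ) = ⋃ R : ℕ, Set.Ioc (0:ℝ) R := by
    ext t; simp only [Set.mem_Ioi, Set.mem_iUnion, Set.mem_Ioc]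
    refine ⟨fun h => ?_, fun ⟨R, h⟩ => h.1⟩
    obtain ⟨R, hR⟩ := exists_nat_ge t
    exact ⟨R, h, hR⟩
  unfold mu
  rw [e, ae_restrict_iUnion_iff]
  exact key

lemma Tst.intg_inner {R : ℝ} {g : ℝ → ℝ} (hg : Tst R g) {f : ℝ → H} (hf : IntegrableOn f (Set.Ioc 0 R)) (a : H) :
    IntegrableOn (fun t => g t * ⟪f t, a⟫) (Set.Ioc 0 R) := by
  obtain ⟨C, hC⟩ := hg.bdd
  have h1 : IntegrableOn (fun t => ⟪f t, a⟫) (Set.Ioc 0 R) := hf.inner_const a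
  exact h1.bdd_mul (c := C) hg.meas.aestronglyMeasurable (Filter.Eventually.of_forall fun t => by simpa using hC t)

lemma Tst.intg_mu {R : ℝ} {g : ℝ → ℝ} (hg : Tst R g) {f : ℝ → H} (hf : IntegrableOn f (Set.Ioc 0 R)) (a : H) :
    Integrable (fun t => g t * ⟪f t, a⟫) mu := by
  have h1 := hg.intg_inner hf a
  refine IntegrableOn.of_forall_diff_eq_zero (s := Set.Ioc 0 R) (t := Set.Ioi 0) h1 measurableSet_Ioi fun t ht => ?_
  rw [hg.supp t ht.2, zero_mul]

lemma dbr_const {f : ℝ → H} (hf : ∀ R, IntegrableOn f (Set.Ioc 0 R))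
    (h : ∀ R g a, 0 ≤ R → Tst R g → (∫ s in (0:ℝ)..R, g s = 0) → ∫ t, g t * ⟪f t, a⟫ ∂mu = 0) :
    ∃ c, ∀ᵐ t ∂mu, f t = c := by
  set c := ∫ t in Set.Ioc (0:ℝ) 1, f t with hc
  have hcI : ∀ R : ℝ, IntegrableOn (fun _ : ℝ => c) (Set.Ioc 0 R) := fun R => integrableOn_const (by simp)
  refine ⟨c, ?_⟩
  have := dbr_zero (f := fun t => f t - c) (fun R => (hf R).sub (hcI R)) ?_
  · filter_upwards [this] with t ht using sub_eq_zero.1 ht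
  intro R0 g a hR0 hg
  set R := max R0 1
  have hg : Tst R g := hg.mono (le_max_left _ _)
  have hR1 : (1:ℝ) ≤ R := le_max_right _ _
  set m := ∫ s in (0:ℝ)..R, g s with hm
  set i1 : ℝ → ℝ := (Set.Ioc (0:ℝ) 1).indicator fun _ => (1:ℝ)
  have hi1 : Tst R i1 := Tst.ind measurableSet_Ioc (fun t ht => ⟨ht.1, ht.2.trans hR1⟩)
  have hk := hg.sub (hi1.const_mul m)
  have i1int : ∫ s in (0:ℝ)..R, i1 s = 1 := by
    rw [intervalIntegral.integral_of_le (by linarith), integral_indicator measurableSet_Ioc, Measure.restrict_restrict measurableSet_Ioc]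
    have : Set.Ioc (0:ℝ) 1 ∩ Set.Ioc 0 R = Set.Ioc 0 1 := Set.inter_eq_left.2 (fun t ht => ⟨ht.1, ht.2.trans hR1⟩)
    rw [this]; simp
  have h1 := h R _ a (by linarith) hk (by
    rw [intervalIntegral.integral_sub hg.intg.intervalIntegrable (hi1.const_mul m).intg.intervalIntegrable,
      intervalIntegral.integral_const_mul, i1int, mul_one, sub_self])
  have e1 : ∀ t, (g t - m * i1 t) * ⟪f t, a⟫ = g t * ⟪f t, a⟫ - m * (i1 t * ⟪f t, a⟫) := fun t => by ring
  simp only [e1] at h1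
  rw [integral_sub (hg.intg_mu (hf R) a) ((hi1.intg_mu (hf R) a).const_mul m), integral_const_mul] at h1
  have e2 : ∫ t, i1 t * ⟪f t, a⟫ ∂mu = ⟪c, a⟫ := by
    rw [(Tst.ind measurableSet_Ioc subset_rfl : Tst 1 i1).mu_int, hc, real_inner_comm, ← integral_inner (hf 1)]
    refine setIntegral_congr_fun measurableSet_Ioc fun t ht => ?_
    simp only [i1, Set.indicator_of_mem ht, one_mul]; rw [real_inner_comm]
  have e3 : ∫ t, g t * ⟪c, a⟫ ∂mu = m * ⟪c, a⟫ := by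
    rw [hg.mu_int, integral_mul_const, hm, intervalIntegral.integral_of_le (by linarith)]
  have e4 : ∀ t, g t * ⟪f t - c, a⟫ = g t * ⟪f t, a⟫ - g t * ⟪c, a⟫ := fun t => by rw [inner_sub_left]; ring
  simp only [e4]
  rw [integral_sub (hg.intg_mu (hf R) a) (hg.intg_mu (hcI R) a), e3]
  rw [e2] at h1; exact h1

lemma ii_of_R {w : ℝ → H} (hw : ∀ R, IntegrableOn w (Set.Ioc 0 R)) {t : ℝ} (ht : 0 ≤ t) : IntervalIntegrable w volume 0 t :=
  (intervalIntegrable_iff_integrableOn_Ioc_of_le ht).2 (hw t)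

lemma fub_inner {R : ℝ} {g : ℝ → ℝ} (hg : Tst R g) {w : ℝ → H} (hw : ∀ R, IntegrableOn w (Set.Ioc 0 R)) (a : H) :
    ∫ t, g t * ⟪∫ s in (0:ℝ)..t, w s, a⟫ ∂mu = ∫ s, bprim R g s * ⟪w s, a⟫ ∂mu := by
  rw [← fub hg ((hw R).inner_const a)]
  unfold mu
  refine setIntegral_congr_fun measurableSet_Ioi fun t ht => ?_
  congr 1
  have ht : (0:ℝ) < t := ht
  rw [intervalIntegral.integral_of_le ht.le, intervalIntegral.integral_of_le ht.le, real_inner_comm, ← integral_inner (hw t)]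
  exact setIntegral_congr_fun measurableSet_Ioc fun s _ => real_inner_comm _ _

lemma prim_intg {w : ℝ → H} (hw : ∀ R, IntegrableOn w (Set.Ioc 0 R)) (R : ℝ) :
    IntegrableOn (fun t => ∫ s in (0:ℝ)..t, w s) (Set.Ioc 0 R) := by
  rcases le_total R 0 with h | h
  · rw [Set.Ioc_eq_empty (not_lt.2 h)]; exact integrableOn_empty
  have : ContinuousOn (fun t => ∫ s in (0:ℝ)..t, w s) (Set.Icc 0 R) := by
    have := intervalIntegral.continuousOn_primitive_interval (f := w) (μ := volume) (a := 0) (b := R) (by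
      rw [Set.uIcc_of_le h, integrableOn_Icc_iff_integrableOn_Ioc]; exact hw R)
    rwa [Set.uIcc_of_le h] at this
  exact (this.integrableOn_Icc).mono_set Set.Ioc_subset_Icc_self

/-- du Bois-Reymond, mean zero tests -/
lemma dbr_mean {v w : ℝ → H} (hv : ∀ R, IntegrableOn v (Set.Ioc 0 R)) (hw : ∀ R, IntegrableOn w (Set.Ioc 0 R))
    (h : ∀ R g a, 0 ≤ R → Tst R g → (∫ s in (0:ℝ)..R, g s = 0) →
      ∫ t, g t * ⟪v t, a⟫ ∂mu = ∫ t, bprim R g t * ⟪w t, a⟫ ∂mu) :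
    ∃ c, ∀ᵐ t ∂mu, v t = c + ∫ s in (0:ℝ)..t, w s := by
  obtain ⟨c, hc⟩ := dbr_const (f := fun t => v t - ∫ s in (0:ℝ)..t, w s) (fun R => (hv R).sub (prim_intg hw R)) (by
    intro R g a hR hg h0
    have e4 : ∀ t, g t * ⟪v t - ∫ s in (0:ℝ)..t, w s, a⟫ = g t * ⟪v t, a⟫ - g t * ⟪∫ s in (0:ℝ)..t, w s, a⟫ :=
      fun t => by rw [inner_sub_left]; ring
    simp only [e4]
    rw [integral_sub (hg.intg_mu (hv R) a) (hg.intg_mu (prim_intg hw R) a), fub_inner hg hw, h R g a hR hg h0, sub_self])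
  exact ⟨c, by filter_upwards [hc] with t ht; rw [← ht]; abel⟩

lemma dbr_all {v w : ℝ → H} (hv : ∀ R, IntegrableOn v (Set.Ioc 0 R)) (hw : ∀ R, IntegrableOn w (Set.Ioc 0 R))
    (h : ∀ R g a, 0 ≤ R → Tst R g →
      ∫ t, g t * ⟪v t, a⟫ ∂mu = ∫ t, bprim R g t * ⟪w t, a⟫ ∂mu) :
    ∀ᵐ t ∂mu, v t = ∫ s in (0:ℝ)..t, w s := by
  have := dbr_zero (f := fun t => v t - ∫ s in (0:ℝ)..t, w s) (fun R => (hv R).sub (prim_intg hw R)) (by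
    intro R g a hR hg
    have e4 : ∀ t, g t * ⟪v t - ∫ s in (0:ℝ)..t, w s, a⟫ = g t * ⟪v t, a⟫ - g t * ⟪∫ s in (0:ℝ)..t, w s, a⟫ :=
      fun t => by rw [inner_sub_left]; ring
    simp only [e4]
    rw [integral_sub (hg.intg_mu (hv R) a) (hg.intg_mu (prim_intg hw R) a), fub_inner hg hw, h R g a hR hg, sub_self])
  filter_upwards [this] with t ht using sub_eq_zero.1 ht
end dbr
end

section
open MeasureTheory
open scoped BigOperators Topology RealInnerProductSpace
set_option linter.all false
set_option linter.deprecated false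

section ten
variable {H : Type*} [NormedAddCommGroup H] [InnerProductSpace ℝ H] [CompleteSpace H]
variable {H' : Type*} [NormedAddCommGroup H'] [InnerProductSpace ℝ H'] [CompleteSpace H']

abbrev L2 (H : Type*) [NormedAddCommGroup H] := Lp H 2 mu

open Classical in
/-- elementary tensor -/
def ten (f : ℝ → ℝ) (a : H) : L2 H := if h : MemLp (fun t => f t • a) 2 mu then h.toLp _ else 0

lemma memLp_smul {f : ℝ → ℝ} (hf : MemLp f 2 mu) (a : H) : MemLp (fun t => f t • a) 2 mu :=
  (ContinuousLinearMap.toSpanSingleton ℝ a).comp_memLp' hf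

lemma Tst.memLp {R : ℝ} {g : ℝ → ℝ} (hg : Tst R g) : MemLp g 2 mu := by
  obtain ⟨C, hC⟩ := hg.bdd
  have h : MemLp g 2 volume := by
    rw [memLp_two_iff_integrable_sq hg.meas.aestronglyMeasurable]
    have := hg.intg.bdd_mul (c := C) hg.meas.aestronglyMeasurable (Filter.Eventually.of_forall fun t => by simpa using hC t)
    simpa [pow_two] using this
  exact h.restrict _

lemma ten_ae {f : ℝ → ℝ} (hf : MemLp f 2 mu) (a : H) : ∀ᵐ t ∂mu, (ten f a : L2 H) t = f t • a := by
  unfold ten; rw [dif_pos (memLp_smul hf a)]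
  exact (memLp_smul hf a).coeFn_toLp

lemma ten_inner {f : ℝ → ℝ} (hf : MemLp f 2 mu) (a : H) (u : L2 H) :
    ⟪u, ten f a⟫ = ∫ t, f t * ⟪u t, a⟫ ∂mu := by
  rw [L2.inner_def]
  refine integral_congr_ae ?_
  filter_upwards [ten_ae hf a] with t ht
  rw [ht, real_inner_smul_right]

lemma ten_map {f : ℝ → ℝ} (hf : MemLp f 2 mu) (a : H) (T : H →L[ℝ] H') :
    T.compLpL 2 mu (ten f a) = ten f (T a) := by
  refine Lp.ext ?_
  filter_upwards [T.coeFn_compLpL (p := 2) (μ := mu) (ten f a), ten_ae hf a, ten_ae hf (T a)] with t h1 h2 h3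
  rw [h1, h2, h3, map_smul]

lemma comp_inner {T : H →L[ℝ] H'} {S : H' →L[ℝ] H} (h : ∀ x y, ⟪T x, y⟫ = ⟪x, S y⟫) (u : L2 H) (v : L2 H') :
    ⟪T.compLpL 2 mu u, v⟫ = ⟪u, S.compLpL 2 mu v⟫ := by
  rw [L2.inner_def, L2.inner_def]
  refine integral_congr_ae ?_
  filter_upwards [T.coeFn_compLpL (p := 2) (μ := mu) u, S.coeFn_compLpL (p := 2) (μ := mu) v] with t h1 h2
  rw [h1, h2, h]

lemma comp_comp {H'' : Type*} [NormedAddCommGroup H''] [InnerProductSpace ℝ H''] {T : H →L[ℝ] H'} {S : H' →L[ℝ] H''} {W : H →L[ℝ] H''}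
    (h : ∀ x, S (T x) = W x) (u : L2 H) :
    S.compLpL 2 mu (T.compLpL 2 mu u) = W.compLpL 2 mu u := by
  refine Lp.ext ?_
  filter_upwards [T.coeFn_compLpL (p := 2) (μ := mu) u, S.coeFn_compLpL (p := 2) (μ := mu) (T.compLpL 2 mu u), W.coeFn_compLpL (p := 2) (μ := mu) u] with t h1 h2 h3
  rw [h2, h1, h3, h]

lemma comp_id {T : H →L[ℝ] H} (h : ∀ x, T x = x) (u : L2 H) : T.compLpL 2 mu u = u := by
  refine Lp.ext ?_
  filter_upwards [T.coeFn_compLpL (p := 2) (μ := mu) u] with t h1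
  rw [h1, h]

lemma comp_coer {T Q : H →L[ℝ] H} {c : ℝ} (hc : ∀ x, c * ‖x‖ ^ 2 ≤ ⟪T x, Q x⟫) (u : L2 H) :
    c * ‖u‖ ^ 2 ≤ ⟪T.compLpL 2 mu u, Q.compLpL 2 mu u⟫ := by
  rw [← real_inner_self_eq_norm_sq, L2.inner_def, L2.inner_def, ← integral_const_mul]
  refine integral_mono_ae ((L2.integrable_inner u u).const_mul c) (L2.integrable_inner _ _) ?_
  filter_upwards [T.coeFn_compLpL (p := 2) (μ := mu) u, Q.coeFn_compLpL (p := 2) (μ := mu) u] with t h1 h2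
  rw [h1, h2]
  simp only [real_inner_self_eq_norm_sq]
  exact hc _

lemma L2_intg (u : L2 H) (R : ℝ) : IntegrableOn u (Set.Ioc 0 R) := by
  have h1 : MemLp u 2 (volume.restrict (Set.Ioc 0 R)) := by
    refine (Lp.memLp u).mono_measure ?_
    exact Measure.restrict_mono (fun t ht => ht.1) le_rfl
  haveI : IsFiniteMeasure (volume.restrict (Set.Ioc 0 R)) := ⟨by simp⟩
  exact h1.integrable one_le_two

lemma L2_norm_sq (u : L2 H) : ‖u‖ ^ 2 = ∫ t, ‖u t‖ ^ 2 ∂mu := by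
  rw [← real_inner_self_eq_norm_sq, L2.inner_def]
  simp only [real_inner_self_eq_norm_sq]
end ten

/-- abstract scale data -/
structure SC (H0 H1 : Type*) [NormedAddCommGroup H0] [InnerProductSpace ℝ H0] [CompleteSpace H0]
    [NormedAddCommGroup H1] [InnerProductSpace ℝ H1] [CompleteSpace H1] where
  J0 : H0 →L[ℝ] H0
  J1 : H1 →L[ℝ] H1
  D : H0 →L[ℝ] H1
  N : H0 →L[ℝ] H1
  Ds : H1 →L[ℝ] H0
  Ns : H1 →L[ℝ] H0
  E : H1 →L[ℝ] H1
  A : ℕ → H1 →L[ℝ] H1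
  Q0 : ℕ → H0 →L[ℝ] H0
  P0 : ℕ → H0 →L[ℝ] H0
  Q1 : ℕ → H1 →L[ℝ] H1
  P1 : ℕ → H1 →L[ℝ] H1
  c : ℕ → ℝ
  b : ℝ
  B : ℕ → ℝ
  Dadj : ∀ x y, ⟪D x, y⟫ = ⟪x, Ds y⟫
  Nadj : ∀ x y, ⟪N x, y⟫ = ⟪x, Ns y⟫
  J1adj : ∀ x y, ⟪J1 x, y⟫ = ⟪x, J1 y⟫
  NsN : ∀ x, Ns (N x) = x
  JD : ∀ x, J1 (D x) = D (J0 x)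
  JN : ∀ x, J1 (N x) = N (J0 x)
  JNs : ∀ x, Ns (J1 x) = J0 (Ns x)
  JDs : ∀ x, Ds (J1 x) = J0 (Ds x)
  JE : ∀ x, E (J1 x) = J1 (E x)
  ED : ∀ x, E (D x) = D (Ns (D x))
  EN : ∀ x, E (N x) = N (Ns (D x))
  NsE : ∀ x, Ns (E x) = Ns (D (Ns x))
  JA : ∀ s x, J1 (A (s + 1) x) = A s (J1 x)
  QD : ∀ s x, Q1 s (D x) = D (Q0 s x)
  QN : ∀ s x, Q1 s (N x) = N (Q0 s x)
  QJ : ∀ s x, Q0 s (J0 x) = J0 (Q0 s x)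
  PD : ∀ s x, P1 s (D x) = D (P0 s x)
  PN : ∀ s x, P1 s (N x) = N (P0 s x)
  PJ : ∀ s x, P0 s (J0 x) = J0 (P0 s x)
  QP1 : ∀ s x, Q1 s (P1 s x) = x
  QP0 : ∀ s x, Q0 s (P0 s x) = x
  c_pos : ∀ s, 0 < c s
  coer : ∀ s x, c s * ‖x‖ ^ 2 ≤ ⟪A s x, Q1 s x⟫
  D_le : ‖D‖ ≤ b
  Ds_le : ‖Ds‖ ≤ b
  E_le : ‖E‖ ≤ b
  A_le : ∀ s, ‖A s‖ ≤ B s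
  Q1_le : ∀ s, ‖Q1 s‖ / c s ≤ B s
  Q0_le : ∀ s, ‖Q0 s‖ / c s ≤ B s

namespace SC
variable {H0 H1 : Type*} [NormedAddCommGroup H0] [InnerProductSpace ℝ H0] [CompleteSpace H0]
    [NormedAddCommGroup H1] [InnerProductSpace ℝ H1] [CompleteSpace H1] (S : SC H0 H1)

/-- tangential projection -/
def Pi : H1 →L[ℝ] H1 := ContinuousLinearMap.id ℝ H1 - S.N.comp S.Ns
lemma Pi_apply (x : H1) : S.Pi x = x - S.N (S.Ns x) := rfl
/-- evolution operator of the tangential part -/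
def L : H1 →L[ℝ] H1 := S.E.comp S.Pi - (S.Pi.comp S.D).comp S.Ns
lemma L_apply (x : H1) : S.L x = S.E (S.Pi x) - S.Pi (S.D (S.Ns x)) := rfl
lemma PiN (x : H0) : S.Pi (S.N x) = 0 := by rw [Pi_apply, NsN, sub_self]
lemma NsPi (x : H1) : S.Ns (S.Pi x) = 0 := by rw [Pi_apply, map_sub, NsN, sub_self]
lemma Pi_adj (x y : H1) : ⟪S.Pi x, y⟫ = ⟪x, S.Pi y⟫ := by
  rw [Pi_apply, Pi_apply, inner_sub_left, inner_sub_right, Nadj, ← real_inner_comm x (S.N (S.Ns y)), Nadj, real_inner_comm (S.Ns x) (S.Ns y)]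
lemma LD (x : H0) : S.L (S.D x) = 0 := by
  rw [L_apply, Pi_apply, Pi_apply, map_sub, ED, EN]
  simp
lemma LN (x : H0) : S.L (S.N x) = - S.Pi (S.D x) := by
  rw [L_apply, PiN, NsN, map_zero, zero_sub]
lemma JPi (x : H1) : S.Pi (S.J1 x) = S.J1 (S.Pi x) := by rw [Pi_apply, Pi_apply, map_sub, JNs, JN]
lemma JL (x : H1) : S.L (S.J1 x) = S.J1 (S.L x) := by
  rw [L_apply, L_apply, JPi, JE, JNs, ← JD, JPi, map_sub]

lemma N_norm (x : H0) : ‖S.N x‖ = ‖x‖ := by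
  have : ‖S.N x‖ ^ 2 = ‖x‖ ^ 2 := by
    rw [← real_inner_self_eq_norm_sq, Nadj, NsN, real_inner_self_eq_norm_sq]
  exact (pow_left_inj₀ (norm_nonneg _) (norm_nonneg _) two_ne_zero).1 this
lemma N_le : ‖S.N‖ ≤ 1 := ContinuousLinearMap.opNorm_le_bound _ zero_le_one fun x => by rw [N_norm, one_mul]
lemma Ns_le (x : H1) : ‖S.Ns x‖ ≤ ‖x‖ := by
  have h : ‖S.Ns x‖ ^ 2 ≤ ‖S.Ns x‖ * ‖x‖ := by
    rw [← real_inner_self_eq_norm_sq, ← Nadj]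
    exact (real_inner_le_norm _ _).trans (by rw [N_norm])
  rcases eq_or_lt_of_le (norm_nonneg (S.Ns x)) with h0 | h0
  · rw [← h0]; exact norm_nonneg _
  · exact le_of_mul_le_mul_left (by linarith [h]) h0
lemma Pi_le (x : H1) : ‖S.Pi x‖ ≤ 2 * ‖x‖ := by
  rw [Pi_apply]
  refine (norm_sub_le _ _).trans ?_
  rw [N_norm]; linarith [S.Ns_le x]
lemma b_nonneg : 0 ≤ S.b := (norm_nonneg _).trans S.D_le
lemma B_nonneg (s : ℕ) : 0 ≤ S.B s := (norm_nonneg _).trans (S.A_le s)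
lemma L_le (x : H1) : ‖S.L x‖ ≤ 4 * S.b * ‖x‖ := by
  rw [L_apply]
  have h1 := (S.E.le_of_opNorm_le S.E_le (S.Pi x))
  have h2 := S.Pi_le x
  have h3 := S.Pi_le (S.D (S.Ns x))
  have h4 := S.D.le_of_opNorm_le S.D_le (S.Ns x)
  have h5 := S.Ns_le x
  have hb := S.b_nonneg
  have h6 := mul_le_mul_of_nonneg_left h2 hb
  have h7 := mul_le_mul_of_nonneg_left h5 hb
  refine (norm_sub_le _ _).trans ?_
  linarith

/-- solution space -/
def X : Submodule ℝ (L2 H1) := (Submodule.span ℝ {u | ∃ (R : ℝ) (g : ℝ → ℝ) (x : H0), 0 ≤ R ∧ Tst R g ∧ (∫ s in (0:ℝ)..R, g s = 0) ∧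
    u = ten (fun t => ∫ s in (0:ℝ)..t, g s) (S.D x) - ten g (S.N (S.J0 x))}).topologicalClosure

lemma X_closed : IsClosed (S.X : Set (L2 H1)) := Submodule.isClosed_topologicalClosure _

lemma X_gen {R : ℝ} {g : ℝ → ℝ} (hR : 0 ≤ R) (hg : Tst R g) (h0 : ∫ s in (0:ℝ)..R, g s = 0) (x : H0) :
    ten (fun t => ∫ s in (0:ℝ)..t, g s) (S.D x) - ten g (S.N (S.J0 x)) ∈ S.X :=
  Submodule.le_topologicalClosure _ (Submodule.subset_span ⟨R, g, x, hR, hg, h0, rfl⟩)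

lemma X_ind (K : Submodule ℝ (L2 H1)) (hK : IsClosed (K : Set (L2 H1)))
    (h : ∀ (R : ℝ) (g : ℝ → ℝ) (x : H0), 0 ≤ R → Tst R g → (∫ s in (0:ℝ)..R, g s = 0) →
      ten (fun t => ∫ s in (0:ℝ)..t, g s) (S.D x) - ten g (S.N (S.J0 x)) ∈ K) : S.X ≤ K := by
  refine Submodule.topologicalClosure_minimal _ (Submodule.span_le.2 ?_) hK
  rintro u ⟨R, g, x, hR, hg, h0, rfl⟩
  exact h R g x hR hg h0

lemma X_map {T1 : H1 →L[ℝ] H1} {T0 : H0 →L[ℝ] H0} (hD : ∀ x, T1 (S.D x) = S.D (T0 x)) (hN : ∀ x, T1 (S.N x) = S.N (T0 x))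
    (hJ : ∀ x, T0 (S.J0 x) = S.J0 (T0 x)) (u : L2 H1) (hu : u ∈ S.X) : T1.compLpL 2 mu u ∈ S.X := by
  have : S.X ≤ S.X.comap (T1.compLpL 2 mu).toLinearMap := by
    refine S.X_ind _ (S.X_closed.preimage (T1.compLpL 2 mu).continuous) fun R g x hR hg h0 => ?_
    change (T1.compLpL 2 mu) _ ∈ S.X
    rw [map_sub, ten_map (hg.prim hR h0).memLp, ten_map hg.memLp, hD, hN, hJ]
    exact S.X_gen hR hg h0 _
  exact this hu

/-- orthogonality characterising the tangential evolution -/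
lemma X_tan {u : L2 H1} (hu : u ∈ S.X) {R : ℝ} {g : ℝ → ℝ} (hg : Tst R g) (a : H1) :
    ∫ t, g t * ⟪S.Pi (S.J1 (u t)), a⟫ ∂mu = ∫ t, bprim R g t * ⟪S.L (u t), a⟫ ∂mu := by
  set w : L2 H1 := ten g (S.J1 (S.Pi a)) - ten (bprim R g) (ContinuousLinearMap.adjoint S.L a) with hw
  have key : ⟪w, u⟫ = 0 := by
    have : S.X ≤ LinearMap.ker (innerSL ℝ w).toLinearMap := by
      refine S.X_ind _ (ContinuousLinearMap.isClosed_ker (innerSL ℝ w)) fun R' g' x hR' hg' h0 => ?_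
      rw [LinearMap.mem_ker]
      change ⟪w, _⟫ = 0
      have hp := hg'.prim hR' h0
      rw [real_inner_comm, hw, inner_sub_right, ten_inner hg.memLp, ten_inner hg.bprim.memLp]
      have hgi : IntegrableOn g' (Set.Ioc 0 R) := hg'.intg.integrableOn
      have e := fub hg hgi
      have e1 : ∫ t, g t * ⟪(ten (fun t => ∫ s in (0:ℝ)..t, g' s) (S.D x) - ten g' (S.N (S.J0 x)) : L2 H1) t, S.J1 (S.Pi a)⟫ ∂mu
          = (∫ t, g t * (∫ s in (0:ℝ)..t, g' s) ∂mu) * ⟪S.D x, S.J1 (S.Pi a)⟫ := by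
        rw [← integral_mul_const]
        refine integral_congr_ae ?_
        filter_upwards [Lp.coeFn_sub (ten (fun t => ∫ s in (0:ℝ)..t, g' s) (S.D x)) (ten g' (S.N (S.J0 x))), ten_ae hp.memLp (S.D x), ten_ae hg'.memLp (S.N (S.J0 x))] with t h1 h2 h3
        rw [h1, Pi.sub_apply, h2, h3, inner_sub_left, real_inner_smul_left, real_inner_smul_left]
        have : ⟪S.N (S.J0 x), S.J1 (S.Pi a)⟫ = 0 := by rw [← JPi, ← Pi_adj, PiN, inner_zero_left]
        rw [this]; ring
      have e2 : ∫ t, bprim R g t * ⟪(ten (fun t => ∫ s in (0:ℝ)..t, g' s) (S.D x) - ten g' (S.N (S.J0 x)) : L2 H1) t, ContinuousLinearMap.adjoint S.L a⟫ ∂mu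
          = (∫ t, bprim R g t * g' t ∂mu) * ⟪S.D x, S.J1 (S.Pi a)⟫ := by
        rw [← integral_mul_const]
        refine integral_congr_ae ?_
        filter_upwards [Lp.coeFn_sub (ten (fun t => ∫ s in (0:ℝ)..t, g' s) (S.D x)) (ten g' (S.N (S.J0 x))), ten_ae hp.memLp (S.D x), ten_ae hg'.memLp (S.N (S.J0 x))] with t h1 h2 h3
        rw [h1, Pi.sub_apply, h2, h3, ContinuousLinearMap.adjoint_inner_right, map_sub, map_smul, map_smul, LD, LN, smul_zero, zero_sub, smul_neg, neg_neg, real_inner_smul_left,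
          ← JD, JPi, J1adj, Pi_adj, JPi]
        ring
      rw [e1, e2, e, sub_self]
    have h := this hu
    rw [LinearMap.mem_ker] at h
    exact h
  rw [real_inner_comm, hw, inner_sub_right, ten_inner hg.memLp, ten_inner hg.bprim.memLp, sub_eq_zero] at key
  simp only [ContinuousLinearMap.adjoint_inner_right] at key
  rw [← key]
  refine integral_congr_ae (Filter.Eventually.of_forall fun t => ?_)
  simp only
  rw [Pi_adj, J1adj]
end SC
end

section
open MeasureTheory
open scoped BigOperators Topology RealInnerProductSpace
set_option linter.all false
set_option linter.deprecated false

lemma exp_memLp : MemLp (fun t : ℝ => Real.exp (-t)) 2 mu := by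
  rw [memLp_two_iff_integrable_sq (by fun_prop)]
  have : Integrable (fun t : ℝ => Real.exp (-2 * t)) mu := exp_neg_integrableOn_Ioi 0 (by norm_num)
  refine this.congr (Filter.Eventually.of_forall fun t => ?_)
  simp only
  rw [pow_two, ← Real.exp_add]; congr 1; ring

lemma exp_sq_le : ∫ t, (Real.exp (-t)) ^ 2 ∂mu ≤ 1 := by
  have h : ∫ t, (Real.exp (-t)) ^ 2 ∂mu ≤ ∫ t, Real.exp (-t) ∂mu := by
    unfold mu
    refine setIntegral_mono_on ?_ ?_ measurableSet_Ioi fun t ht => ?_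
    · exact (memLp_two_iff_integrable_sq (by fun_prop)).1 exp_memLp
    · have := exp_neg_integrableOn_Ioi 0 (show (0:ℝ) < 1 by norm_num)
      simpa using this
    · have h1 : Real.exp (-t) ≤ 1 := Real.exp_le_one_iff.2 (by have : (0:ℝ) < t := ht; linarith)
      have h2 := Real.exp_pos (-t)
      nlinarith
  refine h.trans (le_of_eq ?_)
  unfold mu
  simpa using integral_exp_neg_Ioi 0

lemma ten_exp_norm {H : Type*} [NormedAddCommGroup H] [InnerProductSpace ℝ H] [CompleteSpace H] (a : H) :
    ‖(ten (fun t => Real.exp (-t)) a : L2 H)‖ ≤ ‖a‖ := by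
  have h : ‖(ten (fun t => Real.exp (-t)) a : L2 H)‖ ^ 2 ≤ ‖a‖ ^ 2 := by
    rw [L2_norm_sq]
    have e : ∫ t, ‖(ten (fun t => Real.exp (-t)) a : L2 H) t‖ ^ 2 ∂mu = (∫ t, (Real.exp (-t)) ^ 2 ∂mu) * ‖a‖ ^ 2 := by
      rw [← integral_mul_const]
      refine integral_congr_ae ?_
      filter_upwards [ten_ae exp_memLp a] with t ht
      rw [ht, norm_smul, mul_pow, Real.norm_eq_abs, sq_abs]
    rw [e]
    exact mul_le_of_le_one_left (by positivity) exp_sq_le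
  exact le_of_sq_le_sq h (norm_nonneg _) 

lemma eq_on_half {H : Type*} [NormedAddCommGroup H] {f g : ℝ → H} (hf : Continuous f) (hg : Continuous g)
    (h : ∀ᵐ t ∂mu, f t = g t) : ∀ t, 0 ≤ t → f t = g t := by
  have h1 : Set.EqOn f g (Set.Ioi 0) := Measure.eqOn_open_of_ae_eq (μ := volume) h isOpen_Ioi hf.continuousOn hg.continuousOn
  have h2 := h1.closure hf hg
  rw [closure_Ioi] at h2
  exact fun t ht => h2 ht

namespace SC
variable {H0 H1 : Type*} [NormedAddCommGroup H0] [InnerProductSpace ℝ H0] [CompleteSpace H0]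
    [NormedAddCommGroup H1] [InnerProductSpace ℝ H1] [CompleteSpace H1] (S : SC H0 H1)

/-- boundary lift -/
def Gv (Φ : ℕ → H0) (s : ℕ) : L2 H1 := ten (fun t => Real.exp (-t)) (S.D (Φ (s + 1)) + S.N (Φ s))

lemma Gv_norm (Φ : ℕ → H0) (s : ℕ) : ‖S.Gv Φ s‖ ≤ S.b * ‖Φ (s + 1)‖ + ‖Φ s‖ := by
  refine (ten_exp_norm _).trans ((norm_add_le _ _).trans ?_)
  rw [N_norm]
  linarith [S.D.le_of_opNorm_le S.D_le (Φ (s+1))]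

lemma weak (Φ : ℕ → H0) (hΦ : ∀ s, S.J0 (Φ (s + 1)) = Φ s) :
    ∃ u : ℕ → L2 H1, (∀ s, u s ∈ S.X) ∧ (∀ s, ∀ v ∈ S.X, ⟪(S.A s).compLpL 2 mu (u s + S.Gv Φ s), v⟫ = 0) ∧
      (∀ s, ‖u s + S.Gv Φ s‖ ≤ (1 + S.B s * S.B s) * (S.b * ‖Φ (s + 1)‖ + ‖Φ s‖)) ∧
      (∀ s, S.J1.compLpL 2 mu (u (s + 1)) = u s) ∧ (∀ s, S.J1.compLpL 2 mu (S.Gv Φ (s + 1)) = S.Gv Φ s) := by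
  have hco : ∀ s (x : L2 H1), S.c s * ‖x‖ ^ 2 ≤ ⟪(S.A s).compLpL 2 mu x, (S.Q1 s).compLpL 2 mu x⟫ := fun s => comp_coer (S.coer s)
  have hQ : ∀ s, ∀ x ∈ S.X, (S.Q1 s).compLpL 2 mu x ∈ S.X := fun s x hx => S.X_map (S.QD s) (S.QN s) (S.QJ s) x hx
  have hex : ∀ s, ∃ u ∈ S.X, ∀ v ∈ S.X, ⟪(S.A s).compLpL 2 mu u, v⟫ = ⟪-(S.A s).compLpL 2 mu (S.Gv Φ s), v⟫ := fun s => by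
    refine lax_exists (P := (S.P1 s).compLpL 2 mu) S.X_closed (hQ s) (fun x hx => S.X_map (S.PD s) (S.PN s) (S.PJ s) x hx) (fun x => ?_) (S.c_pos s) (hco s) _
    rw [comp_comp (W := ContinuousLinearMap.id ℝ H1) (S.QP1 s), comp_id (fun x => rfl)]
  choose u hu hw using hex
  have hw' : ∀ s, ∀ v ∈ S.X, ⟪(S.A s).compLpL 2 mu (u s + S.Gv Φ s), v⟫ = 0 := fun s v hv => by
    rw [map_add, inner_add_left, hw s v hv, inner_neg_left]; ring
  have hGJ : ∀ s, S.J1.compLpL 2 mu (S.Gv Φ (s + 1)) = S.Gv Φ s := fun s => by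
    unfold Gv
    rw [ten_map exp_memLp, map_add, JD, JN, hΦ, hΦ]
  refine ⟨u, hu, hw', fun s => ?_, fun s => ?_, hGJ⟩
  · have h1 := lax_bound (hQ s) (S.c_pos s) (hco s) (hu s) (hw s)
    rw [norm_neg] at h1
    have h2 := S.Gv_norm Φ s
    have hB := S.B_nonneg s
    have h3 : ‖(S.A s).compLpL 2 mu (S.Gv Φ s)‖ ≤ S.B s * ‖S.Gv Φ s‖ :=
      ((S.A s).compLpL 2 mu).le_of_opNorm_le (((S.A s).norm_compLpL_le).trans (S.A_le s)) _
    have h4 : ‖(S.Q1 s).compLpL 2 mu‖ / S.c s ≤ S.B s := by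
      refine le_trans ?_ (S.Q1_le s)
      have := S.c_pos s
      gcongr
      exact (S.Q1 s).norm_compLpL_le
    have h5 : ‖u s‖ ≤ S.B s * (S.B s * ‖S.Gv Φ s‖) := h1.trans (mul_le_mul h4 h3 (norm_nonneg _) hB)
    calc _ ≤ ‖u s‖ + ‖S.Gv Φ s‖ := norm_add_le _ _
      _ ≤ (1 + S.B s * S.B s) * ‖S.Gv Φ s‖ := by linarith
      _ ≤ _ := by gcongr
  · have hJX : ∀ v ∈ S.X, S.J1.compLpL 2 mu v ∈ S.X := fun v hv => S.X_map S.JD S.JN (fun x => rfl) v hv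
    refine lax_unique (hQ s) (S.c_pos s) (hco s) (hJX _ (hu _)) (hu s) fun v hv => ?_
    have h1 := hw' (s + 1) _ (hJX v hv)
    have h2 := hw' s v hv
    rw [← comp_inner S.J1adj] at h1
    have e : S.J1.compLpL 2 mu ((S.A (s+1)).compLpL 2 mu (u (s + 1) + S.Gv Φ (s + 1))) =
        (S.A s).compLpL 2 mu (S.J1.compLpL 2 mu (u (s + 1)) + S.Gv Φ s) := by
      rw [← hGJ s, ← map_add]
      rw [comp_comp (W := (S.A s).comp S.J1) (S.JA s), comp_comp (W := (S.A s).comp S.J1) (fun x => rfl)]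
    rw [e, map_add, inner_add_left] at h1
    rw [map_add, inner_add_left] at h2
    linarith

lemma comp_intg {H : Type*} [NormedAddCommGroup H] [InnerProductSpace ℝ H] [CompleteSpace H]
    (T : H1 →L[ℝ] H) (u : L2 H1) (R : ℝ) : IntegrableOn (fun t => T (u t)) (Set.Ioc 0 R) :=
  T.integrable_comp (L2_intg u R)

/-- the two a.e. first order relations -/
lemma rel (Φ : ℕ → H0) (hΦ : ∀ s, S.J0 (Φ (s + 1)) = Φ s) :
    ∃ U : ℕ → L2 H1, (∀ s, ‖U s‖ ≤ (1 + S.B s * S.B s) * (S.b * ‖Φ (s + 1)‖ + ‖Φ s‖)) ∧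
      (∀ s, ∀ᵐ t ∂mu, S.J1 (U (s + 1) t) = U s t) ∧
      (∀ s, ∀ᵐ t ∂mu, S.Pi (U s t) = S.Pi (S.D (Φ (s + 1))) + ∫ r in (0:ℝ)..t, S.L (U (s + 1) r)) ∧
      (∀ s, ∃ c, ∀ᵐ t ∂mu, S.Ns (S.A s (U s t)) = c + ∫ r in (0:ℝ)..t, -S.Ds (S.A (s + 1) (U (s + 1) r))) := by
  obtain ⟨u, hu, hw, hn, hJ, hGJ⟩ := S.weak Φ hΦ
  have hU : ∀ s, ∀ᵐ t ∂mu, S.J1 ((u (s + 1) + S.Gv Φ (s + 1) : L2 H1) t) = (u s + S.Gv Φ s : L2 H1) t := fun s => by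
    have e : S.J1.compLpL 2 mu (u (s + 1) + S.Gv Φ (s + 1)) = u s + S.Gv Φ s := by rw [map_add, hJ, hGJ]
    have h1 := S.J1.coeFn_compLpL (p := 2) (μ := mu) (u (s + 1) + S.Gv Φ (s + 1))
    rw [e] at h1
    filter_upwards [h1] with t ht using ht.symm
  refine ⟨fun s => u s + S.Gv Φ s, hn, hU, fun s => ?_, fun s => ?_⟩
  · have h1 := dbr_all (v := fun t => S.Pi (S.J1 (u (s + 1) t))) (w := fun t => S.L (u (s + 1) t))
      (fun R => comp_intg (S.Pi.comp S.J1) _ R) (fun R => comp_intg S.L _ R) (fun R g a hR hg => S.X_tan (hu _) hg a)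
    have h2 := S.J1.coeFn_compLpL (p := 2) (μ := mu) (u (s + 1))
    rw [hJ] at h2
    have h0 : ∀ᵐ t ∂mu, (0:ℝ) < t := ae_restrict_mem measurableSet_Ioi
    filter_upwards [h1, h2, Lp.coeFn_add (u s) (S.Gv Φ s), ten_ae exp_memLp (S.D (Φ (s + 1)) + S.N (Φ s)), h0] with t h1 h2 h3 h4 ht
    rw [h3, Pi.add_apply, h2, map_add, h1]
    unfold Gv at *
    rw [h4, map_smul, map_add, PiN, add_zero]
    have e5 : ∫ r in (0:ℝ)..t, S.L ((u (s + 1) + ten (fun t => Real.exp (-t)) (S.D (Φ (s + 1 + 1)) + S.N (Φ (s + 1))) : L2 H1) r) =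
        ∫ r in (0:ℝ)..t, (S.L (u (s + 1) r) + Real.exp (-r) • (- S.Pi (S.D (Φ (s + 1))))) := by
      refine intervalIntegral.integral_congr_ae ?_
      have h6 := Lp.coeFn_add (u (s+1)) (ten (fun t => Real.exp (-t)) (S.D (Φ (s + 1 + 1)) + S.N (Φ (s + 1))))
      have h7 := ten_ae exp_memLp (S.D (Φ (s + 1 + 1)) + S.N (Φ (s + 1)))
      have h6' : ∀ᵐ r ∂volume, r ∈ Set.Ioi (0:ℝ) → (u (s + 1) + ten (fun t => Real.exp (-t)) (S.D (Φ (s + 1 + 1)) + S.N (Φ (s + 1))) : L2 H1) r = u (s+1) r + (ten (fun t => Real.exp (-t)) (S.D (Φ (s + 1 + 1)) + S.N (Φ (s + 1))) : L2 H1) r :=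
        (ae_restrict_iff' measurableSet_Ioi).1 h6
      have h7' : ∀ᵐ r ∂volume, r ∈ Set.Ioi (0:ℝ) → (ten (fun t => Real.exp (-t)) (S.D (Φ (s + 1 + 1)) + S.N (Φ (s + 1))) : L2 H1) r = Real.exp (-r) • (S.D (Φ (s + 1 + 1)) + S.N (Φ (s + 1))) :=
        (ae_restrict_iff' measurableSet_Ioi).1 h7
      filter_upwards [h6', h7'] with r h6 h7 hr
      rw [Set.uIoc_of_le ht.le] at hr
      have := h6 hr.1
      rw [this, h7 hr.1, map_add, map_smul, map_add, LD, LN, zero_add]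
    rw [e5, intervalIntegral.integral_add (ii_of_R (fun R => comp_intg S.L _ R) ht.le) (by
      apply Continuous.intervalIntegrable; fun_prop), intervalIntegral.integral_smul_const]
    have e6 : ∫ r in (0:ℝ)..t, Real.exp (-r) = 1 - Real.exp (-t) := by
      rw [intervalIntegral.integral_comp_neg (fun x => Real.exp x), integral_exp]; simp
    rw [e6]
    module
  · refine dbr_mean (v := fun t => S.Ns (S.A s ((u s + S.Gv Φ s : L2 H1) t))) (w := fun t => - S.Ds (S.A (s+1) ((u (s+1) + S.Gv Φ (s+1) : L2 H1) t)))
      (fun R => comp_intg (S.Ns.comp (S.A s)) _ R) (fun R => (comp_intg (S.Ds.comp (S.A (s+1))) _ R).neg) fun R g a hR hg h0 => ?_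
    have h1 := hw (s + 1) _ (S.X_gen hR hg h0 a)
    rw [inner_sub_right, ten_inner (hg.prim hR h0).memLp, ten_inner hg.memLp, sub_eq_zero] at h1
    have hA := (S.A (s+1)).coeFn_compLpL (p := 2) (μ := mu) (u (s + 1) + S.Gv Φ (s + 1))
    have e1 : ∫ t, g t * ⟪S.Ns (S.A s ((u s + S.Gv Φ s : L2 H1) t)), a⟫ ∂mu = ∫ t, g t * ⟪(S.A (s+1)).compLpL 2 mu (u (s + 1) + S.Gv Φ (s + 1)) t, S.N (S.J0 a)⟫ ∂mu := by
      refine integral_congr_ae ?_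
      filter_upwards [hA, hU s] with t h2 h3
      rw [h2, ← h3, ← JA, ← JN, ← J1adj]
      have hz : ∀ z, ⟪z, S.N a⟫ = ⟪S.Ns z, a⟫ := fun z => by rw [real_inner_comm, S.Nadj, real_inner_comm]
      rw [hz]
    rw [e1, ← h1]
    refine integral_congr_ae ?_
    have h0' : ∀ᵐ t ∂mu, (0:ℝ) < t := ae_restrict_mem measurableSet_Ioi
    filter_upwards [hA, h0'] with t h2 ht
    have e3 : (∫ s in (0:ℝ)..t, g s) = - bprim R g t := by
      by_cases h : t ≤ R
      · unfold bprim
        rw [Set.indicator_of_mem (show t ∈ Set.Ioc 0 R from ⟨ht, h⟩)]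
        have := intervalIntegral.integral_add_adjacent_intervals (μ := volume) (f := g) (a := 0) (b := t) (c := R) hg.intg.intervalIntegrable hg.intg.intervalIntegrable
        linarith
      · rw [(hg.prim hR h0).supp t (fun h' => h h'.2), hg.bprim.supp t (fun h' => h h'.2), neg_zero]
    have hz : ∀ z, ⟪z, S.D a⟫ = ⟪S.Ds z, a⟫ := fun z => by rw [real_inner_comm, S.Dadj, real_inner_comm]
    rw [e3, h2, inner_neg_left, hz]
    ring
end SC
end

section
open MeasureTheory
open scoped BigOperators Topology RealInnerProductSpace
set_option linter.all false
set_option linter.deprecated false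

namespace SC
variable {H0 H1 : Type*} [NormedAddCommGroup H0] [InnerProductSpace ℝ H0] [CompleteSpace H0]
    [NormedAddCommGroup H1] [InnerProductSpace ℝ H1] [CompleteSpace H1] (S : SC H0 H1)

lemma NsL (x : H1) : S.Ns (S.L x) = 0 := by
  rw [L_apply, map_sub, NsE, NsPi, NsPi, map_zero, map_zero, sub_zero]

lemma inv_exists (s : ℕ) : ∃ T : H0 →L[ℝ] H0, (∀ x, S.Ns (S.A s (S.N (T x))) = x) ∧ (∀ x, T (S.Ns (S.A s (S.N x))) = x) ∧ ‖T‖ ≤ S.B s := by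
  obtain ⟨T, h1, h2, h3⟩ := lax_inv (T := (S.Ns.comp (S.A s)).comp S.N) (Q := S.Q0 s) (P := S.P0 s) (S.QP0 s) (S.c_pos s) (fun x => by
    have := S.coer s (S.N x)
    rw [N_norm, QN, ← real_inner_comm, Nadj, real_inner_comm] at this
    exact this)
  exact ⟨T, h1, h2, h3.trans (S.Q0_le s)⟩

/-- inverse of the normal-normal block -/
def Ti (s : ℕ) : H0 →L[ℝ] H0 := (S.inv_exists s).choose
lemma Ti_right (s : ℕ) (x : H0) : S.Ns (S.A s (S.N (S.Ti s x))) = x := (S.inv_exists s).choose_spec.1 x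
lemma Ti_left (s : ℕ) (x : H0) : S.Ti s (S.Ns (S.A s (S.N x))) = x := (S.inv_exists s).choose_spec.2.1 x
lemma Ti_le (s : ℕ) : ‖S.Ti s‖ ≤ S.B s := (S.inv_exists s).choose_spec.2.2

/-- recovering a vector from its tangential part and conormal part -/
def Mop (s : ℕ) (p : H1) (q : H0) : H1 := p + S.N (S.Ti s (q - S.Ns (S.A s p)))

lemma Mop_rec (s : ℕ) (x : H1) : S.Mop s (S.Pi x) (S.Ns (S.A s x)) = x := by
  unfold Mop
  rw [← map_sub, ← map_sub]
  have : x - S.Pi x = S.N (S.Ns x) := by rw [Pi_apply]; abel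
  rw [this, Ti_left, Pi_apply]; abel

/-- the evolution generator -/
def G (s : ℕ) : H1 →L[ℝ] H1 :=
  S.L + (S.N.comp (S.Ti s)).comp (-(S.Ds.comp (S.A (s + 1))) - (S.Ns.comp (S.A s)).comp S.L)

lemma G_apply (s : ℕ) (x : H1) : S.G s x = S.Mop s (S.L x) (-S.Ds (S.A (s + 1) x)) := rfl

lemma PiG (s : ℕ) (x : H1) : S.Pi (S.G s x) = S.L x := by
  rw [G_apply, Mop, map_add, PiN, add_zero, Pi_apply, NsL, map_zero, sub_zero]

lemma NsAG (s : ℕ) (x : H1) : S.Ns (S.A s (S.G s x)) = -S.Ds (S.A (s + 1) x) := by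
  rw [G_apply, Mop, map_add, map_add, Ti_right]; abel

/-- bound of the generator -/
def gb (b : ℝ) (B : ℕ → ℝ) (s : ℕ) : ℝ := 4 * b + B s * (b * B (s + 1) + B s * (4 * b))

lemma gb_nonneg (s : ℕ) : 0 ≤ gb S.b S.B s := by
  have := S.b_nonneg; have := S.B_nonneg s; have := S.B_nonneg (s+1)
  unfold gb; positivity

lemma G_le (s : ℕ) (x : H1) : ‖S.G s x‖ ≤ gb S.b S.B s * ‖x‖ := by
  have hb := S.b_nonneg; have hB := S.B_nonneg s; have hB' := S.B_nonneg (s+1)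
  rw [G_apply, Mop]
  refine (norm_add_le _ _).trans ?_
  rw [N_norm]
  have h1 := S.L_le x
  have h2 := (S.Ti s).le_of_opNorm_le (S.Ti_le s) (-S.Ds (S.A (s + 1) x) - S.Ns (S.A s (S.L x)))
  have h3 : ‖-S.Ds (S.A (s + 1) x) - S.Ns (S.A s (S.L x))‖ ≤ (S.b * S.B (s+1) + S.B s * (4 * S.b)) * ‖x‖ := by
    refine (norm_sub_le _ _).trans ?_
    rw [norm_neg]
    have h4 := S.Ds.le_of_opNorm_le S.Ds_le (S.A (s+1) x)
    have h5 := mul_le_mul_of_nonneg_left ((S.A (s+1)).le_of_opNorm_le (S.A_le (s+1)) x) hb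
    have h6 := (S.Ns_le _).trans ((S.A s).le_of_opNorm_le (S.A_le s) (S.L x))
    have h7 := mul_le_mul_of_nonneg_left h1 hB
    linarith
  have h4 := mul_le_mul_of_nonneg_left h3 hB
  unfold gb
  linarith

/-- regularity constant -/
def rb (b : ℝ) (B : ℕ → ℝ) (s : ℕ) : ℝ := (1 + B s * B s) * (b + 1)

lemma rb_nonneg (s : ℕ) : 0 ≤ rb S.b S.B s := by
  have := S.b_nonneg; have := S.B_nonneg s
  unfold rb; positivity

/-- continuous solution of the first order system -/
lemma sol (Φ : ℕ → H0) (hΦ : ∀ s, S.J0 (Φ (s + 1)) = Φ s) :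
    ∃ X : ℕ → ℝ → H1, (∀ s, Continuous (X s)) ∧
      (∀ s t, 0 ≤ t → HasDerivWithinAt (X s) (S.G s (X (s + 1) t)) (Set.Ici 0) t) ∧
      (∀ s t, 0 ≤ t → S.J1 (X (s + 1) t) = X s t) ∧
      (∀ s, S.Pi (X s 0) = S.Pi (S.D (Φ (s + 1)))) ∧
      (∀ s, MemLp (X s) 2 mu) ∧
      (∀ s, ∫ t, ‖X s t‖ ^ 2 ∂mu ≤ (rb S.b S.B s * (‖Φ (s + 1)‖ + ‖Φ s‖)) ^ 2) := by
  obtain ⟨U, hn, hJ, hp, hq⟩ := S.rel Φ hΦ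
  choose c hc using hq
  set Ui : ℕ → ℝ → H1 := fun s => (Set.Ioi 0).indicator (U s) with hUi
  have hUi_t : ∀ s t, 0 < t → Ui s t = U s t := fun s t ht => Set.indicator_of_mem (show t ∈ Set.Ioi 0 from ht) _
  have hIInt : ∀ s a b, IntervalIntegrable (Ui s) volume a b := fun s a b => by
    have key : ∀ R : ℝ, IntegrableOn (Ui s) (Set.Ioc (-R) R) := fun R => by
      rw [hUi, integrableOn_indicator_iff measurableSet_Ioi]
      exact (L2_intg (U s) R).mono_set fun t ht => ⟨ht.1, ht.2.2⟩
    rw [intervalIntegrable_iff]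
    refine (key (|a| + |b| + 1)).mono_set fun t ht => ?_
    rw [Set.mem_uIoc] at ht
    have := neg_abs_le a; have := neg_abs_le b; have := le_abs_self a; have := le_abs_self b
    have := abs_nonneg a; have := abs_nonneg b
    constructor <;> rcases ht with h | h <;> linarith [h.1, h.2]
  set p : ℕ → ℝ → H1 := fun s t => S.Pi (S.D (Φ (s + 1))) + ∫ r in (0:ℝ)..t, S.L (Ui (s + 1) r)
  set q : ℕ → ℝ → H0 := fun s t => c s + ∫ r in (0:ℝ)..t, -S.Ds (S.A (s + 1) (Ui (s + 1) r))
  have hpc : ∀ s, Continuous (p s) := fun s => continuous_const.add (intervalIntegral.continuous_primitive (fun a b => by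
    rw [intervalIntegrable_iff]; exact S.L.integrable_comp ((intervalIntegrable_iff).1 (hIInt (s+1) a b))) 0)
  have hqc : ∀ s, Continuous (q s) := fun s => continuous_const.add (intervalIntegral.continuous_primitive (fun a b => by
    rw [intervalIntegrable_iff]; exact (-(S.Ds.comp (S.A (s+1)))).integrable_comp ((intervalIntegrable_iff).1 (hIInt (s+1) a b))) 0)
  set X : ℕ → ℝ → H1 := fun s t => S.Mop s (p s t) (q s t)
  have hXc : ∀ s, Continuous (X s) := fun s => by
    have h1 := hpc s; have h2 := hqc s
    simp only [X, Mop]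
    fun_prop
  have h0 : ∀ᵐ t ∂mu, (0:ℝ) < t := ae_restrict_mem measurableSet_Ioi
  have hXU : ∀ s, ∀ᵐ t ∂mu, X s t = U s t := fun s => by
    filter_upwards [hp s, hc s, h0] with t h1 h2 ht
    have e1 : p s t = S.Pi (U s t) := by
      rw [h1]; simp only [p]; congr 1
      refine intervalIntegral.integral_congr_ae (Filter.Eventually.of_forall fun r hr => ?_)
      rw [Set.uIoc_of_le ht.le] at hr
      rw [hUi_t _ _ hr.1]
    have e2 : q s t = S.Ns (S.A s (U s t)) := by
      rw [h2]; simp only [q]; congr 1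
      refine intervalIntegral.integral_congr_ae (Filter.Eventually.of_forall fun r hr => ?_)
      rw [Set.uIoc_of_le ht.le] at hr
      rw [hUi_t _ _ hr.1]
    simp only [X]
    rw [e1, e2, Mop_rec]
  have hXU' : ∀ s, ∀ᵐ t ∂volume, t ∈ Set.Ioi (0:ℝ) → X s t = U s t := fun s => (ae_restrict_iff' measurableSet_Ioi).1 (hXU s)
  have hpX : ∀ s t, 0 ≤ t → p s t = S.Pi (S.D (Φ (s + 1))) + ∫ r in (0:ℝ)..t, S.L (X (s + 1) r) := fun s t ht => by
    simp only [p]; congr 1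
    refine intervalIntegral.integral_congr_ae ?_
    filter_upwards [hXU' (s+1)] with r h1 hr
    rw [Set.uIoc_of_le ht] at hr
    rw [hUi_t _ _ hr.1, h1 hr.1]
  have hqX : ∀ s t, 0 ≤ t → q s t = c s + ∫ r in (0:ℝ)..t, -S.Ds (S.A (s + 1) (X (s + 1) r)) := fun s t ht => by
    simp only [q]; congr 1
    refine intervalIntegral.integral_congr_ae ?_
    filter_upwards [hXU' (s+1)] with r h1 hr
    rw [Set.uIoc_of_le ht] at hr
    rw [hUi_t _ _ hr.1, h1 hr.1]
  refine ⟨X, hXc, fun s t ht => ?_, fun s => ?_, fun s => ?_, fun s => ?_, fun s => ?_⟩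
  · have hX1 := hXc (s + 1)
    have d1 : HasDerivAt (fun t => S.Pi (S.D (Φ (s + 1))) + ∫ r in (0:ℝ)..t, S.L (X (s + 1) r)) (S.L (X (s + 1) t)) t :=
      ((by fun_prop : Continuous fun r => S.L (X (s + 1) r)).integral_hasStrictDerivAt 0 t).hasDerivAt.const_add _
    have d2 : HasDerivAt (fun t => c s + ∫ r in (0:ℝ)..t, -S.Ds (S.A (s + 1) (X (s + 1) r))) (-S.Ds (S.A (s + 1) (X (s + 1) t))) t :=
      ((by fun_prop : Continuous fun r => -S.Ds (S.A (s + 1) (X (s + 1) r))).integral_hasStrictDerivAt 0 t).hasDerivAt.const_add _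
    have d1' : HasDerivWithinAt (p s) (S.L (X (s + 1) t)) (Set.Ici 0) t := d1.hasDerivWithinAt.congr (fun r hr => hpX s r hr) (hpX s t ht)
    have d2' : HasDerivWithinAt (q s) (-S.Ds (S.A (s + 1) (X (s + 1) t))) (Set.Ici 0) t := d2.hasDerivWithinAt.congr (fun r hr => hqX s r hr) (hqX s t ht)
    have d3 : HasDerivWithinAt (fun t => S.Ns (S.A s (p s t))) (S.Ns (S.A s (S.L (X (s + 1) t)))) (Set.Ici 0) t :=
      (S.Ns.comp (S.A s)).hasFDerivAt.comp_hasDerivWithinAt t d1'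
    have d4 : HasDerivWithinAt (fun t => S.N (S.Ti s (q s t - S.Ns (S.A s (p s t))))) (S.N (S.Ti s (-S.Ds (S.A (s + 1) (X (s + 1) t)) - S.Ns (S.A s (S.L (X (s + 1) t)))))) (Set.Ici 0) t :=
      (S.N.comp (S.Ti s)).hasFDerivAt.comp_hasDerivWithinAt t (d2'.sub d3)
    exact d1'.add d4
  · refine eq_on_half (S.J1.continuous.comp (hXc (s + 1))) (hXc s) ?_
    filter_upwards [hJ s, hXU s, hXU (s+1)] with t h1 h2 h3
    rw [h2, h3, h1]
  · simp only [X, Mop, p, intervalIntegral.integral_same, add_zero]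
    rw [map_add, PiN, add_zero, Pi_apply (S := S) (S.Pi _), NsPi, map_zero, sub_zero]
  · exact (Lp.memLp (U s)).ae_eq (by filter_upwards [hXU s] with t ht using ht.symm)
  · have e : ∫ t, ‖X s t‖ ^ 2 ∂mu = ‖U s‖ ^ 2 := by
      rw [L2_norm_sq]
      refine integral_congr_ae ?_
      filter_upwards [hXU s] with t ht
      rw [ht]
    rw [e]
    have hb := S.b_nonneg; have hB := S.B_nonneg s
    refine pow_le_pow_left₀ (norm_nonneg _) ((hn s).trans ?_) 2
    unfold rb
    rw [mul_assoc]
    refine mul_le_mul_of_nonneg_left ?_ (by positivity)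
    nlinarith [norm_nonneg (Φ (s+1)), norm_nonneg (Φ s), mul_nonneg hb (norm_nonneg (Φ s))]
end SC
end

section
open MeasureTheory
open scoped BigOperators Topology RealInnerProductSpace
set_option linter.all false
set_option linter.deprecated false

lemma iterD_hasDeriv {η : ℝ → ℝ} (h : ContDiff ℝ (⊤ : ℕ∞) η) (i : ℕ) (t : ℝ) :
    HasDerivAt (iteratedDeriv i η) (iteratedDeriv (i + 1) η t) t := by
  have h1 : Differentiable ℝ (iteratedDeriv i η) := h.differentiable_iteratedDeriv i (by exact_mod_cast ENat.coe_lt_top i)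
  rw [iteratedDeriv_succ]
  exact (h1 t).hasDerivAt

lemma bump_fn (j : ℕ) {ε : ℝ} (hε : 0 < ε) : ∃ η : ℝ → ℝ, ContDiff ℝ (⊤ : ℕ∞) η ∧
    (∀ i, iteratedDeriv i η 0 = if i = j then 1 else 0) ∧ (∀ i, i < j → ∀ t, |iteratedDeriv i η t| ≤ ε) ∧
    ∀ i, ∃ C, ∀ t, |iteratedDeriv i η t| ≤ C := by
  let χ : ContDiffBump (0:ℝ) := ⟨1, 2, one_pos, one_lt_two⟩
  set ψ : ℝ → ℝ := fun u => χ u * ((Nat.factorial j : ℝ)⁻¹ * u ^ j) with hψ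
  have hψs : ContDiff ℝ (⊤ : ℕ∞) ψ := χ.contDiff.mul (by fun_prop)
  have hψc : HasCompactSupport ψ := χ.hasCompactSupport.mul_right
  have hbd : ∀ i, ∃ C, ∀ t, |iteratedDeriv i ψ t| ≤ C := fun i => by
    have hc : Continuous (iteratedDeriv i ψ) := (hψs.continuous_iteratedDeriv i (by exact_mod_cast le_top))
    have hs : HasCompactSupport (iteratedDeriv i ψ) := by
      have h1 := hψc.iteratedFDeriv (𝕜 := ℝ) i
      refine h1.mono fun t ht => ?_
      rw [Function.mem_support] at ht ⊢
      intro h0; apply ht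
      rw [iteratedDeriv_eq_iteratedFDeriv, h0]; rfl
    obtain ⟨C, hC⟩ := hc.bounded_above_of_compact_support hs
    exact ⟨C, fun t => by simpa using hC t⟩
  have h0 : ∀ i, iteratedDeriv i ψ 0 = if i = j then 1 else 0 := fun i => by
    have he : ψ =ᶠ[𝓝 0] fun u => (Nat.factorial j : ℝ)⁻¹ * u ^ j := by
      filter_upwards [χ.eventuallyEq_one] with u hu
      rw [hψ]; simp only [hu, Pi.one_apply, one_mul]
    rw [he.iteratedDeriv_eq i, iteratedDeriv_const_mul_field, iteratedDeriv_fun_pow_zero]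
    split_ifs with h
    · subst h
      exact inv_mul_cancel₀ (by exact_mod_cast (Nat.factorial_ne_zero _))
    · simp
  choose C hC using hbd
  set S : ℝ := ∑ i ∈ Finset.range j, C i
  have hCn : ∀ i, 0 ≤ C i := fun i => (abs_nonneg _).trans (hC i 0)
  have hSn : 0 ≤ S := Finset.sum_nonneg fun i _ => hCn i
  set lam : ℝ := 1 + S / ε
  have hl1 : 1 ≤ lam := by simp only [lam]; have : 0 ≤ S / ε := by positivity
                           linarith
  have hl0 : 0 < lam := by linarith
  have hD : ∀ i t, iteratedDeriv i (fun t => (lam ^ j)⁻¹ * ψ (lam * t)) t = (lam ^ j)⁻¹ * (lam ^ i * iteratedDeriv i ψ (lam * t)) := fun i t => by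
    rw [iteratedDeriv_const_mul_field (f := fun t => ψ (lam * t)), iteratedDeriv_comp_const_mul (hψs.of_le (by exact_mod_cast le_top))]
  refine ⟨fun t => (lam ^ j)⁻¹ * ψ (lam * t), contDiff_const.mul (hψs.comp (by fun_prop)), fun i => ?_, fun i hi t => ?_, fun i => ⟨(lam ^ j)⁻¹ * (lam ^ i * C i), fun t => ?_⟩⟩
  · rw [hD, mul_zero, h0]
    split_ifs with h
    · subst h; field_simp
    · simp
  · rw [hD, abs_mul, abs_mul, abs_of_pos (by positivity), abs_of_pos (by positivity : 0 < lam ^ i)]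
    have h1 : |iteratedDeriv i ψ (lam * t)| ≤ S := (hC i _).trans (Finset.single_le_sum (f := C) (fun i _ => hCn i) (Finset.mem_range.2 hi))
    have h2 : lam ^ (i + 1) ≤ lam ^ j := pow_le_pow_right₀ hl1 hi
    have h3 : S ≤ ε * lam := by
      simp only [lam]; rw [mul_add, mul_div_cancel₀ _ hε.ne']; linarith
    rw [inv_mul_le_iff₀ (by positivity)]
    calc lam ^ i * |iteratedDeriv i ψ (lam * t)| ≤ lam ^ i * (ε * lam) := by gcongr; exact h1.trans h3
      _ = ε * lam ^ (i + 1) := by ring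
      _ ≤ ε * lam ^ j := by gcongr
      _ = lam ^ j * ε := by ring
  · rw [hD, abs_mul, abs_mul, abs_of_pos (by positivity), abs_of_pos (by positivity : 0 < lam ^ i)]
    gcongr
    exact hC i _

/-- Borel's lemma for a scale of sequences -/
lemma borel_scale {H : Type*} [NormedAddCommGroup H] [NormedSpace ℝ H] [CompleteSpace H] (x : ℕ → ℕ → H) :
    ∃ g : ℕ → ℕ → ℝ → H, (∀ s i t, HasDerivAt (g s i) (g s (i + 1) t) t) ∧ (∀ s i, g s i 0 = x s i) ∧
      ∀ (T : H →L[ℝ] H) (s : ℕ), (∀ i, T (x (s + 1) i) = x s i) → ∀ i t, T (g (s + 1) i t) = g s i t := by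
  set ε : ℕ → ℝ := fun j => (1 / 2) ^ j / (1 + ∑ s ∈ Finset.range (j + 1), ‖x s j‖)
  have hden : ∀ j, 0 < 1 + ∑ s ∈ Finset.range (j + 1), ‖x s j‖ := fun j => by positivity
  have hε : ∀ j, 0 < ε j := fun j => div_pos (by positivity) (hden j)
  choose η hs h0 hsm hbd using fun j => bump_fn j (hε j)
  choose C hC using hbd
  set K : ℕ → ℕ → ℝ := fun i j => if i < j then ε j else C j i
  have hK : ∀ i j t, |iteratedDeriv i (η j) t| ≤ K i j := fun i j t => by
    simp only [K]; split_ifs with h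
    · exact hsm j i h t
    · exact hC j i t
  have hsum : ∀ s i, Summable fun j => K i j * ‖x s j‖ := fun s i => by
    refine Summable.of_norm_bounded_eventually_nat (g := fun j => (1 / 2 : ℝ) ^ j) (summable_geometric_of_lt_one (by norm_num) (by norm_num)) ?_
    filter_upwards [Filter.eventually_gt_atTop i, Filter.eventually_ge_atTop s] with j h1 h2
    have hx : ‖x s j‖ ≤ 1 + ∑ s ∈ Finset.range (j + 1), ‖x s j‖ := by
      have := Finset.single_le_sum (f := fun s => ‖x s j‖) (fun i _ => norm_nonneg _) (Finset.mem_range.2 (Nat.lt_succ_of_le h2))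
      linarith
    simp only [K, if_pos h1]
    rw [Real.norm_of_nonneg (mul_nonneg (hε j).le (norm_nonneg _))]
    calc ε j * ‖x s j‖ ≤ ε j * (1 + ∑ s ∈ Finset.range (j + 1), ‖x s j‖) := mul_le_mul_of_nonneg_left hx (hε j).le
      _ = _ := div_mul_cancel₀ _ (hden j).ne'
  have hn : ∀ s i j t, ‖iteratedDeriv i (η j) t • x s j‖ ≤ K i j * ‖x s j‖ := fun s i j t => by
    rw [norm_smul]; exact mul_le_mul_of_nonneg_right (hK i j t) (norm_nonneg _)
  have hsm' : ∀ s i t, Summable fun j => iteratedDeriv i (η j) t • x s j := fun s i t =>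
    Summable.of_norm_bounded (hsum s i) fun j => hn s i j t
  refine ⟨fun s i t => ∑' j, iteratedDeriv i (η j) t • x s j, fun s i t => ?_, fun s i => ?_, fun T s hT i t => ?_⟩
  · exact hasDerivAt_tsum (hsum s (i + 1)) (fun j t => (iterD_hasDeriv (hs j) i t).smul_const _) (fun j t => hn s (i + 1) j t) (hsm' s i 0) t
  · simp only
    rw [tsum_eq_single i]
    · rw [h0, if_pos rfl, one_smul]
    · intro j hj
      rw [h0, if_neg (Ne.symm hj), zero_smul]
  · simp only
    rw [T.map_tsum (hsm' _ _ _)]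
    refine tsum_congr fun j => ?_
    rw [map_smul, hT]

/-- smooth scale -/
structure Scl {H : Type*} [NormedAddCommGroup H] [NormedSpace ℝ H] (J : H →L[ℝ] H) (Z : ℕ → ℕ → ℝ → H) : Prop where
  der : ∀ s i t, HasDerivAt (Z s i) (Z s (i + 1) t) t
  cmp : ∀ s i t, J (Z (s + 1) i t) = Z s i t

lemma Scl.contDiff {H : Type*} [NormedAddCommGroup H] [NormedSpace ℝ H] {J : H →L[ℝ] H} {Z : ℕ → ℕ → ℝ → H} (h : Scl J Z) (s i : ℕ) :
    ContDiff ℝ (⊤ : ℕ∞) (Z s i) := by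
  refine contDiff_infty.2 fun n => ?_
  induction n generalizing i with
  | zero => exact contDiff_zero.2 (continuous_iff_continuousAt.2 fun t => (h.der s i t).continuousAt)
  | succ n ih =>
    have e : ((n + 1 : ℕ) : WithTop ℕ∞) = (n : WithTop ℕ∞) + 1 := by push_cast; rfl
    rw [e, contDiff_succ_iff_deriv]
    refine ⟨fun t => (h.der s i t).differentiableAt, by simp, ?_⟩
    have : deriv (Z s i) = Z s (i + 1) := funext fun t => (h.der s i t).deriv
    rw [this]; exact ih _

/-- extension of a half-line scale -/
lemma half_ext {H : Type*} [NormedAddCommGroup H] [NormedSpace ℝ H] [CompleteSpace H] (J : H →L[ℝ] H) (W : ℕ → ℕ → ℝ → H)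
    (hd : ∀ s i t, 0 ≤ t → HasDerivWithinAt (W s i) (W s (i + 1) t) (Set.Ici 0) t)
    (hJ : ∀ s t, 0 ≤ t → J (W (s + 1) 0 t) = W s 0 t) :
    ∃ Z, Scl J Z ∧ ∀ s i t, 0 ≤ t → Z s i t = W s i t := by
  have hJ' : ∀ s i t, 0 ≤ t → J (W (s + 1) i t) = W s i t := fun s i => by
    induction i with
    | zero => exact hJ s
    | succ i ih =>
      intro t ht
      have h1 : HasDerivWithinAt (fun t => J (W (s + 1) i t)) (J (W (s + 1) (i + 1) t)) (Set.Ici 0) t :=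
        J.hasFDerivAt.comp_hasDerivWithinAt t (hd (s + 1) i t ht)
      have h2 : HasDerivWithinAt (fun t => J (W (s + 1) i t)) (W s (i + 1) t) (Set.Ici 0) t :=
        (hd s i t ht).congr (fun r hr => ih r hr) (ih t ht)
      exact ((uniqueDiffOn_Ici 0) t ht).eq_deriv _ h1 h2
  obtain ⟨g, hg, hg0, hgJ⟩ := borel_scale fun s i => W s i 0
  set Z : ℕ → ℕ → ℝ → H := fun s i t => if 0 ≤ t then W s i t else g s i t
  have hp : ∀ s i t, 0 ≤ t → Z s i t = W s i t := fun s i t ht => if_pos ht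
  have hn : ∀ s i t, t ≤ 0 → Z s i t = g s i t := fun s i t ht => by
    rcases eq_or_lt_of_le ht with rfl | h
    · rw [hp _ _ _ le_rfl, hg0]
    · exact if_neg (not_le.2 h)
  refine ⟨Z, ⟨fun s i t => ?_, fun s i t => ?_⟩, hp⟩
  · rcases lt_trichotomy t 0 with h | rfl | h
    · rw [hn _ _ _ h.le]
      refine (hg s i t).congr_of_eventuallyEq ?_
      filter_upwards [Iio_mem_nhds h] with r hr using hn s i r (le_of_lt hr)
    · have h1 : HasDerivWithinAt (Z s i) (Z s (i + 1) 0) (Set.Ici 0) 0 := by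
        rw [hp _ _ _ le_rfl]
        exact (hd s i 0 le_rfl).congr (fun r hr => hp s i r hr) (hp s i 0 le_rfl)
      have h2 : HasDerivWithinAt (Z s i) (Z s (i + 1) 0) (Set.Iic 0) 0 := by
        rw [hn _ _ _ le_rfl]
        exact (hg s i 0).hasDerivWithinAt.congr (fun r hr => hn s i r hr) (hn s i 0 le_rfl)
      have h3 := h2.union h1
      rw [Set.Iic_union_Ici] at h3
      exact hasDerivWithinAt_univ.1 h3
    · rw [hp _ _ _ h.le]
      have h1 := (hd s i t h.le).hasDerivAt (Ici_mem_nhds h)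
      refine h1.congr_of_eventuallyEq ?_
      filter_upwards [Ioi_mem_nhds h] with r hr using hp s i r (le_of_lt hr)
  · rcases le_total 0 t with h | h
    · rw [hp _ _ _ h, hp _ _ _ h, hJ' _ _ _ h]
    · rw [hn _ _ _ h, hn _ _ _ h]
      exact hgJ J s (fun i => hJ' s i 0 le_rfl) i t

namespace SC
variable {H0 H1 : Type*} [NormedAddCommGroup H0] [InnerProductSpace ℝ H0] [CompleteSpace H0]
    [NormedAddCommGroup H1] [InnerProductSpace ℝ H1] [CompleteSpace H1] (S : SC H0 H1)

/-- iterated generators -/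
def GI (s : ℕ) : ℕ → (H1 →L[ℝ] H1)
  | 0 => ContinuousLinearMap.id ℝ H1
  | i + 1 => (GI s i).comp (S.G (s + i))

/-- bounds of iterated generators -/
def kb (b : ℝ) (B : ℕ → ℝ) (s i : ℕ) : ℝ := ∏ j ∈ Finset.range i, gb b B (s + j)

lemma kb_nonneg (s i : ℕ) : 0 ≤ kb S.b S.B s i := Finset.prod_nonneg fun j _ => S.gb_nonneg _

lemma GI_le (s i : ℕ) (x : H1) : ‖S.GI s i x‖ ≤ kb S.b S.B s i * ‖x‖ := by
  induction i generalizing x with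
  | zero => simp [GI, kb]
  | succ i ih =>
    have h1 := ih (S.G (s + i) x)
    have h2 := mul_le_mul_of_nonneg_left (S.G_le (s + i) x) (S.kb_nonneg s i)
    have e : kb S.b S.B s (i + 1) = kb S.b S.B s i * gb S.b S.B (s + i) := Finset.prod_range_succ _ _
    rw [e, mul_assoc]
    exact h1.trans h2

/-- smooth solution of the first order system -/
lemma smooth_sol (Φ : ℕ → H0) (hΦ : ∀ s, S.J0 (Φ (s + 1)) = Φ s) :
    ∃ Z : ℕ → ℕ → ℝ → H1, Scl S.J1 Z ∧
      (∀ s t, 0 ≤ t → S.Pi (Z s 1 t) = S.L (Z (s + 1) 0 t)) ∧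
      (∀ s t, 0 ≤ t → S.Ns (S.A s (Z s 1 t)) = -S.Ds (S.A (s + 1) (Z (s + 1) 0 t))) ∧
      (∀ s, S.Pi (Z s 0 0) = S.Pi (S.D (Φ (s + 1)))) ∧
      (∀ s i t, 0 ≤ t → ‖Z s i t‖ ≤ kb S.b S.B s i * ‖Z (s + i) 0 t‖) ∧
      (∀ s, MemLp (Z s 0) 2 mu) ∧
      (∀ s, ∫ t, ‖Z s 0 t‖ ^ 2 ∂mu ≤ (rb S.b S.B s * (‖Φ (s + 1)‖ + ‖Φ s‖)) ^ 2) := by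
  obtain ⟨X, hXc, hXd, hXJ, hX0, hXL, hXn⟩ := S.sol Φ hΦ
  obtain ⟨Z, hZ, hZX⟩ := half_ext S.J1 (fun s i t => S.GI s i (X (s + i) t)) (fun s i t ht =>
    (S.GI s i).hasFDerivAt.comp_hasDerivWithinAt t (hXd (s + i) t ht)) hXJ
  have hz0 : ∀ s t, 0 ≤ t → Z s 0 t = X s t := fun s t ht => hZX s 0 t ht
  have hz1 : ∀ s t, 0 ≤ t → Z s 1 t = S.G s (Z (s + 1) 0 t) := fun s t ht => by
    rw [hz0 _ _ ht]; exact hZX s 1 t ht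
  have h0 : ∀ᵐ t ∂mu, (0:ℝ) < t := ae_restrict_mem measurableSet_Ioi
  refine ⟨Z, hZ, fun s t ht => ?_, fun s t ht => ?_, fun s => ?_, fun s i t ht => ?_, fun s => ?_, fun s => ?_⟩
  · rw [hz1 _ _ ht, PiG]
  · rw [hz1 _ _ ht, NsAG]
  · rw [hz0 _ _ le_rfl, hX0]
  · rw [hz0 _ _ ht, hZX _ _ _ ht]
    exact S.GI_le s i _
  · exact (hXL s).ae_eq (by filter_upwards [h0] with t ht using (hz0 s t ht.le).symm)
  · refine le_trans (le_of_eq ?_) (hXn s)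
    refine integral_congr_ae ?_
    filter_upwards [h0] with t ht
    rw [hz0 s t ht.le]
end SC
end

section
open MeasureTheory
open scoped BigOperators Topology RealInnerProductSpace
set_option linter.all false
set_option linter.deprecated false
open CS

section Kop
variable {d : ℕ} {F Fp Fpp : Type*} [NormedAddCommGroup F] [InnerProductSpace ℝ F] [CompleteSpace F]
  [NormedAddCommGroup Fp] [InnerProductSpace ℝ Fp] [CompleteSpace Fp]
  [NormedAddCommGroup Fpp] [InnerProductSpace ℝ Fpp] [CompleteSpace Fpp]

/-- constant-coefficient operator acting on sequences -/
def kop (T : F →L[ℝ] Fp) : HS d F →L[ℝ] HS d Fp := diag (fun _ => T)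
lemma kop_bd (T : F →L[ℝ] Fp) : Bd (d := d) (fun _ => T) := ⟨‖T‖, fun _ => le_rfl⟩
lemma kop_apply (T : F →L[ℝ] Fp) (x : HS d F) (k) : kop T x k = T (x k) := diag_apply (kop_bd T) x k
lemma kop_norm (T : F →L[ℝ] Fp) : ‖(kop T : HS d F →L[ℝ] HS d Fp)‖ ≤ ‖T‖ := diag_norm fun _ => le_rfl
lemma kop_inner (T : F →L[ℝ] Fp) (T' : Fp →L[ℝ] F) (h : ∀ a b, ⟪T a, b⟫ = ⟪a, T' b⟫) (x : HS d F) (y : HS d Fp) :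
    ⟪kop T x, y⟫ = ⟪x, kop T' y⟫ := diag_inner (kop_bd T) (kop_bd T') (fun _ => h) x y
lemma kop_mul {θ : (Fin d → ℤ) → ℝ} (h : ∃ C, ∀ k, |θ k| ≤ C) (T : F →L[ℝ] Fp) (x : HS d F) :
    mul θ (kop T x) = kop T (mul θ x) := mul_diag h (kop_bd T) x
lemma kop_Js (s : ℕ) (T : F →L[ℝ] Fp) (x : HS d F) : Js s (kop T x) = kop T (Js s x) := kop_mul (wi_bd s d) T x
lemma kop_kop (T : F →L[ℝ] Fp) (T' : Fp →L[ℝ] Fpp) (x : HS d F) : kop T' (kop T x) = kop (T'.comp T) x := by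
  ext k; simp [kop_apply]
variable [CS F] [CS Fp]
lemma kop_dh (T : F →L[ℝ] Fp) (hT : ∀ c x, T (cs c x) = cs c (T x)) (v : Euc d) (x : HS d F) :
    kop T (dh v x) = dh v (kop T x) := by
  ext k; simp [kop_apply, dh_apply, hT]
lemma evo_kop {σ : ℕ} (hσ : 2 * d ≤ σ) (T : F →L[ℝ] Fp) (hT : ∀ c x, T (cs c x) = cs c (T x)) (y : Euc d) (x : HS d F) :
    evo σ y (kop T x) = T (evo σ y x) := by
  have h1 := evo_apply hσ y (kop T x)
  have h2 := (evo_apply hσ y x).mapL T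
  refine h1.unique ?_
  have e : (fun k => wi σ k • cs (ek k y) (kop T x k)) = fun k => T (wi σ k • cs (ek k y) (x k)) := by
    funext k; rw [kop_apply, map_smul, hT]
  rw [e]; exact h2
lemma dh_mul {θ : (Fin d → ℤ) → ℝ} (h : ∃ C, ∀ k, |θ k| ≤ C) (v : Euc d) (x : HS d F) :
    mul θ (dh v x) = dh v (mul θ x) := by
  ext k; simp [mul_apply' h, dh_apply]
lemma dh_lin (v : Euc d) (x : HS d F) : dh v x = ∑ i, v i • dh (EuclideanSpace.single i 1) x := by
  ext k
  have e : ∀ (s : Finset (Fin d)) (g : Fin d → HS d F), (∑ i ∈ s, g i : HS d F) k = ∑ i ∈ s, g i k := fun s g =>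
    map_sum (HS.ev k : HS d F →L[ℝ] F) g s
  rw [e]
  simp only [HS.smul_apply, dh_apply]
  have : sy v k = ∑ i, ((v i : ℝ) : ℂ) * sy (EuclideanSpace.single i 1) k := by
    unfold sy
    have hk : kd k v = ∑ i, v i * kd k (EuclideanSpace.single i 1) := by
      conv_lhs => rw [show v = ∑ i, v i • EuclideanSpace.single i (1:ℝ) from by
        ext j; simp [PiLp.smul_apply, Finset.sum_apply, Pi.single_apply]]
      simp [map_sum]
    rw [hk]; push_cast
    simp_rw [Finset.mul_sum, Finset.sum_mul]
    exact Finset.sum_congr rfl fun i _ => by ring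
  rw [this, map_sum, ContinuousLinearMap.sum_apply]
  refine Finset.sum_congr rfl fun i _ => ?_
  rw [cs_mul, cs_real]
lemma sy_adj (v : Euc d) (k) (a b : F) : ⟪cs (sy v k) a, b⟫ = - ⟪a, cs (sy v k) b⟫ := by
  rw [CS.cs_inner]
  have : (starRingEnd ℂ) (sy v k) = - sy v k := by unfold sy; simp
  rw [this, map_neg]; simp
lemma dh_adj (v : Euc d) (x y : HS d F) : ⟪dh v x, y⟫ = - ⟪x, dh v y⟫ := by
  rw [HS.inner_eq, HS.inner_eq, ← tsum_neg]
  refine tsum_congr fun k => ?_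
  rw [dh_apply, dh_apply, sy_adj]
end Kop

section ME
variable {ι : Type*} [Fintype ι] [DecidableEq ι]
/-- matrix unit -/
def Eop (p q : ι) : EuclideanSpace ℂ ι →L[ℂ] EuclideanSpace ℂ ι :=
  LinearMap.toContinuousLinearMap
    { toFun := fun x => EuclideanSpace.single p (x q)
      map_add' := fun x y => by ext j; simp [Pi.single_apply]; split_ifs <;> simp
      map_smul' := fun c x => by ext j; simp [Pi.single_apply] }
lemma Eop_apply (p q : ι) (x : EuclideanSpace ℂ ι) : Eop p q x = EuclideanSpace.single p (x q) := rfl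
/-- operator with real matrix entries -/
def mo (g : ι → ι → ℝ) : EuclideanSpace ℂ ι →L[ℂ] EuclideanSpace ℂ ι := ∑ p, ∑ q, g p q • Eop p q
lemma mo_apply (g : ι → ι → ℝ) (x : EuclideanSpace ℂ ι) (p : ι) : mo g x p = ∑ q, (g p q : ℂ) * x q := by
  unfold mo
  simp [ContinuousLinearMap.sum_apply, Eop_apply, Pi.single_apply, Finset.sum_apply]
lemma mo_re (g : ι → ι → ℝ) (x : EuclideanSpace ℂ ι) (p : ι) : (mo g x p).re = ∑ q, g p q * (x q).re := by
  rw [mo_apply]; simp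
lemma mo_im (g : ι → ι → ℝ) (x : EuclideanSpace ℂ ι) (p : ι) : (mo g x p).im = ∑ q, g p q * (x q).im := by
  rw [mo_apply]; simp
lemma E_inner (x y : EuclideanSpace ℂ ι) : ⟪x, y⟫ = ∑ p, ((x p).re * (y p).re + (x p).im * (y p).im) := by
  rw [PiLp.inner_apply]
  refine Finset.sum_congr rfl fun p _ => ?_
  rw [Complex.inner]; simp; ring
lemma mo_coer (g : ι → ι → ℝ) (lam : ℝ) (h : ∀ ξ : ι → ℝ, lam * ∑ p, ξ p ^ 2 ≤ ∑ p, ∑ q, g p q * ξ q * ξ p) (x : EuclideanSpace ℂ ι) :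
    lam * ‖x‖ ^ 2 ≤ ⟪mo g x, x⟫ := by
  rw [← real_inner_self_eq_norm_sq, E_inner, E_inner]
  have h1 := h fun p => (x p).re
  have h2 := h fun p => (x p).im
  simp only [mo_re, mo_im, Finset.sum_mul, Finset.sum_add_distrib, mul_add] at *
  simp only [← sq]
  linarith
lemma mo_smooth {d : ℕ} (g : Euc d → ι → ι → ℝ) (h : ∀ p q, ContDiff ℝ (⊤:ℕ∞) fun y => g y p q) : ContDiff ℝ (⊤:ℕ∞) fun y => mo (g y) := by
  unfold mo
  exact ContDiff.sum fun p _ => ContDiff.sum fun q _ => (h p q).smul contDiff_const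
end ME
end

section
open MeasureTheory
open scoped BigOperators Topology RealInnerProductSpace
set_option linter.all false
set_option linter.deprecated false
open CS

abbrev F0 (m : ℕ) := EuclideanSpace ℂ (Fin m)
abbrev F1 (m d : ℕ) := EuclideanSpace ℂ (Fin m × Fin d)

section emb
variable {m d : ℕ}
def emb (i : Fin d) : F0 m →L[ℝ] F1 m d :=
  LinearMap.toContinuousLinearMap
    { toFun := fun x => WithLp.toLp 2 (fun p : Fin m × Fin d => if p.2 = i then x p.1 else 0)
      map_add' := fun x y => by ext p; simp; split_ifs <;> simp
      map_smul' := fun c x => by ext p; simp }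
lemma emb_apply (i : Fin d) (x : F0 m) (p) : emb i x p = if p.2 = i then x p.1 else 0 := rfl
def prj (i : Fin d) : F1 m d →L[ℝ] F0 m :=
  LinearMap.toContinuousLinearMap
    { toFun := fun x => WithLp.toLp 2 (fun α : Fin m => x (α, i))
      map_add' := fun x y => by ext p; simp
      map_smul' := fun c x => by ext p; simp }
lemma prj_apply (i : Fin d) (x : F1 m d) (α) : prj i x α = x (α, i) := rfl
lemma emb_cs (i : Fin d) (c : ℂ) (x : F0 m) : emb i (cs c x) = cs c (emb i x) := by
  ext p
  show (if p.2 = i then c • x p.1 else 0) = c • (if p.2 = i then x p.1 else 0)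
  split_ifs <;> simp
lemma prj_cs (i : Fin d) (c : ℂ) (x : F1 m d) : prj i (cs c x) = cs c (prj i x) := rfl
lemma emb_prj_adj (i : Fin d) (x : F0 m) (y : F1 m d) : ⟪emb i x, y⟫ = ⟪x, prj i y⟫ := by
  rw [E_inner, E_inner, Fintype.sum_prod_type]
  refine Finset.sum_congr rfl fun α _ => ?_
  rw [Finset.sum_eq_single i]
  · simp [emb_apply, prj_apply]
  · intro j _ hj; simp [emb_apply, hj]
  · simp
lemma prj_emb (i j : Fin d) (x : F0 m) : prj i (emb j x) = if i = j then x else 0 := by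
  ext α; rw [prj_apply, emb_apply]; split_ifs <;> simp
lemma emb_norm (i : Fin d) : ‖(emb i : F0 m →L[ℝ] F1 m d)‖ ≤ 1 := by
  refine ContinuousLinearMap.opNorm_le_bound _ zero_le_one fun x => ?_
  have : ‖(emb i x : F1 m d)‖ ^ 2 = ‖x‖ ^ 2 := by
    rw [← real_inner_self_eq_norm_sq, emb_prj_adj, prj_emb, if_pos rfl, real_inner_self_eq_norm_sq]
  rw [one_mul]
  exact le_of_eq ((pow_left_inj₀ (norm_nonneg _) (norm_nonneg _) two_ne_zero).1 this)
lemma prj_norm (i : Fin d) : ‖(prj i : F1 m d →L[ℝ] F0 m)‖ ≤ 1 := by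
  refine ContinuousLinearMap.opNorm_le_bound _ zero_le_one fun x => ?_
  have h : ‖(prj i x : F0 m)‖ ^ 2 = ⟪emb i (prj i x), x⟫ := by
    rw [emb_prj_adj, real_inner_self_eq_norm_sq]
  have h2 := real_inner_le_norm (emb i (prj i x)) x
  have h3 := (emb i : F0 m →L[ℝ] F1 m d).le_of_opNorm_le (emb_norm i) (prj i x)
  rw [one_mul] at *
  by_contra hc
  rw [not_le] at hc
  nlinarith [norm_nonneg x, norm_nonneg (prj i x)]

def eo (i : Fin d) : HS d (F0 m) →L[ℝ] HS d (F1 m d) := kop (emb i)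
def po (i : Fin d) : HS d (F1 m d) →L[ℝ] HS d (F0 m) := kop (prj i)
lemma po_eo (i j : Fin d) (x : HS d (F0 m)) : po i (eo j x) = if i = j then x else 0 := by
  ext k; unfold po eo; rw [kop_apply, kop_apply, prj_emb]; split_ifs <;> simp
lemma eo_adj (i : Fin d) (x : HS d (F0 m)) (y : HS d (F1 m d)) : ⟪eo i x, y⟫ = ⟪x, po i y⟫ :=
  kop_inner _ _ (emb_prj_adj i) x y
lemma eo_dh (i : Fin d) (v : Euc d) (x : HS d (F0 m)) : eo i (dh v x) = dh v (eo i x) := kop_dh _ (emb_cs i) v x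
lemma po_dh (i : Fin d) (v : Euc d) (x : HS d (F1 m d)) : po i (dh v x) = dh v (po i x) := kop_dh _ (prj_cs i) v x
lemma eo_norm (i : Fin d) : ‖(eo i : HS d (F0 m) →L[ℝ] _)‖ ≤ 1 := (kop_norm _).trans (emb_norm i)
lemma po_norm (i : Fin d) : ‖(po i : HS d (F1 m d) →L[ℝ] _)‖ ≤ 1 := (kop_norm _).trans (prj_norm i)
lemma eo_mul {θ : (Fin d → ℤ) → ℝ} (h : ∃ C, ∀ k, |θ k| ≤ C) (i : Fin d) (x : HS d (F0 m)) : mul θ (eo i x) = eo i (mul θ x) := kop_mul h _ x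
lemma po_mul {θ : (Fin d → ℤ) → ℝ} (h : ∃ C, ∀ k, |θ k| ≤ C) (i : Fin d) (x : HS d (F1 m d)) : mul θ (po i x) = po i (mul θ x) := kop_mul h _ x

abbrev ei (i : Fin d) : Euc d := EuclideanSpace.single i 1
def Dop (m d : ℕ) : HS d (F0 m) →L[ℝ] HS d (F1 m d) := ∑ i, (eo i).comp (dh (ei i))
lemma Dop_apply (x : HS d (F0 m)) : Dop m d x = ∑ i, eo i (dh (ei i) x) := by
  unfold Dop; rw [ContinuousLinearMap.sum_apply]; rfl
def Dsop (m d : ℕ) : HS d (F1 m d) →L[ℝ] HS d (F0 m) := - ∑ i, (dh (ei i)).comp (po i)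
lemma Dsop_apply (x : HS d (F1 m d)) : Dsop m d x = - ∑ i, dh (ei i) (po i x) := by
  unfold Dsop; rw [ContinuousLinearMap.neg_apply, ContinuousLinearMap.sum_apply]; rfl
def Nop (n : Euc d) : HS d (F0 m) →L[ℝ] HS d (F1 m d) := ∑ i, n i • eo i
lemma Nop_apply (n : Euc d) (x : HS d (F0 m)) : Nop n x = ∑ i, n i • eo i x := by
  unfold Nop; rw [ContinuousLinearMap.sum_apply]; rfl
def Nsop (n : Euc d) : HS d (F1 m d) →L[ℝ] HS d (F0 m) := ∑ i, n i • po i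
lemma Nsop_apply (n : Euc d) (x : HS d (F1 m d)) : Nsop n x = ∑ i, n i • po i x := by
  unfold Nsop; rw [ContinuousLinearMap.sum_apply]; rfl
lemma po_D (i : Fin d) (x : HS d (F0 m)) : po i (Dop m d x) = dh (ei i) x := by
  rw [Dop_apply, map_sum]; simp [po_eo]
lemma po_N (n : Euc d) (i : Fin d) (x : HS d (F0 m)) : po i (Nop n x) = n i • x := by
  rw [Nop_apply, map_sum]; simp [po_eo]
lemma Ns_D (n : Euc d) (x : HS d (F0 m)) : Nsop n (Dop m d x) = dh n x := by
  rw [Nsop_apply, dh_lin]; simp only [po_D]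
lemma dh_D (n : Euc d) (x : HS d (F0 m)) : dh n (Dop m d x) = Dop m d (dh n x) := by
  rw [Dop_apply, Dop_apply, map_sum]
  exact Finset.sum_congr rfl fun i _ => by rw [← eo_dh, dh_dh n (ei i)]
lemma dh_N (n : Euc d) (v : Euc d) (x : HS d (F0 m)) : dh v (Nop n x) = Nop n (dh v x) := by
  rw [Nop_apply, Nop_apply, map_sum]
  exact Finset.sum_congr rfl fun i _ => by rw [map_smul, eo_dh]
lemma dh_Ns (n : Euc d) (v : Euc d) (x : HS d (F1 m d)) : dh v (Nsop n x) = Nsop n (dh v x) := by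
  rw [Nsop_apply, Nsop_apply, map_sum]
  exact Finset.sum_congr rfl fun i _ => by rw [map_smul, po_dh]
lemma mul_D {θ : (Fin d → ℤ) → ℝ} (h : ∃ C, ∀ k, |θ k| ≤ C) (x : HS d (F0 m)) : mul θ (Dop m d x) = Dop m d (mul θ x) := by
  rw [Dop_apply, Dop_apply, map_sum]
  exact Finset.sum_congr rfl fun i _ => by rw [eo_mul h, dh_mul h]
lemma mul_Ds {θ : (Fin d → ℤ) → ℝ} (h : ∃ C, ∀ k, |θ k| ≤ C) (x : HS d (F1 m d)) : mul θ (Dsop m d x) = Dsop m d (mul θ x) := by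
  rw [Dsop_apply, Dsop_apply, map_neg, map_sum]
  exact congrArg _ (Finset.sum_congr rfl fun i _ => by rw [dh_mul h, po_mul h])
lemma mul_N {θ : (Fin d → ℤ) → ℝ} (h : ∃ C, ∀ k, |θ k| ≤ C) (n : Euc d) (x : HS d (F0 m)) : mul θ (Nop n x) = Nop n (mul θ x) := by
  rw [Nop_apply, Nop_apply, map_sum]
  exact Finset.sum_congr rfl fun i _ => by rw [map_smul, eo_mul h]
lemma mul_Ns {θ : (Fin d → ℤ) → ℝ} (h : ∃ C, ∀ k, |θ k| ≤ C) (n : Euc d) (x : HS d (F1 m d)) : mul θ (Nsop n x) = Nsop n (mul θ x) := by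
  rw [Nsop_apply, Nsop_apply, map_sum]
  exact Finset.sum_congr rfl fun i _ => by rw [map_smul, po_mul h]
def bd (d : ℕ) : ℝ := 2 * Real.pi * d * (d + 1)
lemma dh_ei_norm {F : Type*} [NormedAddCommGroup F] [InnerProductSpace ℝ F] [CompleteSpace F] [CS F] (i : Fin d) :
    ‖(dh (ei i) : HS d F →L[ℝ] HS d F)‖ ≤ 2 * Real.pi * d := by
  have := dh_norm (F := F) (ei i)
  simpa using this
lemma D_norm : ‖Dop m d‖ ≤ bd d := by
  unfold Dop bd
  refine (norm_sum_le _ _).trans ?_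
  calc ∑ i, ‖(eo i : HS d (F0 m) →L[ℝ] HS d (F1 m d)).comp (dh (ei i))‖ ≤ ∑ i : Fin d, 1 * (2 * Real.pi * d) :=
        Finset.sum_le_sum fun i _ => (ContinuousLinearMap.opNorm_comp_le _ _).trans
          (mul_le_mul (eo_norm i) (dh_ei_norm i) (norm_nonneg _) zero_le_one)
    _ ≤ _ := by
        simp; have := Real.pi_pos; have hd : (0:ℝ) ≤ d := Nat.cast_nonneg d; nlinarith [mul_nonneg this.le hd]
lemma Ds_norm : ‖Dsop m d‖ ≤ bd d := by
  unfold Dsop bd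
  rw [norm_neg]
  refine (norm_sum_le _ _).trans ?_
  calc ∑ i, ‖(dh (ei i)).comp (po i : HS d (F1 m d) →L[ℝ] HS d (F0 m))‖ ≤ ∑ i : Fin d, (2 * Real.pi * d) * 1 :=
        Finset.sum_le_sum fun i _ => (ContinuousLinearMap.opNorm_comp_le _ _).trans
          (mul_le_mul (dh_ei_norm i) (po_norm i) (norm_nonneg _) (by positivity))
    _ ≤ _ := by
        simp; have := Real.pi_pos; have hd : (0:ℝ) ≤ d := Nat.cast_nonneg d; nlinarith [mul_nonneg this.le hd]
lemma dhn_norm (n : Euc d) (hn : ∑ i, n i ^ 2 = 1) : ‖(dh n : HS d (F1 m d) →L[ℝ] _)‖ ≤ bd d := by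
  refine (dh_norm n).trans ?_
  have : ‖n‖ = 1 := by rw [EuclideanSpace.norm_eq]; simp [hn]
  rw [this]; unfold bd
  have := Real.pi_pos; have hd : (0:ℝ) ≤ d := Nat.cast_nonneg d; nlinarith [mul_nonneg this.le hd, mul_nonneg (mul_nonneg this.le hd) hd]
lemma D_adj (x : HS d (F0 m)) (y : HS d (F1 m d)) : ⟪Dop m d x, y⟫ = ⟪x, Dsop m d y⟫ := by
  rw [Dop_apply, Dsop_apply, sum_inner, inner_neg_right, inner_sum, ← Finset.sum_neg_distrib]
  exact Finset.sum_congr rfl fun i _ => by rw [eo_adj, dh_adj]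
lemma N_adj (n : Euc d) (x : HS d (F0 m)) (y : HS d (F1 m d)) : ⟪Nop n x, y⟫ = ⟪x, Nsop n y⟫ := by
  rw [Nop_apply, Nsop_apply, sum_inner, inner_sum]
  exact Finset.sum_congr rfl fun i _ => by rw [real_inner_smul_left, real_inner_smul_right, eo_adj]
lemma Ns_N (n : Euc d) (hn : ∑ i, n i ^ 2 = 1) (x : HS d (F0 m)) : Nsop n (Nop n x) = x := by
  rw [Nsop_apply]; simp only [po_N, smul_smul, ← sq]; rw [← Finset.sum_smul, hn, one_smul]
end emb

section conc
variable {m d : ℕ} (A : Coeffs d m)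
def gA (y : Euc d) (p q : Fin m × Fin d) : ℝ := astar A p.2 q.2 p.1 q.1 y
def fA (y : Euc d) : F1 m d →L[ℂ] F1 m d := mo (gA A y)
def aA (q : Fin d → ℤ) : F1 m d →L[ℝ] F1 m d := (fc (fA A) q).restrictScalars ℝ
lemma fA_per : Per (fA A) := fun y z => by
  unfold fA; congr 1; funext p q; exact A.periodic _ _ _ _ y z
lemma fA_smooth : ContDiff ℝ (⊤:ℕ∞) (fA A) := mo_smooth _ fun p q => A.smooth _ _ _ _
lemma aA_rapid : Rapid (aA A) := fun s => by
  have := fc_summable s (fA_per A) (fA_smooth A)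
  have e : ∀ q, ‖aA A q‖ = ‖fc (fA A) q‖ := fun q => ContinuousLinearMap.norm_restrictScalars _
  simp only [e]; exact this
lemma aA_cs (q : Fin d → ℤ) (c : ℂ) (x : F1 m d) : aA A q (cs c x) = cs c (aA A q x) := (fc (fA A) q).map_smul c x
lemma aA_sum (y : Euc d) (x : F1 m d) : HasSum (fun q => cs (ek q y) (aA A q x)) ((fA A y).restrictScalars ℝ x) := by
  have := fourier_inv (fA_per A) (fA_smooth A) y
  exact this.mapL (ContinuousLinearMap.apply ℂ (F1 m d) x)
lemma fA_coer (y : Euc d) (x : F1 m d) : A.lam * ‖x‖ ^ 2 ≤ ⟪(fA A y).restrictScalars ℝ x, x⟫ := by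
  refine mo_coer (gA A y) A.lam (fun ξ => ?_) x
  have h := A.ell_low y (fun α i => ξ (α, i))
  rw [Fintype.sum_prod_type]
  refine h.trans (le_of_eq ?_)
  unfold gA astar
  simp only [Fintype.sum_prod_type]
  rw [Finset.sum_comm]
  calc ∑ j, ∑ i, ∑ α, ∑ β, A.a i j α β y * ξ (α, i) * ξ (β, j)
      = ∑ j, ∑ i, ∑ β, ∑ α, A.a i j α β y * ξ (α, i) * ξ (β, j) :=
        Finset.sum_congr rfl fun j _ => Finset.sum_congr rfl fun i _ => Finset.sum_comm
    _ = ∑ j, ∑ β, ∑ i, ∑ α, A.a i j α β y * ξ (α, i) * ξ (β, j) :=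
        Finset.sum_congr rfl fun j _ => Finset.sum_comm
    _ = ∑ β, ∑ j, ∑ i, ∑ α, A.a i j α β y * ξ (α, i) * ξ (β, j) := Finset.sum_comm
    _ = _ := Finset.sum_congr rfl fun β _ => Finset.sum_congr rfl fun j _ => Finset.sum_comm
lemma aA_coer (x : HS d (F1 m d)) : A.lam * ‖x‖ ^ 2 ≤ ⟪As (aA A) 0 x, x⟫ := by
  refine Aop_coercive (aA_rapid A) (aA_cs A) (fun y => (fA A y).restrictScalars ℝ) ?_ (aA_sum A) (fA_coer A) x
  exact (ContinuousLinearMap.restrictScalarsL ℂ (F1 m d) (F1 m d) ℝ ℝ).continuous.comp (fA_smooth A).continuous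
def epsA (s : ℕ) : ℝ := (Aop_coercive' (aA_rapid A) A.lam_pos (aA_coer A) s).choose
lemma epsA_spec (s : ℕ) : 0 < epsA A s ∧ epsA A s ≤ 1 ∧ ∀ x : HS d (F1 m d), A.lam / 2 * ‖x‖ ^ 2 ≤ ⟪Aop (aA A) (wte (epsA A s) s) x, x⟫ :=
  (Aop_coercive' (aA_rapid A) A.lam_pos (aA_coer A) s).choose_spec
/-- weight ratio -/
def rA (s : ℕ) (k : Fin d → ℤ) : ℝ := wte (epsA A s) s k / wt k ^ s
lemma rA_pos (s : ℕ) (k) : 0 < rA A s k := by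
  have := wt_pos k; have h := (epsA_spec A s).1; unfold rA wte; positivity
lemma rA_le (s : ℕ) (k) : rA A s k ≤ 1 := by
  have h0 := wt_pos k; obtain ⟨h, h1, -⟩ := epsA_spec A s
  unfold rA wte; rw [div_le_one (by positivity)]
  unfold wt; gcongr; nlinarith [norm_nonneg k]
lemma rA_ge (s : ℕ) (k) : epsA A s ^ s ≤ rA A s k := by
  have h0 := wt_pos k; obtain ⟨h, h1, -⟩ := epsA_spec A s
  unfold rA wte; rw [le_div_iff₀ (by positivity), ← mul_pow]
  unfold wt; gcongr; nlinarith [norm_nonneg k]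
lemma rA_bd (s : ℕ) : ∃ C, ∀ k, |rA A s k| ≤ C := ⟨1, fun k => by rw [abs_of_pos (rA_pos A s k)]; exact rA_le A s k⟩
def qA (s : ℕ) (k : Fin d → ℤ) : ℝ := rA A s k * rA A s k
def pA (s : ℕ) (k : Fin d → ℤ) : ℝ := (rA A s k * rA A s k)⁻¹
lemma qA_le (s : ℕ) (k) : |qA A s k| ≤ 1 := by
  have := rA_pos A s k; have := rA_le A s k
  unfold qA; rw [abs_of_pos (by positivity)]; nlinarith
lemma qA_bd (s : ℕ) : ∃ C, ∀ k, |qA A s k| ≤ C := ⟨1, qA_le A s⟩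
lemma pA_bd (s : ℕ) : ∃ C, ∀ k, |pA A s k| ≤ C := by
  obtain ⟨h, -⟩ := epsA_spec A s
  refine ⟨(epsA A s ^ s * epsA A s ^ s)⁻¹, fun k => ?_⟩
  have h1 := rA_pos A s k; have h2 := rA_ge A s k
  unfold pA; rw [abs_of_pos (by positivity)]; gcongr
lemma mul_qp {F : Type*} [NormedAddCommGroup F] [InnerProductSpace ℝ F] [CompleteSpace F] (s : ℕ) (x : HS d F) : mul (qA A s) (mul (pA A s) x) = x := by
  rw [mul_mul (qA_bd A s) (pA_bd A s) (χ := fun _ => 1) (fun k => ?_), mul_one' (fun _ => rfl)]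
  have h1 := (rA_pos A s k).ne'
  unfold qA pA; field_simp
def cA (s : ℕ) : ℝ := A.lam / 2 * (epsA A s ^ s) ^ 2
lemma cA_pos (s : ℕ) : 0 < cA A s := by
  have := A.lam_pos; have := (epsA_spec A s).1; unfold cA; positivity
lemma cA_coer (s : ℕ) (x : HS d (F1 m d)) : cA A s * ‖x‖ ^ 2 ≤ ⟪As (aA A) s x, mul (qA A s) x⟫ := by
  obtain ⟨h, h1, h2⟩ := epsA_spec A s
  rw [← mul_mul (χ := qA A s) (rA_bd A s) (rA_bd A s) (fun k => rfl), ← mul_inner (rA_bd A s)]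
  have e : mul (rA A s) (As (aA A) s x) = Aop (aA A) (wte (epsA A s) s) (mul (rA A s) x) := by
    refine mul_Aop (aA_rapid A) (wte_one_adm s) (wte_adm h.le h1 s) (rA_bd A s) (fun k => ?_) x
    rw [wte_one]; unfold rA; have := wt_ne k; field_simp
  rw [e]
  refine le_trans ?_ (h2 _)
  unfold cA
  have h3 : (epsA A s ^ s) ^ 2 * ‖x‖ ^ 2 ≤ ‖mul (rA A s) x‖ ^ 2 := by
    rw [HS.norm_sq, HS.norm_sq, ← tsum_mul_left]
    refine Summable.tsum_le_tsum (fun k => ?_) (x.summable_sq.mul_left _) (HS.summable_sq _)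
    rw [mul_apply' (rA_bd A s), norm_smul, mul_pow, Real.norm_eq_abs, sq_abs]
    have := rA_ge A s k
    gcongr
  have := A.lam_pos
  calc _ = A.lam / 2 * ((epsA A s ^ s) ^ 2 * ‖x‖ ^ 2) := by ring
    _ ≤ _ := by gcongr
def BA (s : ℕ) : ℝ := (∑' q, wt q ^ s * ‖aA A q‖) + 1 / cA A s
lemma sA_nonneg (s : ℕ) : 0 ≤ ∑' q, wt q ^ s * ‖aA A q‖ :=
  tsum_nonneg fun q => mul_nonneg (pow_nonneg (wt_pos q).le _) (norm_nonneg _)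

/-- the concrete scale -/
def SCA (n : Euc d) (hn : ∑ i, n i ^ 2 = 1) : SC (HS d (F0 m)) (HS d (F1 m d)) where
  J0 := Js 1
  J1 := Js 1
  D := Dop m d
  N := Nop n
  Ds := Dsop m d
  Ns := Nsop n
  E := dh n
  A := As (aA A)
  Q0 s := mul (qA A s)
  P0 s := mul (pA A s)
  Q1 s := mul (qA A s)
  P1 s := mul (pA A s)
  c := cA A
  b := bd d
  B := BA A
  Dadj := D_adj
  Nadj := N_adj n
  J1adj := Js_inner 1
  NsN := Ns_N n hn
  JD := mul_D (wi_bd 1 d)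
  JN := mul_N (wi_bd 1 d) n
  JNs x := (mul_Ns (wi_bd 1 d) n x).symm
  JDs x := (mul_Ds (wi_bd 1 d) x).symm
  JE := dh_Js n 1
  ED x := by rw [Ns_D, dh_D]
  EN x := by rw [Ns_D, dh_N]
  NsE x := by rw [Ns_D, dh_Ns]
  JA s x := Js_As (aA_rapid A) s 1 x
  QD s x := mul_D (qA_bd A s) x
  QN s x := mul_N (qA_bd A s) n x
  QJ s x := by
    rw [Js, mul_mul (qA_bd A s) (wi_bd 1 d) (fun k => rfl), mul_mul (wi_bd 1 d) (qA_bd A s) (fun k => mul_comm _ _)]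
  PD s x := mul_D (pA_bd A s) x
  PN s x := mul_N (pA_bd A s) n x
  PJ s x := by
    rw [Js, mul_mul (pA_bd A s) (wi_bd 1 d) (fun k => rfl), mul_mul (wi_bd 1 d) (pA_bd A s) (fun k => mul_comm _ _)]
  QP1 := mul_qp A
  QP0 := mul_qp A
  c_pos := cA_pos A
  coer := cA_coer A
  D_le := D_norm
  Ds_le := Ds_norm
  E_le := dhn_norm n hn
  A_le s := (Aop_norm (aA_rapid A) (wte_one_adm s)).trans (by
    have := cA_pos A s; unfold BA; have : 0 ≤ 1 / cA A s := by positivity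
    linarith)
  Q1_le s := by
    have h := cA_pos A s
    have := sA_nonneg A s
    have h2 := mul_norm (F := F1 m d) (qA_le A s)
    unfold BA
    have : ‖(mul (qA A s) : HS d (F1 m d) →L[ℝ] _)‖ / cA A s ≤ 1 / cA A s := by gcongr
    linarith
  Q0_le s := by
    have h := cA_pos A s
    have := sA_nonneg A s
    have h2 := mul_norm (F := F0 m) (qA_le A s)
    unfold BA
    have : ‖(mul (qA A s) : HS d (F0 m) →L[ℝ] _)‖ / cA A s ≤ 1 / cA A s := by gcongr
    linarith
end conc
end

section
open MeasureTheory
open scoped BigOperators Topology RealInnerProductSpace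
set_option linter.all false
set_option linter.deprecated false
open CS

section phys
variable {d : ℕ} {F : Type*} [NormedAddCommGroup F] [InnerProductSpace ℝ F] [CompleteSpace F] [CS F]

abbrev Scale (d : ℕ) (F : Type*) [NormedAddCommGroup F] := ℕ → ℕ → ℝ → HS d F
/-- physical function of a scale -/
def fz (Z : Scale d F) (y : Euc d) (t : ℝ) : F := evo (2 * d) y (Z (2 * d) 0 t)

lemma fz_eq {Z : Scale d F} (hZ : Scl (Js 1) Z) {σ : ℕ} (hσ : 2 * d ≤ σ) (y : Euc d) (t : ℝ) :
    evo σ y (Z σ 0 t) = fz Z y t := by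
  induction σ, hσ using Nat.le_induction with
  | base => rfl
  | succ σ hσ ih => rw [← evo_Js hσ 1, hZ.cmp, ih]

lemma fz_smooth {Z : Scale d F} (hZ : Scl (Js 1) Z) : ContDiff ℝ (⊤ : ℕ∞) (fun p : Euc d × ℝ => fz Z p.1 p.2) := by
  refine contDiff_infty.2 fun r => ?_
  have hσ : r + 2 * d ≤ r + 2 * d := le_rfl
  have e : (fun p : Euc d × ℝ => fz Z p.1 p.2) = fun p => (evo (r + 2 * d) p.1 : HS d F →L[ℝ] F) (Z (r + 2 * d) 0 p.2) :=
    funext fun p => (fz_eq hZ (by omega) _ _).symm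
  rw [e]
  refine ContDiff.clm_apply ((evo_contDiff hσ).comp contDiff_fst) ?_
  exact ((hZ.contDiff _ _).of_le (by exact_mod_cast le_top)).comp contDiff_snd

lemma fz_per (Z : Scale d F) (t : ℝ) : Per (fun y => fz Z y t) := fun y z => by
  unfold fz
  have := evo_per (F := F) (σ := 2 * d) y z
  simp only at this ⊢
  rw [this]

/-- time derivative -/
def tZ (Z : Scale d F) : Scale d F := fun s i t => Z s (i + 1) t
/-- space derivative -/
def vZ (v : Euc d) (Z : Scale d F) : Scale d F := fun s i t => dh v (Z (s + 1) i t)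
/-- conormal-shifted time derivative -/
def dZ (n : Euc d) (Z : Scale d F) : Scale d F := fun s i t => Z s (i + 1) t - dh n (Z (s + 1) i t)

lemma tZ_scl {Z : Scale d F} (hZ : Scl (Js 1) Z) : Scl (Js 1) (tZ Z) := ⟨fun s i t => hZ.der _ _ _, fun s i t => hZ.cmp _ _ _⟩
lemma vZ_scl {Z : Scale d F} (hZ : Scl (Js 1) Z) (v : Euc d) : Scl (Js 1) (vZ v Z) :=
  ⟨fun s i t => (dh v : HS d F →L[ℝ] HS d F).hasFDerivAt.comp_hasDerivAt t (hZ.der (s + 1) i t),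
   fun s i t => by unfold vZ; rw [← dh_Js, hZ.cmp]⟩
lemma dZ_scl {Z : Scale d F} (hZ : Scl (Js 1) Z) (n : Euc d) : Scl (Js 1) (dZ n Z) :=
  ⟨fun s i t => ((tZ_scl hZ).der s i t).sub ((vZ_scl hZ n).der s i t),
   fun s i t => by
    have h1 := (tZ_scl hZ).cmp s i t
    have h2 := (vZ_scl hZ n).cmp s i t
    unfold tZ at h1; unfold vZ at h2; unfold dZ
    rw [map_sub, h1, h2]⟩
lemma fz_dZ (n : Euc d) (Z : Scale d F) (y : Euc d) (t : ℝ) : fz (dZ n Z) y t = fz (tZ Z) y t - fz (vZ n Z) y t := by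
  unfold fz dZ tZ vZ; rw [map_sub]

lemma fz_dt {Z : Scale d F} (hZ : Scl (Js 1) Z) (y : Euc d) (t : ℝ) : HasDerivAt (fun t => fz Z y t) (fz (tZ Z) y t) t :=
  (evo (2 * d) y : HS d F →L[ℝ] F).hasFDerivAt.comp_hasDerivAt t (hZ.der (2 * d) 0 t)
lemma fz_dv {Z : Scale d F} (hZ : Scl (Js 1) Z) (y : Euc d) (t : ℝ) (v : Euc d) :
    fderiv ℝ (fun y => fz Z y t) y v = fz (vZ v Z) y t := by
  have e : (fun y => fz Z y t) = fun y => evo (2 * d + 1) y (Z (2 * d + 1) 0 t) := funext fun y => (fz_eq hZ (by omega) _ _).symm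
  rw [e, (evo_hasFDerivAt le_rfl _ y v).2]; rfl

lemma fz_fderiv {Z : Scale d F} (hZ : Scl (Js 1) Z) (y : Euc d) (t : ℝ) (v : Euc d) (τ : ℝ) :
    fderiv ℝ (fun p : Euc d × ℝ => fz Z p.1 p.2) (y, t) (v, τ) = fz (vZ v Z) y t + τ • fz (tZ Z) y t := by
  have hd : HasFDerivAt (fun p : Euc d × ℝ => fz Z p.1 p.2) _ (y, t) := ((fz_smooth hZ).differentiable (by simp) (y, t)).hasFDerivAt
  set L := fderiv ℝ (fun p : Euc d × ℝ => fz Z p.1 p.2) (y, t)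
  have h1 : HasFDerivAt (fun y => fz Z y t) (L.comp (ContinuousLinearMap.inl ℝ (Euc d) ℝ)) y :=
    HasFDerivAt.comp (g := fun p : Euc d × ℝ => fz Z p.1 p.2) (f := fun y => (y, t)) y hd (hasFDerivAt_prodMk_left y t)
  have h2 : HasFDerivAt (fun t => fz Z y t) (L.comp (ContinuousLinearMap.inr ℝ (Euc d) ℝ)) t :=
    HasFDerivAt.comp (g := fun p : Euc d × ℝ => fz Z p.1 p.2) (f := fun t => (y, t)) t hd (hasFDerivAt_prodMk_right y t)
  have e1 := fz_dv hZ y t v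
  rw [h1.fderiv] at e1
  have e2 := (h2.hasDerivAt).unique (fz_dt hZ y t)
  have e3 : (v, τ) = ContinuousLinearMap.inl ℝ (Euc d) ℝ v + τ • ContinuousLinearMap.inr ℝ (Euc d) ℝ 1 := by
    simp
  rw [e3, map_add, map_smul, ← e1, ← e2]; rfl

/-- shifted physical function -/
def wz (n : Euc d) (Z : Scale d F) (θ : Euc d) (t : ℝ) : F := fz Z (θ - t • n) t
lemma wz_smooth {Z : Scale d F} (hZ : Scl (Js 1) Z) (n : Euc d) : ContDiff ℝ (⊤ : ℕ∞) (fun p : Euc d × ℝ => wz n Z p.1 p.2) :=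
  (fz_smooth hZ).comp (f := fun p : Euc d × ℝ => (p.1 - p.2 • n, p.2)) (by fun_prop)
lemma wz_per (n : Euc d) (Z : Scale d F) (t : ℝ) : Per (fun y => wz n Z y t) := fun y z => by
  have := fz_per Z t (y - t • n) z
  simp only at this
  show fz Z _ t = fz Z _ t
  rw [← this]; congr 1; abel
lemma wz_dt {Z : Scale d F} (hZ : Scl (Js 1) Z) (n : Euc d) (θ : Euc d) (t : ℝ) :
    HasDerivAt (fun t => wz n Z θ t) (wz n (dZ n Z) θ t) t := by
  have hd : HasFDerivAt (fun p : Euc d × ℝ => fz Z p.1 p.2) _ (θ - t • n, t) := ((fz_smooth hZ).differentiable (by simp) _).hasFDerivAt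
  have hc : HasDerivAt (fun t : ℝ => (θ - t • n, t)) (-n, (1:ℝ)) t := by
    have h1 : HasDerivAt (fun t : ℝ => θ - t • n) (-n) t := by
      have := ((hasDerivAt_id t).smul_const n).const_sub θ
      simpa using this
    exact h1.prodMk (hasDerivAt_id t)
  have := HasFDerivAt.comp_hasDerivAt (l := fun p : Euc d × ℝ => fz Z p.1 p.2) (f := fun t : ℝ => (θ - t • n, t)) t hd hc
  rw [fz_fderiv hZ] at this
  have e : fz (vZ (-n) Z) (θ - t • n) t + (1:ℝ) • fz (tZ Z) (θ - t • n) t = wz n (dZ n Z) θ t := by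
    unfold wz
    rw [fz_dZ, one_smul, ← fz_dv hZ, ← fz_dv hZ, map_neg]; abel
  rw [e] at this
  exact this
lemma wz_dv {Z : Scale d F} (hZ : Scl (Js 1) Z) (n : Euc d) (θ : Euc d) (t : ℝ) (v : Euc d) :
    fderiv ℝ (fun θ => wz n Z θ t) θ v = wz n (vZ v Z) θ t := by
  have : fderiv ℝ (fun θ => wz n Z θ t) θ = fderiv ℝ (fun y => fz Z y t) (θ - t • n) :=
    by
      have := fderiv_comp_add_right (𝕜 := ℝ) (f := fun y => fz Z y t) (x := θ) (-(t • n))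
      simp only [← sub_eq_add_neg] at this
      exact this
  rw [this, fz_dv hZ]; rfl

lemma Scl.cmp0 {Z : Scale d F} (hZ : Scl (Js 1) Z) (s i : ℕ) (t : ℝ) : Js s (Z s i t) = Z 0 i t := by
  induction s with
  | zero => exact Js_zero _
  | succ s ih => rw [← Js_Js, hZ.cmp, ih]
lemma wz_norm {Z : Scale d F} (hZ : Scl (Js 1) Z) (n : Euc d) (t : ℝ) :
    ∫ θ in unitCell d, ‖wz n Z θ t‖ ^ 2 = ‖Z 0 0 t‖ ^ 2 := by
  have hp : Per (fun y => ‖fz Z y t‖ ^ 2) := fun y z => by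
    have := fz_per Z t y z
    simp only at this ⊢
    rw [this]
  have h := cell_shift hp (-(t • n))
  simp only [← sub_eq_add_neg] at h
  unfold wz
  rw [h]
  unfold fz
  rw [parseval_norm le_rfl, hZ.cmp0]

/-- bounds -/
def Bn (K : ℕ → ℕ → ℝ) (r : ℕ) (Z X : Scale d F) : Prop := ∀ s i t, 0 ≤ t → ‖Z s i t‖ ≤ K s i * ‖X (s + i + r) 0 t‖
def Kd (d : ℕ) (K : ℕ → ℕ → ℝ) (s i : ℕ) : ℝ := K s (i + 1) + bd d * K (s + 1) i
lemma bd_nonneg (d : ℕ) : 0 ≤ bd d := by unfold bd; have := Real.pi_pos; positivity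
lemma Kd_nonneg {K : ℕ → ℕ → ℝ} (hK : ∀ s i, 0 ≤ K s i) (s i : ℕ) : 0 ≤ Kd d K s i :=
  add_nonneg (hK _ _) (mul_nonneg (bd_nonneg d) (hK _ _))
lemma dh_bd {v : Euc d} (hv : ‖v‖ ≤ 1) (x : HS d F) : ‖dh v x‖ ≤ bd d * ‖x‖ := by
  have h1 := (dh v : HS d F →L[ℝ] HS d F).le_opNorm x
  have h2 := dh_norm (F := F) v
  refine h1.trans (mul_le_mul_of_nonneg_right (h2.trans ?_) (norm_nonneg _))
  unfold bd
  have hd : (0:ℝ) ≤ d := Nat.cast_nonneg d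
  have := Real.pi_pos
  calc 2 * Real.pi * d * ‖v‖ ≤ 2 * Real.pi * d * (d + 1) := by gcongr; linarith
    _ = _ := rfl
lemma Bn.dZ {K : ℕ → ℕ → ℝ} {r : ℕ} {Z X : Scale d F} (h : Bn K r Z X) {n : Euc d} (hn : ‖n‖ ≤ 1) : Bn (Kd d K) (r + 1) (dZ n Z) X := by
  intro s i t ht
  have h1 := h s (i + 1) t ht
  have h2 := h (s + 1) i t ht
  have h3 := dh_bd hn (Z (s + 1) i t)
  have e1 : s + (i + 1) + r = s + i + (r + 1) := by omega
  have e2 : s + 1 + i + r = s + i + (r + 1) := by omega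
  rw [e1] at h1; rw [e2] at h2
  unfold _root_.dZ Kd
  calc _ ≤ ‖Z s (i + 1) t‖ + ‖dh n (Z (s + 1) i t)‖ := norm_sub_le _ _
    _ ≤ K s (i + 1) * ‖X (s + i + (r + 1)) 0 t‖ + bd d * (K (s + 1) i * ‖X (s + i + (r + 1)) 0 t‖) :=
        add_le_add h1 (h3.trans (mul_le_mul_of_nonneg_left h2 (bd_nonneg d)))
    _ = _ := by ring
lemma Bn.vZ {K : ℕ → ℕ → ℝ} (hK : ∀ s i, 0 ≤ K s i) {r : ℕ} {Z X : Scale d F} (h : Bn K r Z X) {n : Euc d} (hn : ‖n‖ ≤ 1) : Bn (Kd d K) (r + 1) (vZ n Z) X := by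
  intro s i t ht
  have h2 := h (s + 1) i t ht
  have h3 := dh_bd hn (Z (s + 1) i t)
  have e2 : s + 1 + i + r = s + i + (r + 1) := by omega
  rw [e2] at h2
  unfold _root_.vZ Kd
  have h4 := mul_nonneg (hK s (i + 1)) (norm_nonneg (X (s + i + (r + 1)) 0 t))
  calc _ ≤ bd d * (K (s + 1) i * ‖X (s + i + (r + 1)) 0 t‖) := h3.trans (mul_le_mul_of_nonneg_left h2 (bd_nonneg d))
    _ ≤ _ := by linarith

/-- mixed derivative of a scale -/
def mZ (n : Euc d) (l : List (Fin d)) (j : ℕ) (Z : Scale d F) : Scale d F := l.foldr (fun i Z => vZ (ei i) Z) ((dZ n)^[j] Z)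
lemma mZ_spec {K : ℕ → ℕ → ℝ} (hK : ∀ s i, 0 ≤ K s i) {n : Euc d} (hn : ‖n‖ ≤ 1) {Z : Scale d F} (hZ : Scl (Js 1) Z) (h : Bn K 0 Z Z) (l : List (Fin d)) (j : ℕ) :
    Scl (Js 1) (mZ n l j Z) ∧ Bn ((Kd d)^[l.length + j] K) (l.length + j) (mZ n l j Z) Z ∧ ∀ s i, 0 ≤ ((Kd d)^[l.length + j] K) s i := by
  have hKK : ∀ N s i, 0 ≤ ((Kd d)^[N] K) s i := fun N => by
    induction N with
    | zero => exact hK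
    | succ N ih => rw [Function.iterate_succ_apply']; exact Kd_nonneg ih
  refine ⟨?_, ?_, hKK _⟩
  · induction l with
    | nil =>
      unfold mZ; simp only [List.foldr_nil]
      induction j with
      | zero => exact hZ
      | succ j ih => rw [Function.iterate_succ_apply']; exact dZ_scl ih n
    | cons a l ih => exact vZ_scl ih _
  · induction l with
    | nil =>
      unfold mZ; simp only [List.foldr_nil, List.length_nil, zero_add]
      induction j with
      | zero => exact h
      | succ j ih => rw [Function.iterate_succ_apply', Function.iterate_succ_apply']; exact ih.dZ hn
    | cons a l ih =>
      have e : (a :: l).length + j = l.length + j + 1 := by simp; omega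
      rw [e, Function.iterate_succ_apply']
      exact Bn.vZ (hKK _) ih (n := ei a) (by simp)
end phys
end

section
open MeasureTheory
open scoped BigOperators Topology RealInnerProductSpace
set_option linter.all false
set_option linter.deprecated false
open CS

section pint
variable {E : Type} [NormedAddCommGroup E] [NormedSpace ℝ E] [FiniteDimensional ℝ E]

lemma pint_hasFDerivAt {F : Type} [NormedAddCommGroup F] [NormedSpace ℝ F] [CompleteSpace F] (g : E × ℝ → F)
    (hg : ContDiff ℝ 1 g) (x₀ : E) (b : ℝ) :
    HasFDerivAt (fun x => ∫ r in (0:ℝ)..b, g (x, r)) (∫ r in (0:ℝ)..b, (fderiv ℝ g (x₀, r)).comp (ContinuousLinearMap.inl ℝ E ℝ)) x₀ := by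
  have : ProperSpace E := FiniteDimensional.proper ℝ E
  have hcont : Continuous (fun p : E × ℝ => (fderiv ℝ g p).comp (ContinuousLinearMap.inl ℝ E ℝ)) :=
    (hg.continuous_fderiv one_ne_zero).clm_comp continuous_const
  obtain ⟨C, hC⟩ := ((isCompact_closedBall x₀ 1).prod (isCompact_uIcc (a := (0:ℝ)) (b := b))).exists_bound_of_continuousOn hcont.continuousOn
  refine (intervalIntegral.hasFDerivAt_integral_of_dominated_of_fderiv_le (𝕜 := ℝ) (μ := volume) (s := Metric.ball x₀ 1)
    (F := fun x r => g (x, r)) (F' := fun x r => (fderiv ℝ g (x, r)).comp (ContinuousLinearMap.inl ℝ E ℝ)) (bound := fun _ => C)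
    (Metric.ball_mem_nhds x₀ one_pos) ?_ ?_ ?_ ?_ ?_ ?_)
  · exact Filter.Eventually.of_forall fun x => (hg.continuous.comp (by fun_prop : Continuous fun r : ℝ => (x, r))).aestronglyMeasurable
  · exact (hg.continuous.comp (by fun_prop : Continuous fun r : ℝ => (x₀, r))).intervalIntegrable _ _
  · exact (hcont.comp (by fun_prop : Continuous fun r : ℝ => (x₀, r))).aestronglyMeasurable
  · refine Filter.Eventually.of_forall fun r hr x hx => ?_
    exact hC (x, r) ⟨Metric.ball_subset_closedBall hx, Set.uIoc_subset_uIcc hr⟩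
  · exact intervalIntegrable_const
  · refine Filter.Eventually.of_forall fun r hr x hx => ?_
    have hd : HasFDerivAt g (fderiv ℝ g (x, r)) (x, r) := (hg.differentiable one_ne_zero (x, r)).hasFDerivAt
    exact HasFDerivAt.comp (g := g) (f := fun x => (x, r)) x hd (hasFDerivAt_prodMk_left x r)

lemma pint_nat (n : ℕ) : ∀ {F : Type} [NormedAddCommGroup F] [NormedSpace ℝ F] [CompleteSpace F] (g : E × ℝ → F)
    (hg : ContDiff ℝ (⊤ : ℕ∞) g), ContDiff ℝ n (fun x => ∫ r in (0:ℝ)..1, g (x, r)) := by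
  induction n with
  | zero =>
    intro F _ _ _ g hg
    exact contDiff_zero.2 (intervalIntegral.continuous_parametric_intervalIntegral_of_continuous' (f := fun x r => g (x, r)) hg.continuous 0 1)
  | succ n ih =>
    intro F _ _ _ g hg
    have h1 : ContDiff ℝ 1 g := hg.of_le (by exact_mod_cast le_top)
    have e : ((n + 1 : ℕ) : WithTop ℕ∞) = (n : WithTop ℕ∞) + 1 := by push_cast; rfl
    rw [e, contDiff_succ_iff_fderiv]
    refine ⟨fun x => (pint_hasFDerivAt g h1 x 1).differentiableAt, by simp, ?_⟩
    have e2 : fderiv ℝ (fun x => ∫ r in (0:ℝ)..1, g (x, r)) = fun x => ∫ r in (0:ℝ)..1, (fun p : E × ℝ => (fderiv ℝ g p).comp (ContinuousLinearMap.inl ℝ E ℝ)) (x, r) :=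
      funext fun x => (pint_hasFDerivAt g h1 x 1).fderiv
    rw [e2]
    refine ih (fun p : E × ℝ => (fderiv ℝ g p).comp (ContinuousLinearMap.inl ℝ E ℝ)) ?_
    exact (hg.fderiv_right (m := (⊤ : ℕ∞)) (by simp)).clm_comp contDiff_const

lemma pint_smooth {F : Type} [NormedAddCommGroup F] [NormedSpace ℝ F] [CompleteSpace F] {h : E → ℝ → F}
    (hh : ContDiff ℝ (⊤ : ℕ∞) (fun p : E × ℝ => h p.1 p.2)) : ContDiff ℝ (⊤ : ℕ∞) (fun p : E × ℝ => ∫ r in (0:ℝ)..p.2, h p.1 r) := by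
  have e : (fun p : E × ℝ => ∫ r in (0:ℝ)..p.2, h p.1 r) = fun p => ∫ r in (0:ℝ)..1, (fun q : (E × ℝ) × ℝ => q.1.2 • h q.1.1 (q.1.2 * q.2)) (p, r) := by
    funext p
    simp only
    rw [intervalIntegral.integral_smul, intervalIntegral.smul_integral_comp_mul_left (fun r => h p.1 r)]
    simp
  rw [e]
  refine contDiff_infty.2 fun n => pint_nat n (fun q : (E × ℝ) × ℝ => q.1.2 • h q.1.1 (q.1.2 * q.2)) ?_
  refine ContDiff.smul (by fun_prop) ?_
  exact hh.comp (f := fun q : (E × ℝ) × ℝ => (q.1.1, q.1.2 * q.2)) (by fun_prop)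
end pint
end

section
open MeasureTheory
open scoped BigOperators Topology RealInnerProductSpace
set_option linter.all false
set_option linter.deprecated false
open CS

section wrs
/-- real part of a component -/
def rc {ι : Type*} [Fintype ι] (p : ι) : EuclideanSpace ℂ ι →L[ℝ] ℝ :=
  Complex.reCLM.comp ((EuclideanSpace.proj (𝕜 := ℂ) p : EuclideanSpace ℂ ι →L[ℂ] ℂ).restrictScalars ℝ)
lemma rc_apply {ι : Type*} [Fintype ι] (p : ι) (x : EuclideanSpace ℂ ι) : rc p x = (x p).re := rfl
lemma rc_le {ι : Type*} [Fintype ι] (p : ι) (x : EuclideanSpace ℂ ι) : |rc p x| ≤ ‖x‖ := by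
  rw [rc_apply]
  exact (Complex.abs_re_le_norm _).trans (PiLp.norm_apply_le x p)
variable {d m : ℕ}

def wr (n : Euc d) (Z : Scale d (F1 m d)) (p : Fin m × Fin d) (θ : Euc d) (t : ℝ) : ℝ := rc p (wz n Z θ t)

lemma wr_smooth {Z : Scale d (F1 m d)} (hZ : Scl (Js 1) Z) (n : Euc d) (p) : ContDiff ℝ (⊤ : ℕ∞) (fun q : Euc d × ℝ => wr n Z p q.1 q.2) :=
  (rc p : F1 m d →L[ℝ] ℝ).contDiff.comp (wz_smooth hZ n)
lemma wr_per (n : Euc d) (Z : Scale d (F1 m d)) (p t) : Per (fun θ => wr n Z p θ t) := fun y z => by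
  have := wz_per n Z t y z
  simp only at this ⊢
  unfold wr; rw [this]
lemma wr_dt {Z : Scale d (F1 m d)} (hZ : Scl (Js 1) Z) (n : Euc d) (p) (θ : Euc d) (t : ℝ) :
    HasDerivAt (fun t => wr n Z p θ t) (wr n (dZ n Z) p θ t) t :=
  (rc p : F1 m d →L[ℝ] ℝ).hasFDerivAt.comp_hasDerivAt t (wz_dt hZ n θ t)
lemma wz_diff {Z : Scale d (F1 m d)} (hZ : Scl (Js 1) Z) (n : Euc d) (t : ℝ) : ContDiff ℝ (⊤ : ℕ∞) (fun θ => wz n Z θ t) :=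
  (wz_smooth hZ n).comp (f := fun θ : Euc d => (θ, t)) (by fun_prop)
lemma wr_diff {Z : Scale d (F1 m d)} (hZ : Scl (Js 1) Z) (n : Euc d) (p) (t : ℝ) : ContDiff ℝ (⊤ : ℕ∞) (fun θ => wr n Z p θ t) :=
  (rc p : F1 m d →L[ℝ] ℝ).contDiff.comp (wz_diff hZ n t)
lemma wr_pder {Z : Scale d (F1 m d)} (hZ : Scl (Js 1) Z) (n : Euc d) (p) (t : ℝ) (i : Fin d) (θ : Euc d) :
    pder i (fun θ => wr n Z p θ t) θ = wr n (vZ (ei i) Z) p θ t := by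
  have h := HasFDerivAt.comp (g := fun x => rc p x) (f := fun θ => wz n Z θ t) θ (rc p : F1 m d →L[ℝ] ℝ).hasFDerivAt
    ((wz_diff hZ n t).differentiable (by simp) θ).hasFDerivAt
  have h2 : fderiv ℝ (fun θ => wr n Z p θ t) θ = _ := h.fderiv
  unfold pder
  rw [h2]
  show rc p (fderiv ℝ (fun θ => wz n Z θ t) θ (ei i)) = _
  rw [wz_dv hZ]; rfl

lemma dZ_it {Z : Scale d (F1 m d)} (hZ : Scl (Js 1) Z) (n : Euc d) (j : ℕ) : Scl (Js 1) ((dZ n)^[j] Z) := by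
  induction j with
  | zero => exact hZ
  | succ j ih => rw [Function.iterate_succ_apply']; exact dZ_scl ih n
lemma mZ_scl {Z : Scale d (F1 m d)} (hZ : Scl (Js 1) Z) (n : Euc d) (l : List (Fin d)) (j : ℕ) : Scl (Js 1) (mZ n l j Z) := by
  induction l with
  | nil => exact dZ_it hZ n j
  | cons a l ih => exact vZ_scl ih _

lemma rc_po (σ : ℕ) (hσ : 2 * d ≤ σ) (y : Euc d) (x : HS d (F1 m d)) (α : Fin m) (i : Fin d) :
    rc (α, i) (evo σ y x) = rc α (evo σ y (po i x)) := by
  unfold po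
  rw [evo_kop hσ (prj i) (prj_cs i)]; rfl
lemma wr_po (n : Euc d) (Z : Scale d (F1 m d)) (α i θ t) : wr n Z (α, i) θ t = rc α (evo (2 * d) (θ - t • n) (po i (Z (2 * d) 0 t))) :=
  rc_po _ le_rfl _ _ _ _

/-- the structural identities -/
lemma H1a {A : Coeffs d m} {n : Euc d} (hn : ∑ i, n i ^ 2 = 1) {x z : HS d (F1 m d)}
    (h : (SCA A n hn).Pi x = (SCA A n hn).L z) : x - dh n z = Nop n (Nsop n x) - Dop m d (Nsop n z) := by
  rw [SC.L_apply, SC.Pi_apply, SC.Pi_apply, SC.Pi_apply] at h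
  change x - Nop n (Nsop n x) = dh n (z - Nop n (Nsop n z)) - (Dop m d (Nsop n z) - Nop n (Nsop n (Dop m d (Nsop n z)))) at h
  rw [Ns_D, map_sub, dh_N] at h
  have e : ∀ a b c p q : HS d (F1 m d), a - b = c - p - (q - p) → a - c = b - q := fun a b c p q h => by
    have h2 : a = a - b + b := by abel
    rw [h2, h]; abel
  exact e _ _ _ _ _ h

variable {A : Coeffs d m} {n : Euc d} (hn : ∑ i, n i ^ 2 = 1) {Z : Scale d (F1 m d)}

lemma H1 {t : ℝ} (h : ∀ s, (SCA A n hn).Pi (Z s 1 t) = (SCA A n hn).L (Z (s + 1) 0 t)) (θ : Euc d) (β : Fin m) (j : Fin d) :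
    wr n (dZ n Z) (β, j) θ t = n j * (∑ i, n i * wr n (tZ Z) (β, i) θ t) - ∑ i, n i * wr n (vZ (ei j) Z) (β, i) θ t := by
  simp only [wr_po]
  have e : dZ n Z (2 * d) 0 t = _ := H1a hn (h (2 * d))
  rw [e, map_sub, po_N, po_D, map_sub, map_sub, map_smul, map_smul, dh_Ns, Nsop_apply, Nsop_apply, smul_eq_mul]
  simp only [map_sum, map_smul, smul_eq_mul]
  rfl

lemma H0 {Φ : ℕ → HS d (F0 m)} (h : ∀ s, (SCA A n hn).Pi (Z s 0 0) = (SCA A n hn).Pi ((SCA A n hn).D (Φ (s + 1))))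
    {φ : Euc d → Fin m → ℝ} (hφ : ContDiff ℝ (⊤ : ℕ∞) φ)
    (hΦ : ∀ y α, rc α (evo (2 * d + 1) y (Φ (2 * d + 1))) = φ y α) (θ : Euc d) (β : Fin m) :
    ∃ g : ℝ, ∀ j, wr n Z (β, j) θ 0 = pder j (fun y => φ y β) θ + n j * g := by
  have h0 := h (2 * d)
  rw [SC.Pi_apply, SC.Pi_apply] at h0
  change Z (2 * d) 0 0 - Nop n (Nsop n (Z (2 * d) 0 0)) = Dop m d (Φ (2 * d + 1)) - Nop n (Nsop n (Dop m d (Φ (2 * d + 1)))) at h0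
  have h1 : Z (2 * d) 0 0 = Dop m d (Φ (2 * d + 1)) + Nop n (Nsop n (Z (2 * d) 0 0) - Nsop n (Dop m d (Φ (2 * d + 1)))) := by
    rw [map_sub]
    calc _ = (Z (2 * d) 0 0 - Nop n (Nsop n (Z (2 * d) 0 0))) + Nop n (Nsop n (Z (2 * d) 0 0)) := by abel
      _ = _ := by rw [h0]; abel
  refine ⟨rc β (evo (2 * d) (θ - (0:ℝ) • n) (Nsop n (Z (2 * d) 0 0) - Nsop n (Dop m d (Φ (2 * d + 1))))), fun j => ?_⟩
  rw [wr_po]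
  set w := Nsop n (Z (2 * d) 0 0) - Nsop n (Dop m d (Φ (2 * d + 1))) with hw
  rw [h1, map_add, po_N, po_D, map_add, map_add, map_smul, map_smul, smul_eq_mul]
  congr 1
  rw [zero_smul, sub_zero]
  have h2 := evo_hasFDerivAt (F := F0 m) (σ := 2 * d) le_rfl (Φ (2 * d + 1)) θ (ei j)
  rw [← h2.2]
  have h3 := HasFDerivAt.comp (g := fun x => rc β x) (f := fun y => evo (2 * d + 1) y (Φ (2 * d + 1))) θ (rc β : F0 m →L[ℝ] ℝ).hasFDerivAt
    h2.1
  have h4 : (fun y => φ y β) = (fun x => rc β x) ∘ (fun y => evo (2 * d + 1) y (Φ (2 * d + 1))) := funext fun y => (hΦ y β).symm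
  unfold pder
  rw [h4, h3.fderiv]; rfl

/-- flux scale -/
def yZ (A : Coeffs d m) (Z : Scale d (F1 m d)) : Scale d (F1 m d) := fun s i t => As (aA A) s (Z s i t)
lemma yZ_scl (hZ : Scl (Js 1) Z) : Scl (Js 1) (yZ A Z) :=
  ⟨fun s i t => (As (aA A) s : HS d (F1 m d) →L[ℝ] _).hasFDerivAt.comp_hasDerivAt t (hZ.der s i t),
   fun s i t => (Js_As (aA_rapid A) s 1 _).trans (by rw [hZ.cmp s i t]; rfl)⟩
lemma H2 {t : ℝ} (h : ∀ s, (SCA A n hn).Ns ((SCA A n hn).A s (Z s 1 t)) = - (SCA A n hn).Ds ((SCA A n hn).A (s + 1) (Z (s + 1) 0 t))) (θ : Euc d) (α : Fin m) :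
    ∑ i, n i * wr n (tZ (yZ A Z)) (α, i) θ t = ∑ i, wr n (vZ (ei i) (yZ A Z)) (α, i) θ t := by
  simp only [wr_po]
  have e : Nsop n (tZ (yZ A Z) (2 * d) 0 t) = - Dsop m d (yZ A Z (2 * d + 1) 0 t) := h (2 * d)
  rw [Nsop_apply, Dsop_apply, neg_neg] at e
  have e2 := congrArg (fun x => rc α (evo (2 * d) (θ - t • n) x)) e
  simp only [map_sum, map_smul, smul_eq_mul] at e2
  rw [e2]
  refine Finset.sum_congr rfl fun i _ => ?_
  unfold vZ
  rw [po_dh]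
lemma H3 (Z : Scale d (F1 m d)) (α i θ t) : wr n (yZ A Z) (α, i) θ t = ∑ j, ∑ β, astar A i j α β (θ - t • n) * wr n Z (β, j) θ t := by
  unfold wr wz fz yZ
  rw [evo_As le_rfl (aA_rapid A) (aA_cs A) _ ((fA A (θ - t • n)).restrictScalars ℝ) (aA_sum A _)]
  show (mo (gA A (θ - t • n)) _ (α, i)).re = _
  rw [mo_re, Fintype.sum_prod_type_right]
  rfl
lemma vZ_sum (n : Euc d) (v : Euc d) (Z : Scale d (F1 m d)) (p θ t) : wr n (vZ v Z) p θ t = ∑ i, v i * wr n (vZ (ei i) Z) p θ t := by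
  unfold wr wz fz vZ
  rw [dh_lin v]
  simp only [map_sum, map_smul, smul_eq_mul]
lemma dZ_sub (n : Euc d) (Z : Scale d (F1 m d)) (p θ t) : wr n (dZ n Z) p θ t = wr n (tZ Z) p θ t - wr n (vZ n Z) p θ t := by
  unfold wr wz
  rw [fz_dZ, map_sub]
end wrs
end

section
open MeasureTheory
open scoped BigOperators Topology RealInnerProductSpace
set_option linter.all false
set_option linter.deprecated false
open CS

section Vsec
variable {d m : ℕ}

lemma ortho_rows {M : Fin d → Fin d → ℝ} (hM : IsOrtho M) (i j : Fin d) : ∑ k, M i k * M j k = if i = j then (1:ℝ) else 0 := by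
  have h1 : (Matrix.of M).transpose * (Matrix.of M) = 1 := by
    ext k l
    rw [Matrix.mul_apply, Matrix.one_apply]
    exact hM k l
  have h3 : (Matrix.of M) * (Matrix.of M).transpose = 1 := mul_eq_one_comm.1 h1
  have h2 : ((Matrix.of M) * (Matrix.of M).transpose) i j = (1 : Matrix (Fin d) (Fin d) ℝ) i j := by rw [h3]
  rw [Matrix.mul_apply, Matrix.one_apply] at h2
  exact h2

def wW (n : Euc d) (Z : Scale d (F1 m d)) (β : Fin m) (θ : Euc d) (t : ℝ) : ℝ := ∑ i, n i * wr n Z (β, i) θ t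
lemma wW_smooth {Z : Scale d (F1 m d)} (hZ : Scl (Js 1) Z) (n : Euc d) (β) : ContDiff ℝ (⊤ : ℕ∞) (fun q : Euc d × ℝ => wW n Z β q.1 q.2) := by
  unfold wW
  exact ContDiff.sum fun i _ => contDiff_const.mul (wr_smooth hZ n (β, i))
lemma wr_cont_t {Z : Scale d (F1 m d)} (hZ : Scl (Js 1) Z) (n : Euc d) (p θ) : Continuous (fun t => wr n Z p θ t) :=
  (wr_smooth hZ n p).continuous.comp (f := fun t : ℝ => (θ, t)) (by fun_prop)
lemma wW_cont_t {Z : Scale d (F1 m d)} (hZ : Scl (Js 1) Z) (n : Euc d) (β θ) : Continuous (fun t => wW n Z β θ t) :=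
  (wW_smooth hZ n β).continuous.comp (f := fun t : ℝ => (θ, t)) (by fun_prop)
lemma pder_sum {ι : Type*} (s : Finset ι) (c : ι → ℝ) (f : ι → Euc d → ℝ) (hf : ∀ i, ContDiff ℝ (⊤ : ℕ∞) (f i)) (i : Fin d) (θ : Euc d) :
    pder i (fun θ => ∑ j ∈ s, c j * f j θ) θ = ∑ j ∈ s, c j * pder i (f j) θ := by
  unfold pder
  have h : HasFDerivAt (fun θ => ∑ j ∈ s, c j * f j θ) (∑ j ∈ s, c j • fderiv ℝ (f j) θ) θ :=
    HasFDerivAt.fun_sum fun j _ => (((hf j).differentiable (by simp) θ).hasFDerivAt).const_mul (c j)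
  rw [h.fderiv]
  simp [ContinuousLinearMap.sum_apply]
lemma wW_diff {Z : Scale d (F1 m d)} (hZ : Scl (Js 1) Z) (n : Euc d) (β t) : ContDiff ℝ (⊤ : ℕ∞) (fun θ => wW n Z β θ t) :=
  (wW_smooth hZ n β).comp (f := fun θ : Euc d => (θ, t)) (by fun_prop)
lemma wW_pder {Z : Scale d (F1 m d)} (hZ : Scl (Js 1) Z) (n : Euc d) (β t i θ) :
    pder i (fun θ => wW n Z β θ t) θ = wW n (vZ (ei i) Z) β θ t := by
  unfold wW
  rw [pder_sum Finset.univ (fun i => n i) (fun i θ => wr n Z (β, i) θ t) (fun i => wr_diff hZ n _ t)]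
  simp only [wr_pder hZ]
lemma wW_dt {Z : Scale d (F1 m d)} (hZ : Scl (Js 1) Z) (n : Euc d) (β θ t) :
    HasDerivAt (fun t => wW n Z β θ t) (wW n (dZ n Z) β θ t) t := by
  unfold wW
  exact HasDerivAt.fun_sum fun i _ => (wr_dt hZ n (β, i) θ t).const_mul (n i)

def VV (n : Euc d) (Z : Scale d (F1 m d)) (φ : Euc d → Fin m → ℝ) (θ : Euc d) (t : ℝ) (β : Fin m) : ℝ := φ θ β - ∫ r in (0:ℝ)..t, wW n Z β θ r

variable {n : Euc d} {Z : Scale d (F1 m d)} {φ : Euc d → Fin m → ℝ}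

lemma VV_smooth1 (hZ : Scl (Js 1) Z) (hφ : ContDiff ℝ (⊤ : ℕ∞) φ) (β : Fin m) :
    ContDiff ℝ (⊤ : ℕ∞) (fun p : Euc d × ℝ => VV n Z φ p.1 p.2 β) := by
  unfold VV
  refine ContDiff.sub ?_ (pint_smooth (h := fun θ r => wW n Z β θ r) (wW_smooth hZ n β))
  exact ((contDiff_pi.1 hφ) β).comp contDiff_fst
lemma VV_smooth (hZ : Scl (Js 1) Z) (hφ : ContDiff ℝ (⊤ : ℕ∞) φ) :
    ContDiff ℝ (⊤ : ℕ∞) (fun p : Euc d × ℝ => VV n Z φ p.1 p.2) := contDiff_pi.2 fun β => VV_smooth1 hZ hφ β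
lemma VV_per (hp : ∀ (θ : Euc d) (z : Fin d → ℤ), φ (θ + zvec z) = φ θ) (θ : Euc d) (z : Fin d → ℤ) (t : ℝ) :
    VV n Z φ (θ + zvec z) t = VV n Z φ θ t := by
  funext β
  unfold VV wW
  rw [hp]
  congr 1
  refine intervalIntegral.integral_congr fun r _ => ?_
  refine Finset.sum_congr rfl fun i _ => ?_
  have := wr_per n Z (β, i) r θ z
  simp only at this
  rw [this]
lemma VV_zero (θ : Euc d) : VV n Z φ θ 0 = φ θ := by
  funext β; unfold VV; simp
lemma VV_dt (hZ : Scl (Js 1) Z) (β θ t) : HasDerivAt (fun t => VV n Z φ θ t β) (- wW n Z β θ t) t := by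
  unfold VV
  have hc := wW_cont_t hZ n β θ
  exact (intervalIntegral.integral_hasDerivAt_right (hc.intervalIntegrable _ _) (hc.stronglyMeasurableAtFilter _ _) hc.continuousAt).const_sub _
lemma VV_pder (hZ : Scl (Js 1) Z) (hφ : ContDiff ℝ (⊤ : ℕ∞) φ) (β θ t i) :
    pder i (fun θ => VV n Z φ θ t β) θ = pder i (fun θ => φ θ β) θ - ∫ r in (0:ℝ)..t, wW n (vZ (ei i) Z) β θ r := by
  have hs := wW_smooth hZ n β
  have h1 : ContDiff ℝ 1 (fun q : Euc d × ℝ => wW n Z β q.1 q.2) := hs.of_le (by exact_mod_cast le_top)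
  have h2 := pint_hasFDerivAt (fun q : Euc d × ℝ => wW n Z β q.1 q.2) h1 θ t
  have h3 : HasFDerivAt (fun θ => φ θ β) _ θ := (((contDiff_pi.1 hφ) β).differentiable (by simp) θ).hasFDerivAt
  have h4 : HasFDerivAt (fun θ => VV n Z φ θ t β) _ θ := h3.sub h2
  unfold pder
  rw [h4.fderiv, ContinuousLinearMap.sub_apply]
  congr 1
  have hfc : Continuous fun r : ℝ => (fderiv ℝ (fun q : Euc d × ℝ => wW n Z β q.1 q.2) (θ, r)).comp (ContinuousLinearMap.inl ℝ (Euc d) ℝ) :=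
    ((h1.continuous_fderiv one_ne_zero).comp (f := fun r : ℝ => (θ, r)) (by fun_prop)).clm_comp continuous_const
  rw [ContinuousLinearMap.intervalIntegral_apply (hfc.intervalIntegrable _ _)]
  refine intervalIntegral.integral_congr fun r _ => ?_
  show fderiv ℝ (fun q : Euc d × ℝ => wW n Z β q.1 q.2) (θ, r) (ContinuousLinearMap.inl ℝ (Euc d) ℝ (ei i)) = _
  have h5 : HasFDerivAt (fun θ => wW n Z β θ r) ((fderiv ℝ (fun q : Euc d × ℝ => wW n Z β q.1 q.2) (θ, r)).comp (ContinuousLinearMap.inl ℝ (Euc d) ℝ)) θ :=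
    HasFDerivAt.comp (g := fun q : Euc d × ℝ => wW n Z β q.1 q.2) (f := fun θ => (θ, r)) θ (h1.differentiable (by simp) _).hasFDerivAt (hasFDerivAt_prodMk_left θ r)
  have h6 := wW_pder hZ n β r i θ
  unfold pder at h6
  rw [h5.fderiv] at h6
  exact h6

/-- hypotheses -/
structure Hyp (A : Coeffs d m) (n : Euc d) (Z : Scale d (F1 m d)) (φ : Euc d → Fin m → ℝ) : Prop where
  hn : ∑ i, n i ^ 2 = 1
  hZ : Scl (Js 1) Z
  hφ : ContDiff ℝ (⊤ : ℕ∞) φ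
  h0 : ∀ θ β, ∃ g : ℝ, ∀ j, wr n Z (β, j) θ 0 = pder j (fun y => φ y β) θ + n j * g
  h1 : ∀ t, 0 ≤ t → ∀ θ β j, wr n (dZ n Z) (β, j) θ t = n j * (∑ i, n i * wr n (tZ Z) (β, i) θ t) - ∑ i, n i * wr n (vZ (ei j) Z) (β, i) θ t
  h2 : ∀ t, 0 ≤ t → ∀ θ α, ∑ i, n i * wr n (tZ (yZ A Z)) (α, i) θ t = ∑ i, wr n (vZ (ei i) (yZ A Z)) (α, i) θ t

variable {A : Coeffs d m}
lemma VV_tan (H : Hyp A n Z φ) {v : Fin d → ℝ} (hv : ∑ j, v j * n j = 0) {t : ℝ} (ht : 0 ≤ t) (β : Fin m) (θ : Euc d) :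
    ∑ j, v j * pder j (fun θ => VV n Z φ θ t β) θ = ∑ j, v j * wr n Z (β, j) θ t := by
  have hZ := H.hZ
  have hd : ∀ r ∈ Set.uIcc 0 t, HasDerivAt (fun t => ∑ j, v j * wr n Z (β, j) θ t) (∑ j, v j * wr n (dZ n Z) (β, j) θ r) r := fun r _ =>
    HasDerivAt.fun_sum fun j _ => (wr_dt hZ n (β, j) θ r).const_mul (v j)
  have hc : Continuous (fun r => ∑ j, v j * wr n (dZ n Z) (β, j) θ r) :=
    continuous_finset_sum _ fun j _ => continuous_const.mul (wr_cont_t (dZ_scl hZ n) n (β, j) θ)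
  have hF := intervalIntegral.integral_eq_sub_of_hasDerivAt hd (hc.intervalIntegrable _ _)
  obtain ⟨g, hg⟩ := H.h0 θ β
  have e0 : ∑ j, v j * wr n Z (β, j) θ 0 = ∑ j, v j * pder j (fun y => φ y β) θ := by
    simp only [hg, mul_add, Finset.sum_add_distrib]
    have : ∑ j, v j * (n j * g) = (∑ j, v j * n j) * g := by rw [Finset.sum_mul]; exact Finset.sum_congr rfl fun _ _ => by ring
    rw [this, hv]; ring
  have e1 : ∫ r in (0:ℝ)..t, ∑ j, v j * wr n (dZ n Z) (β, j) θ r = - ∑ j, v j * ∫ r in (0:ℝ)..t, wW n (vZ (ei j) Z) β θ r := by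
    have : ∀ j, v j * ∫ r in (0:ℝ)..t, wW n (vZ (ei j) Z) β θ r = ∫ r in (0:ℝ)..t, v j * wW n (vZ (ei j) Z) β θ r := fun j =>
      (intervalIntegral.integral_const_mul _ _).symm
    simp only [this]
    rw [← intervalIntegral.integral_finset_sum (f := fun j r => v j * wW n (vZ (ei j) Z) β θ r) fun j _ => (continuous_const.mul (wW_cont_t (vZ_scl hZ _) n β θ)).intervalIntegrable _ _,
      ← intervalIntegral.integral_neg]
    refine intervalIntegral.integral_congr fun r hr => ?_
    rw [Set.uIcc_of_le ht] at hr
    have : ∀ j, v j * wr n (dZ n Z) (β, j) θ r = v j * n j * (∑ i, n i * wr n (tZ Z) (β, i) θ r) - v j * wW n (vZ (ei j) Z) β θ r := fun j => by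
      rw [H.h1 r hr.1]; unfold wW; ring
    simp only [this, Finset.sum_sub_distrib, ← Finset.sum_mul, hv]
    ring
  rw [e1, e0] at hF
  have e2 : ∑ j, v j * pder j (fun θ => VV n Z φ θ t β) θ = ∑ j, v j * pder j (fun y => φ y β) θ - ∑ j, v j * ∫ r in (0:ℝ)..t, wW n (vZ (ei j) Z) β θ r := by
    rw [← Finset.sum_sub_distrib]
    exact Finset.sum_congr rfl fun j _ => by rw [VV_pder hZ H.hφ]; ring
  rw [e2]; linarith

lemma VV_tanM (H : Hyp A n Z φ) (hd : 0 < d) {M : Fin d → Fin d → ℝ} (hM : IsOrtho M) (hL : LastColNeg hd n M) {k : Fin d} (hk : k ≠ lastIdx d hd) {t : ℝ} (ht : 0 ≤ t) (β : Fin m) (θ : Euc d) :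
    ∑ j, M j k * pder j (fun θ => VV n Z φ θ t β) θ = ∑ j, M j k * wr n Z (β, j) θ t := by
  refine VV_tan H (v := fun j => M j k) ?_ ht β θ
  have := hM k (lastIdx d hd)
  rw [if_neg hk] at this
  simp only [hL _] at this
  simp only [mul_neg, Finset.sum_neg_distrib, neg_eq_zero] at this
  exact this
lemma VV_liftD (H : Hyp A n Z φ) (hd : 0 < d) {M : Fin d → Fin d → ℝ} (hM : IsOrtho M) (hL : LastColNeg hd n M) (l : Fin d) {t : ℝ} (ht : 0 ≤ t) (β : Fin m) (θ : Euc d) :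
    liftD hd M l (fun a b => VV n Z φ a b β) θ t = ∑ j, M j l * wr n Z (β, j) θ t := by
  unfold liftD
  split_ifs with h
  · rw [(VV_dt H.hZ β θ t).deriv, h]
    simp only [hL _]
    unfold wW
    simp
  · exact VV_tanM H hd hM hL h ht β θ

lemma VV_flux (H : Hyp A n Z φ) (hd : 0 < d) {M : Fin d → Fin d → ℝ} (hM : IsOrtho M) (hL : LastColNeg hd n M) (k : Fin d) {t : ℝ} (ht : 0 ≤ t) (α : Fin m) (θ : Euc d) :
    ∑ l, ∑ β, liftB A n M k l α β θ t * liftD hd M l (fun a b => VV n Z φ a b β) θ t = ∑ i, M i k * wr n (yZ A Z) (α, i) θ t := by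
  simp only [VV_liftD H hd hM hL _ ht, H3]
  unfold liftB
  rw [Finset.sum_comm]
  have key : ∀ β, ∑ l, (∑ i, ∑ j, M i k * astar A i j α β (θ - t • n) * M j l) * ∑ j, M j l * wr n Z (β, j) θ t
      = ∑ i, ∑ j, M i k * (astar A i j α β (θ - t • n) * wr n Z (β, j) θ t) := fun β => by
    have s1 : ∀ l, (∑ i, ∑ j, M i k * astar A i j α β (θ - t • n) * M j l) * ∑ j, M j l * wr n Z (β, j) θ t
      = ∑ i, ∑ j, ∑ j', M i k * astar A i j α β (θ - t • n) * wr n Z (β, j') θ t * (M j l * M j' l) := fun l => by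
      rw [Finset.sum_mul]
      refine Finset.sum_congr rfl fun i _ => ?_
      rw [Finset.sum_mul]
      refine Finset.sum_congr rfl fun j _ => ?_
      rw [Finset.mul_sum]
      exact Finset.sum_congr rfl fun j' _ => by ring
    simp only [s1]
    rw [Finset.sum_comm]
    refine Finset.sum_congr rfl fun i _ => ?_
    rw [Finset.sum_comm]
    refine Finset.sum_congr rfl fun j _ => ?_
    rw [Finset.sum_comm]
    simp only [← Finset.mul_sum, ortho_rows hM]
    simp [mul_assoc]
  simp only [key]
  rw [Finset.sum_comm]
  refine Finset.sum_congr rfl fun i _ => ?_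
  rw [Finset.sum_comm, Finset.mul_sum]
  refine Finset.sum_congr rfl fun j _ => ?_
  rw [Finset.mul_sum]

lemma VV_eqn (H : Hyp A n Z φ) (hd : 0 < d) {M : Fin d → Fin d → ℝ} (hM : IsOrtho M) (hL : LastColNeg hd n M) {t : ℝ} (ht : 0 < t) (α : Fin m) (θ : Euc d) : liftOp hd A n M (VV n Z φ) α θ t = 0 := by
  have hY : Scl (Js 1) (yZ A Z) := yZ_scl H.hZ
  have key : ∀ k, liftD hd M k (fun a b => ∑ l, ∑ β, liftB A n M k l α β a b * liftD hd M l (fun a' b' => VV n Z φ a' b' β) a b) θ t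
     = (∑ i', ∑ i, wr n (vZ (ei i') (yZ A Z)) (α, i) θ t * (M i' k * M i k))
       - if k = lastIdx d hd then ∑ i, wr n (vZ (ei i) (yZ A Z)) (α, i) θ t else 0 := fun k => by
    unfold liftD
    split_ifs with hk
    · have hev : (fun b => ∑ l, ∑ β, liftB A n M k l α β θ b * liftD hd M l (fun a' b' => VV n Z φ a' b' β) θ b) =ᶠ[𝓝 t]
          fun b => ∑ i, M i k * wr n (yZ A Z) (α, i) θ b := by
        filter_upwards [lt_mem_nhds ht] with b hb
        exact VV_flux H hd hM hL k hb.le α θ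
      have e := hev.deriv_eq
      unfold liftD at e
      rw [e]
      have hD : HasDerivAt (fun b => ∑ i, M i k * wr n (yZ A Z) (α, i) θ b) (∑ i, M i k * wr n (dZ n (yZ A Z)) (α, i) θ t) t :=
        HasDerivAt.fun_sum fun i _ => (wr_dt hY n (α, i) θ t).const_mul (M i k)
      rw [hD.deriv]
      simp only [hk, hL _, dZ_sub, vZ_sum n n]
      rw [← H.h2 t ht.le, Finset.sum_comm (f := fun i' i => wr n (vZ (ei i') (yZ A Z)) (α, i) θ t * (-n i' * -n i)), ← Finset.sum_sub_distrib]
      refine Finset.sum_congr rfl fun i _ => ?_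
      rw [mul_sub, Finset.mul_sum, sub_eq_neg_add, sub_eq_add_neg, ← Finset.sum_neg_distrib]
      congr 1
      · exact Finset.sum_congr rfl fun _ _ => by ring
      · ring
    · rw [sub_zero]
      have e : (fun a => ∑ l, ∑ β, liftB A n M k l α β a t * liftD hd M l (fun a' b' => VV n Z φ a' b' β) a t) =
          fun a => ∑ i, M i k * wr n (yZ A Z) (α, i) a t := funext fun a => VV_flux H hd hM hL k ht.le α a
      unfold liftD at e
      rw [e]
      refine Finset.sum_congr rfl fun i' _ => ?_
      rw [pder_sum Finset.univ (fun i => M i k) (fun i θ => wr n (yZ A Z) (α, i) θ t) (fun i => wr_diff hY n _ t), Finset.mul_sum]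
      exact Finset.sum_congr rfl fun i _ => by rw [wr_pder hY]; ring
  unfold liftOp
  simp only [key, Finset.sum_sub_distrib]
  rw [Finset.sum_ite_eq', if_pos (Finset.mem_univ _), sub_eq_zero, Finset.sum_comm]
  refine Finset.sum_congr rfl fun i' _ => ?_
  rw [Finset.sum_comm]
  simp only [← Finset.mul_sum, ortho_rows hM]
  simp

lemma VV_sol (H : Hyp A n Z φ) (hd : 0 < d) {M : Fin d → Fin d → ℝ} (hM : IsOrtho M) (hL : LastColNeg hd n M) (hp : ∀ (θ : Euc d) (z : Fin d → ℤ), φ (θ + zvec z) = φ θ) : IsLiftedDirSol hd A n M φ (VV n Z φ) where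
  smooth := VV_smooth H.hZ H.hφ
  periodic := VV_per hp
  eqn θ t ht α := VV_eqn H hd hM hL ht α θ
  bc := VV_zero
end Vsec
end

section
open MeasureTheory
open scoped BigOperators Topology RealInnerProductSpace
set_option linter.all false
set_option linter.deprecated false
open CS

section est
variable {d m : ℕ}

/-- iterated partial derivatives -/
def pm (l : List (Fin d)) (g : Euc d → ℝ) : Euc d → ℝ := l.foldr pder g
lemma pder_smooth {g : Euc d → ℝ} (hg : ContDiff ℝ (⊤ : ℕ∞) g) (i : Fin d) : ContDiff ℝ (⊤ : ℕ∞) (pder i g) := by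
  unfold pder
  exact (hg.fderiv_right (m := ((⊤ : ℕ∞) : WithTop ℕ∞)) (by exact_mod_cast le_top)).clm_apply contDiff_const
lemma pm_smooth {g : Euc d → ℝ} (hg : ContDiff ℝ (⊤ : ℕ∞) g) (l : List (Fin d)) : ContDiff ℝ (⊤ : ℕ∞) (pm l g) := by
  induction l with
  | nil => exact hg
  | cons a l ih => exact pder_smooth ih a
lemma pder_comm {g : Euc d → ℝ} (hg : ContDiff ℝ (⊤ : ℕ∞) g) (i j : Fin d) : pder i (pder j g) = pder j (pder i g) := by
  funext x
  have hs : IsSymmSndFDerivAt ℝ g x := (hg.contDiffAt).isSymmSndFDerivAt (by simp only [minSmoothness_of_isRCLikeNormedField]; exact WithTop.coe_le_coe.2 (le_top : (2:ℕ∞) ≤ ⊤))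
  have h1 : ContDiff ℝ (⊤ : ℕ∞) (fderiv ℝ g) := hg.fderiv_right (m := ((⊤ : ℕ∞) : WithTop ℕ∞)) (by exact_mod_cast le_top)
  have h2 : ∀ i j, pder i (pder j g) x = fderiv ℝ (fderiv ℝ g) x (EuclideanSpace.single i 1) (EuclideanSpace.single j 1) := fun i j => by
    have hd := (h1.differentiable (by simp) x).hasFDerivAt
    have h3 : HasFDerivAt (pder j g) _ x := hd.clm_apply (hasFDerivAt_const (EuclideanSpace.single j (1:ℝ)) x)
    show fderiv ℝ (pder j g) x _ = _
    rw [h3.fderiv]; simp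
  rw [h2, h2, hs.eq]
lemma pm_comm {g : Euc d → ℝ} (hg : ContDiff ℝ (⊤ : ℕ∞) g) (i : Fin d) (l : List (Fin d)) : pder i (pm l g) = pm l (pder i g) := by
  induction l with
  | nil => rfl
  | cons a l ih =>
    show pder i (pder a (pm l g)) = pder a (pm l (pder i g))
    rw [pder_comm (pm_smooth hg l), ih]
lemma pm_sum {ι : Type*} (s : Finset ι) (c : ι → ℝ) (f : ι → Euc d → ℝ) (hf : ∀ i, ContDiff ℝ (⊤ : ℕ∞) (f i)) (l : List (Fin d)) :
    pm l (fun θ => ∑ j ∈ s, c j * f j θ) = fun θ => ∑ j ∈ s, c j * pm l (f j) θ := by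
  induction l with
  | nil => rfl
  | cons a l ih =>
    show pder a (pm l (fun θ => ∑ j ∈ s, c j * f j θ)) = _
    rw [ih]
    funext θ
    exact pder_sum s c (fun j => pm l (f j)) (fun j => pm_smooth (hf j) l) a θ
lemma dthMulti_pm (l : List (Fin d)) (f : Euc d → ℝ → ℝ) (t : ℝ) : (fun θ => dthMulti l f θ t) = pm l (fun θ => f θ t) := by
  induction l with
  | nil => rfl
  | cons a l ih =>
    show (fun θ => pder a (fun x => dthMulti l f x t) θ) = pder a (pm l (fun θ => f θ t))
    rw [ih]
variable {n : Euc d} {Z : Scale d (F1 m d)} {φ : Euc d → Fin m → ℝ}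
lemma fold_scl {Z : Scale d (F1 m d)} (hZ : Scl (Js 1) Z) (l : List (Fin d)) : Scl (Js 1) (l.foldr (fun i Z => vZ (ei i) Z) Z) := by
  induction l with
  | nil => exact hZ
  | cons a l ih => exact vZ_scl ih _
lemma pm_wr (hZ : Scl (Js 1) Z) (p) (t : ℝ) (l : List (Fin d)) : pm l (fun θ => wr n Z p θ t) = fun θ => wr n (l.foldr (fun i Z => vZ (ei i) Z) Z) p θ t := by
  induction l with
  | nil => rfl
  | cons a l ih =>
    show pder a (pm l (fun θ => wr n Z p θ t)) = _
    rw [ih]; funext θ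
    exact wr_pder (fold_scl hZ l) n p t a θ
lemma pder_cmul (c : ℝ) {f : Euc d → ℝ} (hf : ContDiff ℝ (⊤ : ℕ∞) f) (i : Fin d) (θ) : pder i (fun θ => c * f θ) θ = c * pder i f θ := by
  have := pder_sum (Finset.univ : Finset Unit) (fun _ => c) (fun _ => f) (fun _ => hf) i θ
  simpa using this
lemma pm_wW (hZ : Scl (Js 1) Z) (c : ℝ) (β) (t : ℝ) (l : List (Fin d)) :
    pm l (fun θ => c * wW n Z β θ t) = fun θ => c * wW n (l.foldr (fun i Z => vZ (ei i) Z) Z) β θ t := by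
  induction l with
  | nil => rfl
  | cons a l ih =>
    show pder a (pm l (fun θ => c * wW n Z β θ t)) = _
    rw [ih]; funext θ
    rw [pder_cmul c (wW_diff (fold_scl hZ l) n β t), wW_pder (fold_scl hZ l)]; rfl
lemma dt_wW (c : ℝ) (β) (θ : Euc d) (j : ℕ) : ∀ {Z : Scale d (F1 m d)} (hZ : Scl (Js 1) Z), 
    deriv^[j] (fun t => c * wW n Z β θ t) = fun t => c * wW n ((dZ n)^[j] Z) β θ t := by
  induction j with
  | zero => intro Z hZ; rfl
  | succ j ih =>
    intro Z hZ
    rw [Function.iterate_succ_apply, Function.iterate_succ_apply, ← ih (dZ_scl hZ n)]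
    congr 1
    funext t
    exact ((wW_dt hZ n β θ t).const_mul c).deriv
lemma dtj_VV (hZ : Scl (Js 1) Z) (β) (j : ℕ) : dtj (j + 1) (fun a b => VV n Z φ a b β) = fun θ t => (-1) * wW n ((dZ n)^[j] Z) β θ t := by
  funext θ t
  unfold dtj
  rw [Function.iterate_succ_apply]
  have h2 := congrFun (dt_wW (n := n) (-1) β θ j hZ) t
  simp only at h2 ⊢
  rw [← h2]
  have : deriv (fun b => VV n Z φ θ b β) = fun t => (-1) * wW n Z β θ t := by
    funext t
    rw [(VV_dt hZ β θ t).deriv]; ring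
  rw [this]
lemma mult_VV (hZ : Scl (Js 1) Z) (β) (l : List (Fin d)) (j : ℕ) (t : ℝ) :
    (fun θ => dthMulti l (dtj (j + 1) (fun a b => VV n Z φ a b β)) θ t) = fun θ => (-1) * wW n (mZ n l j Z) β θ t := by
  rw [dthMulti_pm, dtj_VV hZ, pm_wW (dZ_it hZ n j)]; rfl

/-- the scales controlling the estimate -/
def zq (n : Euc d) (l : List (Fin d)) (j : ℕ) (Z : Scale d (F1 m d)) : Option (Fin d) → Scale d (F1 m d)
  | none => mZ n l j Z
  | some i => match j with
    | 0 => mZ n l 0 Z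
    | j + 1 => mZ n (i :: l) j Z
lemma zq_scl (hZ : Scl (Js 1) Z) (l : List (Fin d)) (j : ℕ) (q) : Scl (Js 1) (zq n l j Z q) := by
  rcases q with _ | i
  · exact mZ_scl hZ n l j
  · rcases j with _ | j
    · exact mZ_scl hZ n l 0
    · exact mZ_scl hZ n (i :: l) j
lemma zq_bd {K : ℕ → ℕ → ℝ} (hK : ∀ s i, 0 ≤ K s i) (hn : ‖n‖ ≤ 1) (hZ : Scl (Js 1) Z) (h : Bn K 0 Z Z) (l : List (Fin d)) (j : ℕ) (q) (t : ℝ) (ht : 0 ≤ t) :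
    ‖zq n l j Z q 0 0 t‖ ≤ ((Kd d)^[l.length + j] K) 0 0 * ‖Z (l.length + j) 0 t‖ := by
  rcases q with _ | i
  · have := (mZ_spec hK hn hZ h l j).2.1 0 0 t ht
    rw [zero_add, zero_add] at this; exact this
  · rcases j with _ | j
    · have := (mZ_spec hK hn hZ h l 0).2.1 0 0 t ht
      rw [zero_add, zero_add] at this; exact this
    · have := (mZ_spec hK hn hZ h (i :: l) j).2.1 0 0 t ht
      have e : (i :: l).length + j = l.length + (j + 1) := by simp; omega
      rw [e] at this
      rw [zero_add, zero_add] at this; exact this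

lemma wr_sq (p) (θ : Euc d) (t : ℝ) : (wr n Z p θ t) ^ 2 ≤ ‖wz n Z θ t‖ ^ 2 := by
  have := rc_le p (wz n Z θ t)
  exact sq_le_sq' (by have := abs_le.1 this; exact this.1) (abs_le.1 this).2
lemma csum {ι : Type*} [Fintype ι] (c x : ι → ℝ) (hc : ∀ i, (c i) ^ 2 ≤ 1) : (∑ i, c i * x i) ^ 2 ≤ (Fintype.card ι) * ∑ i, (x i) ^ 2 := by
  have h := sq_sum_le_card_mul_sum_sq (s := (Finset.univ : Finset ι)) (f := fun i => c i * x i)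
  refine h.trans ?_
  rw [Finset.card_univ]
  refine mul_le_mul_of_nonneg_left (Finset.sum_le_sum fun i _ => ?_) (Nat.cast_nonneg _)
  rw [mul_pow]
  nlinarith [hc i, sq_nonneg (x i)]
lemma wW_sq (hn : ∑ i, n i ^ 2 = 1) (β) (θ : Euc d) (t : ℝ) : (wW n Z β θ t) ^ 2 ≤ (d:ℝ) ^ 2 * ‖wz n Z θ t‖ ^ 2 := by
  have h := csum (fun i => n i) (fun i => wr n Z (β, i) θ t) (fun i => by
    rw [← hn]; exact Finset.single_le_sum (f := fun i => n i ^ 2) (fun j _ => sq_nonneg _) (Finset.mem_univ i))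
  refine h.trans ?_
  rw [Fintype.card_fin]
  have h2 : ∑ i : Fin d, wr n Z (β, i) θ t ^ 2 ≤ ∑ i : Fin d, ‖wz n Z θ t‖ ^ 2 := Finset.sum_le_sum fun i _ => wr_sq _ _ _
  rw [Finset.sum_const, Finset.card_univ, Fintype.card_fin, nsmul_eq_mul] at h2
  calc _ ≤ (d:ℝ) * (d * ‖wz n Z θ t‖ ^ 2) := mul_le_mul_of_nonneg_left h2 (Nat.cast_nonneg _)
    _ = _ := by ring
variable {A : Coeffs d m}
lemma tan_sq (H : Hyp A n Z φ) (hd : 0 < d) {M : Fin d → Fin d → ℝ} (hM : IsOrtho M) (hL : LastColNeg hd n M) {k : Fin d} (hk : k ≠ lastIdx d hd)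
    (l : List (Fin d)) (j : ℕ) (β : Fin m) (θ : Euc d) {t : ℝ} (ht : 0 ≤ t) :
    (liftD hd M k (dthMulti l (dtj j fun a b => VV n Z φ a b β)) θ t) ^ 2 ≤ (d:ℝ) ^ 3 * ∑ i, ‖wz n (zq n l j Z (some i)) θ t‖ ^ 2 := by
  have hMk : ∀ i, (M i k) ^ 2 ≤ 1 := fun i => by
    have := hM k k
    rw [if_pos rfl] at this
    rw [← this, pow_two]
    exact Finset.single_le_sum (f := fun i => M i k * M i k) (fun j _ => mul_self_nonneg _) (Finset.mem_univ i)
  have hd1 : (1:ℝ) ≤ d := by exact_mod_cast hd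
  unfold liftD
  rw [if_neg hk]
  rcases j with _ | j
  · have e1 : (fun θ => dthMulti l (dtj 0 fun a b => VV n Z φ a b β) θ t) = pm l (fun θ => VV n Z φ θ t β) := dthMulti_pm l _ t
    have hs : ContDiff ℝ (⊤ : ℕ∞) (fun θ => VV n Z φ θ t β) :=
      (VV_smooth1 (n := n) H.hZ H.hφ β).comp (f := fun θ : Euc d => (θ, t)) (by fun_prop)
    have e2 : ∑ i, M i k * pder i (pm l (fun θ => VV n Z φ θ t β)) θ = ∑ i, M i k * wr n (mZ n l 0 Z) (β, i) θ t := by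
      have e3 := congrFun (pm_sum Finset.univ (fun i => M i k) (fun i => pder i (fun θ => VV n Z φ θ t β)) (fun i => pder_smooth hs i) l) θ
      have e4 : (fun θ => ∑ i, M i k * pder i (fun θ => VV n Z φ θ t β) θ) = fun θ => ∑ i, M i k * wr n Z (β, i) θ t :=
        funext fun θ => VV_tanM H hd hM hL hk ht β θ
      rw [e4, pm_sum Finset.univ (fun i => M i k) (fun i θ => wr n Z (β, i) θ t) (fun i => wr_diff H.hZ n _ t)] at e3
      simp only [pm_wr H.hZ] at e3
      simp only [pm_comm hs]
      exact e3.symm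
    rw [e1, e2]
    refine (csum _ _ hMk).trans ?_
    rw [Fintype.card_fin]
    have h2 : ∑ i : Fin d, wr n (mZ n l 0 Z) (β, i) θ t ^ 2 ≤ ∑ i : Fin d, ‖wz n (zq n l 0 Z (some i)) θ t‖ ^ 2 := Finset.sum_le_sum fun i _ => wr_sq _ _ _
    refine mul_le_mul ?_ h2 (Finset.sum_nonneg fun _ _ => sq_nonneg _) (by positivity)
    nlinarith [mul_self_nonneg ((d:ℝ) - 1), mul_nonneg (sub_nonneg.2 hd1) (sub_nonneg.2 hd1), pow_le_pow_right₀ hd1 (show 1 ≤ 3 by norm_num)]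
  · rw [mult_VV H.hZ]
    have e : ∀ i, pder i (fun θ => (-1) * wW n (mZ n l j Z) β θ t) θ = (-1) * wW n (mZ n (i :: l) j Z) β θ t := fun i => by
      rw [pder_cmul _ (wW_diff (mZ_scl H.hZ n l j) n β t), wW_pder (mZ_scl H.hZ n l j)]; rfl
    simp only [e]
    refine (csum _ _ hMk).trans ?_
    rw [Fintype.card_fin]
    have h2 : ∑ i : Fin d, ((-1) * wW n (mZ n (i :: l) j Z) β θ t) ^ 2 ≤ ∑ i : Fin d, (d:ℝ) ^ 2 * ‖wz n (zq n l (j + 1) Z (some i)) θ t‖ ^ 2 :=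
      Finset.sum_le_sum fun i _ => by
        have := wW_sq (Z := mZ n (i :: l) j Z) H.hn β θ t
        rw [neg_one_mul, neg_sq]; exact this
    rw [← Finset.mul_sum] at h2
    calc _ ≤ (d:ℝ) * ((d:ℝ) ^ 2 * ∑ i : Fin d, ‖wz n (zq n l (j + 1) Z (some i)) θ t‖ ^ 2) := mul_le_mul_of_nonneg_left h2 (Nat.cast_nonneg _)
      _ = _ := by ring
def cst (d m : ℕ) : ℝ := m * d * (d:ℝ) ^ 3 + m * (d:ℝ) ^ 2
lemma cst_nonneg (d m : ℕ) : 0 ≤ cst d m := by unfold cst; positivity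
lemma pt_bd (H : Hyp A n Z φ) (hd : 0 < d) {M : Fin d → Fin d → ℝ} (hM : IsOrtho M) (hL : LastColNeg hd n M)
    (l : List (Fin d)) (j : ℕ) (θ : Euc d) {t : ℝ} (ht : 0 ≤ t) :
    ((∑ α, ∑ k ∈ tanIdx d hd, (liftD hd M k (dthMulti l (dtj j fun a b => VV n Z φ a b α)) θ t) ^ 2)
                + ∑ α, (dthMulti l (dtj (j + 1) fun a b => VV n Z φ a b α) θ t) ^ 2) ≤ cst d m * ∑ q, ‖wz n (zq n l j Z q) θ t‖ ^ 2 := by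
  rw [Fintype.sum_option]
  set S0 := ‖wz n (zq n l j Z none) θ t‖ ^ 2
  set S := ∑ i, ‖wz n (zq n l j Z (some i)) θ t‖ ^ 2
  have hS0 : 0 ≤ S0 := sq_nonneg _
  have hS : 0 ≤ S := Finset.sum_nonneg fun _ _ => sq_nonneg _
  have h1 : ∀ α : Fin m, ∑ k ∈ tanIdx d hd, (liftD hd M k (dthMulti l (dtj j fun a b => VV n Z φ a b α)) θ t) ^ 2 ≤ d * ((d:ℝ) ^ 3 * S) := fun α => by
    have ht : ∀ k ∈ tanIdx d hd, (liftD hd M k (dthMulti l (dtj j fun a b => VV n Z φ a b α)) θ t) ^ 2 ≤ (d:ℝ) ^ 3 * S := fun k hk => by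
      have hk' : k ≠ lastIdx d hd := (Finset.mem_filter.1 hk).2
      exact tan_sq H hd hM hL hk' l j α θ ht
    refine (Finset.sum_le_card_nsmul _ _ _ ht).trans ?_
    rw [nsmul_eq_mul]
    refine mul_le_mul_of_nonneg_right ?_ (mul_nonneg (pow_nonneg (Nat.cast_nonneg d) 3) hS)
    have := Finset.card_le_univ (tanIdx d hd)
    rw [Fintype.card_fin] at this
    exact_mod_cast this
  have h2 : ∀ α : Fin m, (dthMulti l (dtj (j + 1) fun a b => VV n Z φ a b α) θ t) ^ 2 ≤ (d:ℝ) ^ 2 * S0 := fun α => by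
    have := congrFun (mult_VV (n := n) (φ := φ) H.hZ α l j t) θ
    rw [this, neg_one_mul, neg_sq]
    exact wW_sq H.hn α θ t
  have h3 := Finset.sum_le_sum fun α (_ : α ∈ (Finset.univ : Finset (Fin m))) => h1 α
  have h4 := Finset.sum_le_sum fun α (_ : α ∈ (Finset.univ : Finset (Fin m))) => h2 α
  rw [Finset.sum_const, Finset.card_univ, Fintype.card_fin, nsmul_eq_mul] at h3 h4
  refine (add_le_add h3 h4).trans ?_
  clear_value S S0
  clear h1 h2 h3 h4
  unfold cst
  have h5 : 0 ≤ m * (d:ℝ) * (d:ℝ) ^ 3 * S0 := by positivity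
  have h6 : 0 ≤ m * (d:ℝ) ^ 2 * S := by positivity
  nlinarith
lemma inner_bd (H : Hyp A n Z φ) (hd : 0 < d) {M : Fin d → Fin d → ℝ} (hM : IsOrtho M) (hL : LastColNeg hd n M)
    {K : ℕ → ℕ → ℝ} (hK : ∀ s i, 0 ≤ K s i) (hB : Bn K 0 Z Z)
    (l : List (Fin d)) (j : ℕ) {t : ℝ} (ht : 0 ≤ t) :
    ∫ θ in unitCell d, ((∑ α, ∑ k ∈ tanIdx d hd, (liftD hd M k (dthMulti l (dtj j fun a b => VV n Z φ a b α)) θ t) ^ 2)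
                + ∑ α, (dthMulti l (dtj (j + 1) fun a b => VV n Z φ a b α) θ t) ^ 2) ≤
      cst d m * (d + 1) * (((Kd d)^[l.length + j] K) 0 0) ^ 2 * ‖Z (l.length + j) 0 t‖ ^ 2 := by
  have hn : ‖n‖ ≤ 1 := by
    rw [EuclideanSpace.norm_eq]
    simp only [Real.norm_eq_abs, sq_abs]
    rw [H.hn, Real.sqrt_one]
  have hc : ∀ q, Continuous fun θ => ‖wz n (zq n l j Z q) θ t‖ ^ 2 := fun q => ((wz_diff (zq_scl H.hZ l j q) n t).continuous.norm).pow 2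
  have hi : ∀ q, IntegrableOn (fun θ => ‖wz n (zq n l j Z q) θ t‖ ^ 2) (unitCell d) := fun q => cell_integrable (hc q)
  have h1 : ∫ θ in unitCell d, ((∑ α, ∑ k ∈ tanIdx d hd, (liftD hd M k (dthMulti l (dtj j fun a b => VV n Z φ a b α)) θ t) ^ 2)
                + ∑ α, (dthMulti l (dtj (j + 1) fun a b => VV n Z φ a b α) θ t) ^ 2) ≤ ∫ θ in unitCell d, cst d m * ∑ q, ‖wz n (zq n l j Z q) θ t‖ ^ 2 := by
    refine integral_mono_of_nonneg (Filter.Eventually.of_forall fun θ => ?_) ?_ (Filter.Eventually.of_forall fun θ => pt_bd H hd hM hL l j θ ht)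
    · exact add_nonneg (Finset.sum_nonneg fun _ _ => Finset.sum_nonneg fun _ _ => sq_nonneg _) (Finset.sum_nonneg fun _ _ => sq_nonneg _)
    · exact (integrable_finset_sum _ fun q _ => hi q).const_mul _
  refine h1.trans ?_
  rw [integral_const_mul, integral_finset_sum _ fun q _ => hi q]
  simp only [fun q => wz_norm (zq_scl (n := n) H.hZ l j q) n t]
  have h2 : ∑ q, ‖zq n l j Z q 0 0 t‖ ^ 2 ≤ ∑ q : Option (Fin d), (((Kd d)^[l.length + j] K) 0 0 * ‖Z (l.length + j) 0 t‖) ^ 2 :=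
    Finset.sum_le_sum fun q _ => pow_le_pow_left₀ (norm_nonneg _) (zq_bd hK hn H.hZ hB l j q t ht) 2
  rw [Finset.sum_const, Finset.card_univ, Fintype.card_option, Fintype.card_fin, nsmul_eq_mul] at h2
  calc _ ≤ cst d m * _ := mul_le_mul_of_nonneg_left h2 (cst_nonneg d m)
    _ = _ := by push_cast; ring
lemma outer_bd (H : Hyp A n Z φ) (hd : 0 < d) {M : Fin d → Fin d → ℝ} (hM : IsOrtho M) (hL : LastColNeg hd n M)
    {K : ℕ → ℕ → ℝ} (hK : ∀ s i, 0 ≤ K s i) (hB : Bn K 0 Z Z)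
    (l : List (Fin d)) (j : ℕ) {R : ℝ} (hm : MemLp (Z (l.length + j) 0) 2 mu) (hR : ∫ t, ‖Z (l.length + j) 0 t‖ ^ 2 ∂mu ≤ R) :
    ∫ t in Set.Ioi (0:ℝ), ∫ θ in unitCell d, ((∑ α, ∑ k ∈ tanIdx d hd, (liftD hd M k (dthMulti l (dtj j fun a b => VV n Z φ a b α)) θ t) ^ 2)
                + ∑ α, (dthMulti l (dtj (j + 1) fun a b => VV n Z φ a b α) θ t) ^ 2) ≤
      cst d m * (d + 1) * (((Kd d)^[l.length + j] K) 0 0) ^ 2 * R := by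
  have hcc : 0 ≤ cst d m * (d + 1) * (((Kd d)^[l.length + j] K) 0 0) ^ 2 := by have := cst_nonneg d m; positivity
  refine le_trans (integral_mono_of_nonneg (g := fun t => cst d m * (d + 1) * (((Kd d)^[l.length + j] K) 0 0) ^ 2 * ‖Z (l.length + j) 0 t‖ ^ 2)
    (Filter.Eventually.of_forall fun t => ?_) ?_ ?_) ?_
  · refine integral_nonneg fun θ => ?_
    exact add_nonneg (Finset.sum_nonneg fun _ _ => Finset.sum_nonneg fun _ _ => sq_nonneg _) (Finset.sum_nonneg fun _ _ => sq_nonneg _)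
  · have := (hm.integrable_norm_pow (by norm_num)).const_mul (cst d m * (d + 1) * (((Kd d)^[l.length + j] K) 0 0) ^ 2)
    simpa [mu] using this
  · refine (ae_restrict_iff' measurableSet_Ioi).2 (Filter.Eventually.of_forall fun t ht => ?_)
    exact inner_bd H hd hM hL hK hB l j (le_of_lt ht)
  · rw [integral_const_mul]
    exact mul_le_mul_of_nonneg_left hR hcc
end est
end

section
open MeasureTheory
open scoped BigOperators Topology RealInnerProductSpace
set_option linter.all false
set_option linter.deprecated false
open CS

section data
variable {d m : ℕ}

lemma ph_summable {f : Euc d → F0 m} (hf : Per f) (hc : ContDiff ℝ (⊤ : ℕ∞) f) (s : ℕ) :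
    Summable (fun k => ‖(wt k ^ s : ℝ) • fc f k‖ ^ 2) := by
  have h : Summable (fun k => ‖(wt k ^ s : ℝ) • fc f k‖) := by
    have := fc_summable s hf hc
    refine this.congr fun k => ?_
    rw [norm_smul, Real.norm_of_nonneg (pow_nonneg (wt_pos k).le s)]
  obtain ⟨C, hC⟩ := fc_decay s hf hc
  refine Summable.of_nonneg_of_le (fun k => sq_nonneg _) (fun k => ?_) (h.mul_left C)
  rw [pow_two]
  refine mul_le_mul_of_nonneg_right ?_ (norm_nonneg _)
  rw [norm_smul, Real.norm_of_nonneg (pow_nonneg (wt_pos k).le s)]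
  exact hC k

/-- Sobolev scale of a smooth periodic function -/
def Ph {f : Euc d → F0 m} (hf : Per f) (hc : ContDiff ℝ (⊤ : ℕ∞) f) (s : ℕ) : HS d (F0 m) :=
  HS.mk (fun k => (wt k ^ s : ℝ) • fc f k) (ph_summable hf hc s)
variable {f : Euc d → F0 m} (hf : Per f) (hc : ContDiff ℝ (⊤ : ℕ∞) f)
lemma Ph_apply (s : ℕ) (k) : Ph hf hc s k = (wt k ^ s : ℝ) • fc f k := rfl
lemma Js_Ph (s r : ℕ) : Js r (Ph hf hc (s + r)) = Ph hf hc s := by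
  ext1 k
  rw [Js_apply, Ph_apply, Ph_apply, wi, smul_smul]
  congr 1
  have := wt_ne k
  field_simp
  ring
lemma evo_Ph {σ : ℕ} (hσ : 2 * d ≤ σ) (y : Euc d) : evo σ y (Ph hf hc σ) = f y := by
  have h1 := evo_apply hσ y (Ph hf hc σ)
  have h2 := fourier_inv hf hc y
  refine h1.unique ?_
  have e : (fun k => wi σ k • cs (ek k y) (Ph hf hc σ k)) = fun k => ek k y • fc f k := by
    funext k
    rw [Ph_apply, map_smul, smul_smul, wi, inv_mul_cancel₀ (pow_ne_zero _ (wt_ne k)), one_smul]; rfl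
  rw [e]; exact h2
lemma Ph_zero_sq : ‖Ph hf hc 0‖ ^ 2 = ∫ y in unitCell d, ‖f y‖ ^ 2 := by
  have h1 := parseval_norm (σ := 2 * d) le_rfl (Ph hf hc (2 * d))
  have h2 := Js_Ph hf hc 0 (2 * d)
  rw [zero_add] at h2
  rw [h2] at h1
  rw [← h1]
  simp only [evo_Ph hf hc le_rfl]
lemma Ph_zero_le {C : ℝ} (hC : ∀ y, ‖f y‖ ≤ C) : ‖Ph hf hc 0‖ ^ 2 ≤ C ^ 2 := by
  rw [Ph_zero_sq]
  have hi : IntegrableOn (fun y => ‖f y‖ ^ 2) (unitCell d) := cell_integrable ((hc.continuous.norm).pow 2)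
  calc ∫ y in unitCell d, ‖f y‖ ^ 2 ≤ ∫ y in unitCell d, C ^ 2 :=
        integral_mono hi (integrable_const _) fun y => pow_le_pow_left₀ (norm_nonneg _) (hC y) 2
    _ = C ^ 2 := by simp
lemma pdit_per (hf : Per f) (j : Fin d) (s : ℕ) : Per ((pd j)^[s] f) := by
  induction s with
  | zero => exact hf
  | succ s ih => rw [Function.iterate_succ_apply']; exact ih.pd j
lemma pdit_smooth (hc : ContDiff ℝ (⊤ : ℕ∞) f) (j : Fin d) (s : ℕ) : ContDiff ℝ (⊤ : ℕ∞) ((pd j)^[s] f) := by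
  induction s with
  | zero => exact hc
  | succ s ih => rw [Function.iterate_succ_apply']; exact pd_smooth ih j
lemma fc_pdit (hf : Per f) (hc : ContDiff ℝ (⊤ : ℕ∞) f) (j : Fin d) (s : ℕ) (k) : ‖fc ((pd j)^[s] f) k‖ = (2 * Real.pi * |(k j : ℝ)|) ^ s * ‖fc f k‖ := by
  induction s with
  | zero => simp
  | succ s ih =>
    rw [Function.iterate_succ_apply', fc_pd (pdit_per hf j s) ((pdit_smooth hc j s).of_le (by exact_mod_cast le_top)), norm_smul, ih, pow_succ]
    have : ‖(2 * Real.pi * (k j : ℝ) * Complex.I : ℂ)‖ = 2 * Real.pi * |(k j : ℝ)| := by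
      rw [norm_mul, norm_mul, norm_mul, Complex.norm_I, Complex.norm_real, Complex.norm_real, Real.norm_of_nonneg Real.pi_pos.le]
      simp
    rw [this]; ring
lemma wt_le (k : Fin d → ℤ) (s : ℕ) : (wt k ^ s) ^ 2 ≤ 4 ^ s * (1 + ∑ j, ((2 * Real.pi * |(k j : ℝ)|) ^ s) ^ 2) := by
  have hpi := Real.pi_gt_three
  have hnn : ∀ j, 0 ≤ ((2 * Real.pi * |(k j : ℝ)|) ^ s) ^ 2 := fun j => sq_nonneg _
  have e4 : (4:ℝ) ^ s = (2 ^ s) ^ 2 := by rw [← pow_mul, mul_comm, pow_mul]; norm_num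
  by_cases h : ‖k‖ ≤ 1
  · have h1 : wt k ≤ 2 := by unfold wt; linarith
    have h2 : (wt k ^ s) ^ 2 ≤ 4 ^ s := by
      rw [e4]; exact pow_le_pow_left₀ (pow_nonneg (wt_pos k).le _) (pow_le_pow_left₀ (wt_pos k).le h1 s) 2
    have h3 := Finset.sum_nonneg fun j (_ : j ∈ Finset.univ) => hnn j
    have h4 : (0:ℝ) ≤ 4 ^ s := by positivity
    nlinarith
  · rw [not_le] at h
    have hne : (Finset.univ : Finset (Fin d)).Nonempty := by
      by_contra h0
      rw [Finset.not_nonempty_iff_eq_empty, Finset.univ_eq_empty_iff] at h0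
      have : k = 0 := Subsingleton.elim _ _
      rw [this, norm_zero] at h; linarith
    obtain ⟨j, hj⟩ : ∃ j, ‖k‖ ≤ |(k j : ℝ)| := by
      by_contra hcon
      have hall : ∀ j, ‖k j‖ < ‖k‖ := fun j => by
        by_contra h1
        exact hcon ⟨j, by rw [not_lt] at h1; rwa [Int.norm_eq_abs] at h1⟩
      have := (pi_norm_lt_iff (x := k) (r := ‖k‖) (by linarith)).2 hall
      exact lt_irrefl _ this
    have h1 : wt k ≤ 2 * (2 * Real.pi * |(k j : ℝ)|) := by
      unfold wt
      have : 0 ≤ |(k j : ℝ)| := abs_nonneg _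
      nlinarith
    have h2 : (wt k ^ s) ^ 2 ≤ 4 ^ s * ((2 * Real.pi * |(k j : ℝ)|) ^ s) ^ 2 := by
      rw [e4, ← mul_pow, ← mul_pow]
      exact pow_le_pow_left₀ (pow_nonneg (wt_pos k).le _) (pow_le_pow_left₀ (wt_pos k).le h1 s) 2
    refine h2.trans (mul_le_mul_of_nonneg_left ?_ (by positivity))
    have := Finset.single_le_sum (f := fun j => ((2 * Real.pi * |(k j : ℝ)|) ^ s) ^ 2) (fun j _ => hnn j) (Finset.mem_univ j)
    linarith
lemma Ph_le (s : ℕ) {C : ℝ} (h0 : ∀ y, ‖f y‖ ≤ C) (hs : ∀ j y, ‖(pd j)^[s] f y‖ ≤ C) : ‖Ph hf hc s‖ ^ 2 ≤ 4 ^ s * (1 + d) * C ^ 2 := by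
  have hP : ∀ j, ‖Ph (pdit_per hf j s) (pdit_smooth hc j s) 0‖ ^ 2 ≤ C ^ 2 := fun j => Ph_zero_le _ _ (hs j)
  have hP0 := Ph_zero_le hf hc h0
  have hsum0 := ph_summable hf hc 0
  have hsumj := fun j => ph_summable (pdit_per hf j s) (pdit_smooth hc j s) 0
  have key : ‖Ph hf hc s‖ ^ 2 ≤ 4 ^ s * (‖Ph hf hc 0‖ ^ 2 + ∑ j, ‖Ph (pdit_per hf j s) (pdit_smooth hc j s) 0‖ ^ 2) := by
    simp only [HS.norm_sq, Ph_apply]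
    rw [← Summable.tsum_finsetSum fun j _ => hsumj j, ← hsum0.tsum_add (summable_sum fun j _ => hsumj j), ← tsum_mul_left]
    refine (ph_summable hf hc s).tsum_le_tsum (fun k => ?_) ((hsum0.add (summable_sum fun j _ => hsumj j)).mul_left _)
    simp only [pow_zero, one_smul, fc_pdit hf hc]
    rw [norm_smul, Real.norm_of_nonneg (pow_nonneg (wt_pos k).le s), mul_pow]
    have h1 := mul_le_mul_of_nonneg_right (wt_le k s) (sq_nonneg ‖fc f k‖)
    refine h1.trans (le_of_eq ?_)
    simp only [mul_pow _ ‖fc f k‖]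
    rw [← Finset.sum_mul]
    ring
  refine key.trans ?_
  have h2 := Finset.sum_le_sum fun j (_ : j ∈ (Finset.univ : Finset (Fin d))) => hP j
  rw [Finset.sum_const, Finset.card_univ, Fintype.card_fin, nsmul_eq_mul] at h2
  have h4 : (0:ℝ) ≤ 4 ^ s := by positivity
  calc _ ≤ (4:ℝ) ^ s * (C ^ 2 + d * C ^ 2) := mul_le_mul_of_nonneg_left (add_le_add hP0 h2) h4
    _ = _ := by ring

/-- complexification of the data -/
def ofR (m : ℕ) : (Fin m → ℝ) →L[ℝ] F0 m :=
  LinearMap.toContinuousLinearMap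
    { toFun := fun x => WithLp.toLp 2 fun α => ((x α : ℝ) : ℂ)
      map_add' := fun x y => by ext α; simp
      map_smul' := fun c x => by ext α; simp }
lemma ofR_apply (x : Fin m → ℝ) (α) : ofR m x α = ((x α : ℝ) : ℂ) := rfl
lemma rc_ofR (x : Fin m → ℝ) (α) : rc α (ofR m x) = x α := by rw [rc_apply, ofR_apply, Complex.ofReal_re]

lemma pdit_iter {E : Type*} [NormedAddCommGroup E] [NormedSpace ℝ E] {g : Euc d → E} (hg : ContDiff ℝ (⊤ : ℕ∞) g) (j : Fin d) (s : ℕ) :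
    (pd j)^[s] g = fun y => iteratedFDeriv ℝ s g y (fun _ => EuclideanSpace.single j 1) := by
  induction s with
  | zero => funext y; simp
  | succ s ih =>
    rw [Function.iterate_succ_apply', ih]
    funext y
    rw [iteratedFDeriv_succ_apply_left]
    have hd : DifferentiableAt ℝ (iteratedFDeriv ℝ s g) y := (hg.differentiable_iteratedFDeriv (by exact_mod_cast WithTop.coe_lt_top s)) y
    have h2 := HasFDerivAt.comp (g := fun T : ContinuousMultilinearMap ℝ (fun _ : Fin s => Euc d) E => T (fun _ => EuclideanSpace.single j 1))
      (f := fun y => iteratedFDeriv ℝ s g y) y (ContinuousMultilinearMap.apply ℝ (fun _ : Fin s => Euc d) E (fun _ => EuclideanSpace.single j 1)).hasFDerivAt hd.hasFDerivAt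
    show fderiv ℝ ((fun T : ContinuousMultilinearMap ℝ (fun _ : Fin s => Euc d) E => T (fun _ => EuclideanSpace.single j 1)) ∘ fun y => iteratedFDeriv ℝ s g y) y _ = _
    rw [h2.fderiv]; rfl
variable {φ : Euc d → Fin m → ℝ}
lemma iter_bdd (hφ : ContDiff ℝ (⊤ : ℕ∞) φ) (hp : Per φ) (s : ℕ) : BddAbove (Set.range fun x => ‖iteratedFDeriv ℝ s φ x‖) := by
  have hper : Per (iteratedFDeriv ℝ s φ) := fun y z => by
    have : (fun x => φ (x + zvec z)) = φ := funext fun x => hp x z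
    rw [← iteratedFDeriv_comp_add_right, this]
  obtain ⟨C, hC⟩ := hper.bdd (hφ.continuous_iteratedFDeriv (by exact_mod_cast le_top))
  exact ⟨C, by rintro _ ⟨x, rfl⟩; exact hC x⟩
lemma iter_le (hφ : ContDiff ℝ (⊤ : ℕ∞) φ) (hp : Per φ) {s k : ℕ} (hk : s ≤ k) (x) : ‖iteratedFDeriv ℝ s φ x‖ ≤ CkNorm k φ := by
  refine (le_ciSup (iter_bdd hφ hp s) x).trans ?_
  unfold CkNorm
  exact Finset.single_le_sum (f := fun j => ⨆ x : Euc d, ‖iteratedFDeriv ℝ j φ x‖) (fun j _ => Real.iSup_nonneg fun x => norm_nonneg _)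
    (Finset.mem_range.2 (by omega))
lemma Ck_nonneg (k : ℕ) (φ : Euc d → Fin m → ℝ) : 0 ≤ CkNorm k φ := Finset.sum_nonneg fun j _ => Real.iSup_nonneg fun x => norm_nonneg _
lemma phc_per (hp : Per φ) : Per (fun y => ofR m (φ y)) := fun y z => by
  have := hp y z
  simp only at this ⊢
  rw [this]
lemma phc_smooth (hφ : ContDiff ℝ (⊤ : ℕ∞) φ) : ContDiff ℝ (⊤ : ℕ∞) (fun y => ofR m (φ y)) := (ofR m).contDiff.comp hφ
lemma phc_le (hφ : ContDiff ℝ (⊤ : ℕ∞) φ) (hp : Per φ) {s k : ℕ} (hk : s ≤ k) (j : Fin d) (y) : ‖(pd j)^[s] (fun y => ofR m (φ y)) y‖ ≤ ‖ofR m‖ * CkNorm k φ := by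
  rw [pdit_iter (phc_smooth hφ)]
  refine (ContinuousMultilinearMap.le_opNorm _ _).trans ?_
  have h1 : ∏ i : Fin s, ‖(EuclideanSpace.single j (1:ℝ) : Euc d)‖ = 1 := by simp
  rw [h1, mul_one]
  have h2 := (ofR m).norm_iteratedFDeriv_comp_left (f := φ) (x := y) (n := s) hφ.contDiffAt (by exact_mod_cast le_top)
  exact h2.trans (mul_le_mul_of_nonneg_left (iter_le hφ hp hk y) (norm_nonneg _))
lemma Ph_bd (hφ : ContDiff ℝ (⊤ : ℕ∞) φ) (hp : Per φ) {s k : ℕ} (hk : s ≤ k) :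
    ‖Ph (phc_per hp) (phc_smooth hφ) s‖ ≤ 2 ^ s * (1 + d) * (‖ofR m‖ * CkNorm k φ) := by
  have h := Ph_le (phc_per hp) (phc_smooth hφ) s (C := ‖ofR m‖ * CkNorm k φ) (fun y => by
    refine ((ofR m).le_opNorm _).trans (mul_le_mul_of_nonneg_left ?_ (norm_nonneg _))
    have := iter_le hφ hp (Nat.zero_le k) y
    rwa [norm_iteratedFDeriv_zero] at this) (fun j y => phc_le hφ hp hk j y)
  have hC : 0 ≤ ‖ofR m‖ * CkNorm k φ := mul_nonneg (norm_nonneg _) (Ck_nonneg k φ)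
  generalize ‖ofR m‖ * CkNorm k φ = C at h hC ⊢
  have hpos : 0 ≤ 2 ^ s * (1 + (d:ℝ)) * C := mul_nonneg (by positivity) hC
  refine (abs_le_of_sq_le_sq' ?_ hpos).2
  refine h.trans ?_
  have e4 : (4:ℝ) ^ s = (2 ^ s) ^ 2 := by rw [← pow_mul, mul_comm, pow_mul]; norm_num
  rw [mul_pow, mul_pow, e4]
  have hd : (0:ℝ) ≤ d := Nat.cast_nonneg d
  have h1 : (1 + d : ℝ) ≤ (1 + d) ^ 2 := by nlinarith
  exact mul_le_mul_of_nonneg_right (mul_le_mul_of_nonneg_left h1 (sq_nonneg _)) (sq_nonneg _)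
end data
end

section
open MeasureTheory
open scoped BigOperators Topology RealInnerProductSpace
set_option linter.all false
set_option linter.deprecated false
open CS

/-- The product of the solution constants of order `N` -/
def cX (d m : ℕ) (A : Coeffs d m) (N : ℕ) : ℝ :=
  ((Kd d)^[N] (SC.kb (bd d) (BA A))) 0 0 * (SC.rb (bd d) (BA A) N * (2 * (2 ^ (N + 1) * (1 + d) * ‖ofR m‖)))

lemma final_arith {c K r S Y k X : ℝ} (hc : 0 ≤ c) (hS : 0 ≤ S) (hY : S ≤ Y * k) (hk : 0 ≤ k) (hX : X = K * (r * Y)) :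
    c * K ^ 2 * (r * S) ^ 2 ≤ ((1 + (c + 1) * |X|) * k) ^ 2 := by
  have h1 : S ^ 2 ≤ (Y * k) ^ 2 := pow_le_pow_left₀ hS hY 2
  have h2 : c * K ^ 2 * (r * S) ^ 2 ≤ c * (|X| * k) ^ 2 := by
    rw [mul_pow |X|, sq_abs, hX]
    have : c * K ^ 2 * (r * S) ^ 2 = c * K ^ 2 * r ^ 2 * S ^ 2 := by ring
    rw [this]
    refine (mul_le_mul_of_nonneg_left h1 (by positivity)).trans (le_of_eq (by ring))
  have h3 : c * (|X| * k) ^ 2 ≤ ((c + 1) * (|X| * k)) ^ 2 := by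
    rw [mul_pow (c + 1)]
    refine mul_le_mul_of_nonneg_right (by nlinarith) (sq_nonneg _)
  refine h2.trans (h3.trans (pow_le_pow_left₀ (by positivity) ?_ 2))
  nlinarith

theorem final_thm (d m : ℕ) (hd : 0 < d) (A : Coeffs d m) :
    ∃ C : ℕ → ℕ → ℝ, (∀ a j, 0 < C a j) ∧
      ∀ (n : Euc d), (∑ i, n i ^ 2 = 1) →
      ∀ M : Fin d → Fin d → ℝ, IsOrtho M → LastColNeg hd n M →
      ∀ φ : Euc d → Fin m → ℝ, ContDiff ℝ (⊤ : ℕ∞) φ →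
        (∀ (θ : Euc d) (z : Fin d → ℤ), φ (θ + zvec z) = φ θ) →
      ∃ V : Euc d → ℝ → Fin m → ℝ, IsLiftedDirSol hd A n M φ V ∧
        ∀ (l : List (Fin d)) (j : ℕ),
          (∫ t in Set.Ioi (0:ℝ), ∫ θ in unitCell d,
              ((∑ α, ∑ k ∈ tanIdx d hd,
                  (liftD hd M k (dthMulti l (dtj j fun a b => V a b α)) θ t) ^ 2)
                + ∑ α, (dthMulti l (dtj (j + 1) fun a b => V a b α) θ t) ^ 2))
            ≤ (C l.length j * CkNorm (l.length + j + 1) φ) ^ 2 := by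
  have hc0 : 0 ≤ cst d m * (d + 1) := mul_nonneg (cst_nonneg d m) (by positivity)
  refine ⟨fun a j => 1 + (cst d m * (d + 1) + 1) * |cX d m A (a + j)|, fun a j => ?_, ?_⟩
  · have := mul_nonneg (add_nonneg hc0 zero_le_one) (abs_nonneg (cX d m A (a + j)))
    linarith
  intro n hn M hM hL φ hφ hp
  obtain ⟨Z, hZ, z1, z2, z0, zk, zL, zR⟩ := (SCA A n hn).smooth_sol (fun s => Ph (phc_per hp) (phc_smooth hφ) s)
    (fun s => Js_Ph _ _ s 1)
  have H : Hyp A n Z φ := by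
    refine ⟨hn, hZ, hφ, fun θ β => H0 hn z0 hφ (fun y α => ?_) θ β, fun t ht => H1 hn (fun s => z1 s t ht), fun t ht => H2 hn (fun s => z2 s t ht)⟩
    rw [evo_Ph _ _ (by omega), rc_ofR]
  refine ⟨VV n Z φ, VV_sol H hd hM hL hp, fun l j => ?_⟩
  have hb := outer_bd H hd hM hL (K := SC.kb (bd d) (BA A)) (SCA A n hn).kb_nonneg (fun s i t ht => zk s i t ht) l j (zL _) (zR _)
  refine hb.trans ?_
  refine final_arith hc0 (by positivity) ?_ (Ck_nonneg _ φ) rfl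
  have b1 := Ph_bd hφ hp (s := l.length + j + 1) (k := l.length + j + 1) le_rfl
  have b2 := Ph_bd hφ hp (s := l.length + j) (k := l.length + j + 1) (by omega)
  have b3 : (2:ℝ) ^ (l.length + j) * (1 + d) * (‖ofR m‖ * CkNorm (l.length + j + 1) φ) ≤ 2 ^ (l.length + j + 1) * (1 + d) * (‖ofR m‖ * CkNorm (l.length + j + 1) φ) := by
    refine mul_le_mul_of_nonneg_right ?_ (mul_nonneg (norm_nonneg _) (Ck_nonneg _ φ))
    refine mul_le_mul_of_nonneg_right (pow_le_pow_right₀ (by norm_num) (by omega)) (by positivity)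
  refine (add_le_add b1 (b2.trans b3)).trans (le_of_eq (by ring))
end


/-- For any `n ∈ S^{d-1}` and smooth periodic data `φ`, the lifted Dirichlet
problem has a smooth solution `V` satisfying, for every multi-index (list) `l` and `j ≥ 0`,
the square-integral estimate `‖(Nᵀ∇_θ ∂_θ^l ∂_t^j V, ∂_θ^l ∂_t^{1+j} V)‖_{L²(𝕋^d×ℝ₊)} ≤
C ‖φ‖_{C^{|l|+j+1}(𝕋^d)}`, where `C = C(d,m,|l|,j,A)`. -/
theorem stmt3 (d m : ℕ) (hd : 0 < d) (A : Coeffs d m) :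
    ∃ C : ℕ → ℕ → ℝ, (∀ a j, 0 < C a j) ∧
      ∀ (n : Euc d), (∑ i, n i ^ 2 = 1) →
      ∀ M : Fin d → Fin d → ℝ, IsOrtho M → LastColNeg hd n M →
      ∀ φ : Euc d → Fin m → ℝ, ContDiff ℝ (⊤ : ℕ∞) φ →
        (∀ (θ : Euc d) (z : Fin d → ℤ), φ (θ + zvec z) = φ θ) →
      ∃ V : Euc d → ℝ → Fin m → ℝ, IsLiftedDirSol hd A n M φ V ∧
        ∀ (l : List (Fin d)) (j : ℕ),
          (∫ t in Set.Ioi (0:ℝ), ∫ θ in unitCell d,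
              ((∑ α, ∑ k ∈ tanIdx d hd,
                  (liftD hd M k (dthMulti l (dtj j fun a b => V a b α)) θ t) ^ 2)
                + ∑ α, (dthMulti l (dtj (j + 1) fun a b => V a b α) θ t) ^ 2))
            ≤ (C l.length j * CkNorm (l.length + j + 1) φ) ^ 2 := by
  exact final_thm d m hd A
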